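/- arXiv:0912.5003 — 3 statements merged into one kernel-verified Lean document; each statement's English description precedes it below -/
import Mathlib

section
/- Let Λ be an artin algebra, let p be the maximal length of an indecomposable projective Λ-module and q the maximal length of an indecomposable injective Λ-module. If X ⊂ Y is a Gabriel-Roiter inclusion, then |Y| ≤ pq·|X|. -/
/-!
Setting: `k` is a commutative artinian ring and `Λ` an artin `k`-algebra
(an algebra over `k` which is finitely generated as a `k`-module).
All modules considered are `Λ`-modules of finite length (`IsFiniteLength Λ M`),
and `|M|` denotes the length of `M`, implemented as the height
`Order.height (⊤ : Submodule Λ M)` of the lattice of submodules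
(for a submodule `N` of an ambient module, its length is `Order.height N`).
-/

universe u v

open Submodule

section GRDefs

variable (Λ : Type u) [Ring Λ]

/-- A submodule `N` of an ambient module is indecomposable (as a module):
it is nonzero, and whenever it is the direct sum of two submodules, one of them is zero. -/
def IndecSub {Y : Type v} [AddCommGroup Y] [Module Λ Y] (N : Submodule Λ Y) : Prop :=
  N ≠ ⊥ ∧ ∀ A B : Submodule Λ Y, A ≤ N → B ≤ N → A ⊔ B = N → A ⊓ B = ⊥ → A = ⊥ ∨ B = ⊥

/-- A module is indecomposable iff its top submodule is. -/
def IndecMod (M : Type v) [AddCommGroup M] [Module Λ M] : Prop :=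
  IndecSub Λ (⊤ : Submodule Λ M)

/-- The length `|M|` of a module, as an extended natural number. -/
noncomputable def modLen (M : Type v) [AddCommGroup M] [Module Λ M] : ℕ∞ :=
  Order.height (⊤ : Submodule Λ M)

/-- The length `|N|` of a submodule of an ambient module, as a natural number. -/
noncomputable def subLen {Y : Type v} [AddCommGroup Y] [Module Λ Y] (N : Submodule Λ Y) : ℕ :=
  (Order.height N).toNat

open Classical in
/-- Fuel-based auxiliary function for the Gabriel-Roiter measure. -/
noncomputable def muAux {Y : Type v} [AddCommGroup Y] [Module Λ Y] :
    ℕ → Submodule Λ Y → ℝ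
  | 0, _ => 0
  | n + 1, N =>
      (if IndecSub Λ N then (2 : ℝ) ^ (-(subLen Λ N : ℤ)) else 0)
        + sSup (muAux n '' {N' : Submodule Λ Y | N' < N})

/-- The Gabriel-Roiter measure `μ(N)` of a submodule `N` of an ambient module:
`μ(0) = 0`; if `N ≠ 0` is decomposable, `μ(N)` is the maximum of `μ(N')` over proper
submodules `N'` of `N`; if `N` is indecomposable, `μ(N) = 2^(-|N|)` plus this maximum.
(For modules of finite length the supremum is a maximum and the fuel `|N|` suffices for
the recursion, so this agrees with the usual inductive definition; the measure of a
submodule depends only on the sublattice of its submodules, hence it does not matter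
in which ambient module it is computed.) -/
noncomputable def mu {Y : Type v} [AddCommGroup Y] [Module Λ Y] (N : Submodule Λ Y) : ℝ :=
  muAux Λ (subLen Λ N) N

/-- The Gabriel-Roiter measure of a module. -/
noncomputable def muMod (M : Type v) [AddCommGroup M] [Module Λ M] : ℝ :=
  mu Λ (⊤ : Submodule Λ M)

/-- `X` is a Gabriel-Roiter submodule of the (indecomposable, non-simple) ambient
module `Y`: `X` is an indecomposable proper submodule with `μ(Y) = μ(X) + 2^(-|Y|)`. -/
def IsGRSub {Y : Type v} [AddCommGroup Y] [Module Λ Y] (X : Submodule Λ Y) : Prop :=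
  IndecMod Λ Y ∧ IndecSub Λ X ∧ X ≠ ⊤ ∧
    mu Λ (⊤ : Submodule Λ Y) = mu Λ X + (2 : ℝ) ^ (-(subLen Λ (⊤ : Submodule Λ Y) : ℤ))

/-- A map `u : X → Y` is a Gabriel-Roiter inclusion iff it is injective and its
image is a Gabriel-Roiter submodule of `Y`. -/
def IsGRInclusion {X Y : Type v} [AddCommGroup X] [Module Λ X] [AddCommGroup Y] [Module Λ Y]
    (u : X →ₗ[Λ] Y) : Prop :=
  Function.Injective u ∧ IsGRSub Λ (LinearMap.range u)

/-- A linear map is a split monomorphism. -/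
def IsSplitMonoHom {A B : Type v} [AddCommGroup A] [Module Λ A] [AddCommGroup B] [Module Λ B]
    (f : A →ₗ[Λ] B) : Prop :=
  ∃ g : B →ₗ[Λ] A, g.comp f = LinearMap.id

/-- A linear map is a split epimorphism. -/
def IsSplitEpiHom {A B : Type v} [AddCommGroup A] [Module Λ A] [AddCommGroup B] [Module Λ B]
    (f : A →ₗ[Λ] B) : Prop :=
  ∃ g : B →ₗ[Λ] A, f.comp g = LinearMap.id

/-- A morphism `f` in the category of finite length `Λ`-modules is irreducible if it is
neither a split monomorphism nor a split epimorphism and, whenever `f = g ∘ h` with the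
intermediate module of finite length, either `h` is a split monomorphism or `g` is a
split epimorphism. -/
def IsIrreducibleHom {A B : Type v} [AddCommGroup A] [Module Λ A] [AddCommGroup B] [Module Λ B]
    (f : A →ₗ[Λ] B) : Prop :=
  ¬ IsSplitMonoHom Λ f ∧ ¬ IsSplitEpiHom Λ f ∧
    ∀ (Z : Type v) [AddCommGroup Z] [Module Λ Z], IsFiniteLength Λ Z →
      ∀ (h : A →ₗ[Λ] Z) (g : Z →ₗ[Λ] B), f = g.comp h →
        IsSplitMonoHom Λ h ∨ IsSplitEpiHom Λ g

/-- An indecomposable submodule `U` of the ambient module is piling provided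
`μ(V) ≤ μ(U)` for every indecomposable submodule `V` with `|V| ≤ |U|`. -/
def IsPilingSub {Y : Type v} [AddCommGroup Y] [Module Λ Y] (U : Submodule Λ Y) : Prop :=
  IndecSub Λ U ∧ ∀ V : Submodule Λ Y, IndecSub Λ V →
    Order.height V ≤ Order.height U → mu Λ V ≤ mu Λ U

/-- A Gabriel-Roiter filtration `c 0 ⊂ c 1 ⊂ ⋯ ⊂ c t = N` of an (indecomposable)
submodule `N`: a chain of indecomposable submodules starting at a simple module such
that each inclusion `c i ⊂ c (i+1)` is a Gabriel-Roiter inclusion,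
i.e. `μ(c (i+1)) = μ(c i) + 2^(-|c (i+1)|)`. -/
def IsGRFiltration {Y : Type v} [AddCommGroup Y] [Module Λ Y] {t : ℕ}
    (c : Fin (t + 1) → Submodule Λ Y) (N : Submodule Λ Y) : Prop :=
  c (Fin.last t) = N ∧
  IsSimpleModule Λ (c 0) ∧
  (∀ i : Fin (t + 1), IndecSub Λ (c i)) ∧
  ∀ i : Fin t, c i.castSucc < c i.succ ∧
    mu Λ (c i.succ) = mu Λ (c i.castSucc) + (2 : ℝ) ^ (-(subLen Λ (c i.succ) : ℤ))

/-- A brick: a nonzero module all of whose nonzero endomorphisms are invertible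
(i.e. the endomorphism ring is a division ring). -/
def IsBrick (M : Type v) [AddCommGroup M] [Module Λ M] : Prop :=
  (∃ x : M, x ≠ 0) ∧ ∀ f : M →ₗ[Λ] M, f ≠ 0 → Function.Bijective f

/-- An `M`-filtration `0 = c 0 ⊂ c 1 ⊂ ⋯ ⊂ c m = Y` of the module `Y`
(so `c j` is the module `M[j]`, with `M[0] = 0`, and the `M`-length of `Y` is `m`):
all consecutive factors `c (i+1) / c i` are isomorphic to `M`. -/
structure IsMFiltration (M : Type v) [AddCommGroup M] [Module Λ M]
    {Y : Type v} [AddCommGroup Y] [Module Λ Y] {m : ℕ}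
    (c : Fin (m + 1) → Submodule Λ Y) : Prop where
  bot : c 0 = ⊥
  top : c (Fin.last m) = ⊤
  lt : ∀ i : Fin m, c i.castSucc < c i.succ
  quot : ∀ i : Fin m,
    Nonempty ((↥(c i.succ) ⧸ comap (c i.succ).subtype (c i.castSucc)) ≃ₗ[Λ] M)

/-- A homogeneous `M`-filtration: an `M`-filtration in which moreover all the
`M[i] = c i` with `i ≥ 1` are indecomposable and all the inclusions
`M[i-1] ⊂ M[i]` for `2 ≤ i ≤ m` are irreducible monomorphisms. -/
structure IsHomogMFiltration (M : Type v) [AddCommGroup M] [Module Λ M]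
    {Y : Type v} [AddCommGroup Y] [Module Λ Y] {m : ℕ}
    (c : Fin (m + 1) → Submodule Λ Y) extends IsMFiltration Λ M c : Prop where
  indec : ∀ i : Fin (m + 1), i ≠ 0 → IndecSub Λ (c i)
  irr : ∀ i : Fin m, (i : ℕ) ≠ 0 →
    IsIrreducibleHom Λ (Submodule.inclusion (toIsMFiltration.lt i).le)

end GRDefs

section Measure

variable {Λ : Type u} [Ring Λ] {Y : Type v} [AddCommGroup Y] [Module Λ Y]

lemma IndecSub.ne_bot {N : Submodule Λ Y} (h : IndecSub Λ N) : N ≠ ⊥ := h.1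

open Classical in
/-- The contribution of `N` itself to its Gabriel-Roiter measure. -/
noncomputable def ownWeight (N : Submodule Λ Y) : ℝ :=
  if IndecSub Λ N then ((2 : ℝ) ^ subLen Λ N)⁻¹ else 0

lemma ownWeight_nonneg (N : Submodule Λ Y) : 0 ≤ ownWeight N := by
  rw [ownWeight]
  split_ifs
  · positivity
  · rfl

lemma ownWeight_of_indec {N : Submodule Λ Y} (h : IndecSub Λ N) :
    ownWeight N = ((2 : ℝ) ^ subLen Λ N)⁻¹ := if_pos h

lemma muAux_succ (n : ℕ) (N : Submodule Λ Y) :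
    muAux Λ (n + 1) N = ownWeight N + sSup (muAux Λ n '' {N' | N' < N}) := by
  simp [muAux, ownWeight]

lemma muAux_succ_bot (n : ℕ) : muAux Λ (n + 1) (⊥ : Submodule Λ Y) = 0 := by
  rw [muAux_succ, ownWeight, if_neg fun h => h.ne_bot rfl]
  simp

variable [IsArtinian Λ Y] [IsNoetherian Λ Y]

lemma coe_subLen (N : Submodule Λ Y) : (subLen Λ N : ℕ∞) = Order.height N :=
  ENat.natCast_toNat N.height_lt_top.ne

lemma subLen_lt_subLen {N M : Submodule Λ Y} (h : N < M) : subLen Λ N < subLen Λ M := by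
  have := Submodule.height_strictMono h
  rwa [← coe_subLen, ← coe_subLen, Nat.cast_lt] at this

lemma subLen_le_subLen {N M : Submodule Λ Y} (h : N ≤ M) : subLen Λ N ≤ subLen Λ M := by
  rcases h.eq_or_lt with rfl | h
  · rfl
  · exact (subLen_lt_subLen h).le

lemma subLen_eq_zero_iff {N : Submodule Λ Y} : subLen Λ N = 0 ↔ N = ⊥ := by
  rw [← Nat.cast_inj (R := ℕ∞), coe_subLen, Nat.cast_zero, Order.height_eq_zero, isMin_iff_eq_bot]

lemma muAux_eq_mu (n : ℕ) : ∀ N : Submodule Λ Y, subLen Λ N ≤ n → muAux Λ n N = mu Λ N := by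
  induction n using Nat.strong_induction_on with
  | _ n ih =>
    intro N hN
    rcases hm : subLen Λ N with _ | m
    · rw [mu, hm]
      rw [subLen_eq_zero_iff] at hm
      subst hm
      rcases n with _ | n
      · rfl
      · rw [muAux_succ_bot, muAux]
    · rcases n with _ | n
      · omega
      · rw [mu, hm, muAux_succ, muAux_succ]
        congr 2
        refine Set.image_congr fun N' hN' => ?_
        have := subLen_lt_subLen (show N' < N from hN')
        rw [ih n (by omega) N' (by omega), ih m (by omega) N' (by omega)]

lemma mu_eq (N : Submodule Λ Y) : mu Λ N = ownWeight N + sSup (mu Λ '' Set.Iio N) := by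
  rw [← muAux_eq_mu (subLen Λ N + 1) N (by omega), muAux_succ]
  congr 2
  refine Set.image_congr fun N' hN' => ?_
  exact muAux_eq_mu _ _ (subLen_lt_subLen (show N' < N from hN')).le

lemma finite_of_dyadic {s : Set ℝ} (n : ℕ)
    (h : ∀ x ∈ s, 0 ≤ x ∧ x ≤ 1 ∧ ∃ z : ℤ, x * 2 ^ n = z) : s.Finite := by
  refine ((Set.finite_Icc (0 : ℤ) (2 ^ n)).image fun z : ℤ => (z : ℝ) / 2 ^ n).subset ?_
  rintro x hx
  obtain ⟨h0, h1, z, hz⟩ := h x hx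
  refine ⟨z, ⟨?_, ?_⟩, ?_⟩
  · have : (0 : ℝ) ≤ z := hz ▸ by positivity
    exact_mod_cast this
  · have : (z : ℝ) ≤ 2 ^ n := hz ▸ by nlinarith [show (0 : ℝ) < 2 ^ n by positivity]
    exact_mod_cast this
  · simp only
    rw [← hz]
    field_simp

lemma dyadic_mono {x : ℝ} {m n : ℕ} (h : m ≤ n) (hx : ∃ z : ℤ, x * 2 ^ m = z) :
    ∃ z : ℤ, x * 2 ^ n = z := by
  obtain ⟨z, hz⟩ := hx
  obtain ⟨d, rfl⟩ := Nat.exists_eq_add_of_le h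
  exact ⟨z * 2 ^ d, by push_cast; rw [pow_add, ← mul_assoc, hz]⟩

lemma mu_dyadic (N : Submodule Λ Y) :
    0 ≤ mu Λ N ∧ mu Λ N ≤ 1 - ((2 : ℝ) ^ subLen Λ N)⁻¹ ∧
      ∃ z : ℤ, mu Λ N * 2 ^ subLen Λ N = z := by
  induction N using WellFoundedLT.induction with
  | ind N ih =>
    rcases eq_or_ne N ⊥ with rfl | hN
    · have h0 : subLen Λ (⊥ : Submodule Λ Y) = 0 := subLen_eq_zero_iff.2 rfl
      have : mu Λ (⊥ : Submodule Λ Y) = 0 := by rw [mu, h0, muAux]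
      rw [this, h0]
      simpa using ⟨0, by simp⟩
    · have hne : (mu Λ '' Set.Iio N).Nonempty := ⟨_, ⊥, bot_lt_iff_ne_bot.2 hN, rfl⟩
      have hfin : (mu Λ '' Set.Iio N).Finite := by
        refine finite_of_dyadic (subLen Λ N) ?_
        rintro _ ⟨N', hN', rfl⟩
        obtain ⟨h0, h1, h2⟩ := ih N' hN'
        refine ⟨h0, h1.trans ?_, dyadic_mono (subLen_lt_subLen hN').le h2⟩
        have : (0 : ℝ) < ((2 : ℝ) ^ subLen Λ N')⁻¹ := by positivity
        linarith
      obtain ⟨N', hN', he⟩ := hne.csSup_mem hfin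
      rw [mu_eq, ← he]
      obtain ⟨h0, h1, h2⟩ := ih N' hN'
      have hlt := subLen_lt_subLen (show N' < N from hN')
      have hw : ownWeight N ≤ ((2 : ℝ) ^ subLen Λ N)⁻¹ := by
        rw [ownWeight]; split_ifs
        · rfl
        · positivity
      have hw0 := ownWeight_nonneg N
      refine ⟨by positivity, ?_, ?_⟩
      · have : 2 * ((2 : ℝ) ^ subLen Λ N)⁻¹ ≤ ((2 : ℝ) ^ subLen Λ N')⁻¹ := by
          have h3 : ((2 : ℝ) ^ subLen Λ N)⁻¹ ≤ ((2 : ℝ) ^ (subLen Λ N' + 1))⁻¹ := by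
            gcongr
            · norm_num
            · exact hlt
          rw [pow_succ, mul_inv] at h3
          linarith
        linarith
      · obtain ⟨z, hz⟩ := dyadic_mono hlt.le h2
        rw [add_mul, hz, ownWeight]
        split_ifs
        · exact ⟨1 + z, by push_cast; rw [inv_mul_cancel₀ (by positivity)]⟩
        · exact ⟨z, by simp⟩

lemma finite_mu_image (s : Set (Submodule Λ Y)) : (mu Λ '' s).Finite := by
  refine finite_of_dyadic (subLen Λ (⊤ : Submodule Λ Y)) ?_
  rintro _ ⟨N, -, rfl⟩
  obtain ⟨h0, h1, h2⟩ := mu_dyadic N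
  have : (0 : ℝ) < ((2 : ℝ) ^ subLen Λ N)⁻¹ := by positivity
  exact ⟨h0, by linarith, dyadic_mono (subLen_le_subLen le_top) h2⟩

lemma mu_add_ownWeight_le {N M : Submodule Λ Y} (h : N < M) : mu Λ N + ownWeight M ≤ mu Λ M := by
  rw [mu_eq M]
  have := le_csSup (finite_mu_image (Set.Iio M)).bddAbove ⟨N, h, rfl⟩
  linarith

lemma mu_mono {N M : Submodule Λ Y} (h : N ≤ M) : mu Λ N ≤ mu Λ M := by
  rcases h.eq_or_lt with rfl | h
  · rfl
  · linarith [mu_add_ownWeight_le h, ownWeight_nonneg M]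

lemma exists_mu_eq {N : Submodule Λ Y} (h : N ≠ ⊥) :
    ∃ N' < N, mu Λ N = ownWeight N + mu Λ N' := by
  have hne : (mu Λ '' Set.Iio N).Nonempty := ⟨_, ⊥, bot_lt_iff_ne_bot.2 h, rfl⟩
  obtain ⟨N', hN', he⟩ := hne.csSup_mem (finite_mu_image _)
  exact ⟨N', hN', by rw [mu_eq, he]⟩

/-- The measure of a submodule is attained at an indecomposable submodule. -/
lemma exists_indec_mu_eq (N : Submodule Λ Y) :
    ∃ N' ≤ N, mu Λ N' = mu Λ N ∧ (N' = ⊥ ∨ IndecSub Λ N') := by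
  induction N using WellFoundedLT.induction with
  | ind N ih =>
    by_cases hN : N = ⊥ ∨ IndecSub Λ N
    · exact ⟨N, le_rfl, rfl, hN⟩
    · push Not at hN
      obtain ⟨M, hM, he⟩ := exists_mu_eq hN.1
      obtain ⟨N', h1, h2, h3⟩ := ih M hM
      refine ⟨N', h1.trans hM.le, ?_, h3⟩
      rw [h2, he, ownWeight, if_neg hN.2, zero_add]

end Measure

section Indecomposable

variable {Λ : Type u} [Ring Λ] {Y : Type v} [AddCommGroup Y] [Module Λ Y]

lemma indecSub_range_iff {M : Type*} [AddCommGroup M] [Module Λ M] (f : M →ₗ[Λ] Y)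
    (hf : Function.Injective f) : IndecSub Λ (LinearMap.range f) ↔ IndecMod Λ M := by
  have hmap : ∀ A : Submodule Λ M, A.map f = ⊥ ↔ A = ⊥ := fun A => by
    rw [← Submodule.map_bot f, (Submodule.map_injective_of_injective hf).eq_iff]
  constructor
  · rintro ⟨h0, h⟩
    refine ⟨fun ht => h0 ?_, fun A B _ _ hs hi => ?_⟩
    · rw [LinearMap.range_eq_map, ht, Submodule.map_bot]
    · have := h (A.map f) (B.map f) (LinearMap.map_le_range) (LinearMap.map_le_range)
        (by rw [← Submodule.map_sup, hs, LinearMap.range_eq_map])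
        (by rw [← Submodule.map_inf f hf, hi, Submodule.map_bot])
      rwa [hmap, hmap] at this
  · rintro ⟨h0, h⟩
    refine ⟨fun ht => h0 ?_, fun A B hA hB hs hi => ?_⟩
    · rwa [LinearMap.range_eq_map, hmap] at ht
    · have hA' := Submodule.map_comap_eq_of_le hA
      have hB' := Submodule.map_comap_eq_of_le hB
      have := h (A.comap f) (B.comap f) le_top le_top
        (Submodule.map_injective_of_injective hf (by
          rw [Submodule.map_sup, hA', hB', hs, LinearMap.range_eq_map]))
        (by rw [← Submodule.comap_inf, hi, Submodule.comap_bot, LinearMap.ker_eq_bot.2 hf])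
      rwa [← hmap, ← hmap, hA', hB'] at this

lemma indecSub_iff_indecMod {N : Submodule Λ Y} : IndecSub Λ N ↔ IndecMod Λ N := by
  rw [← indecSub_range_iff N.subtype N.injective_subtype, Submodule.range_subtype]

lemma indecMod_congr {M : Type*} [AddCommGroup M] [Module Λ M] (e : M ≃ₗ[Λ] Y) :
    IndecMod Λ Y ↔ IndecMod Λ M := by
  rw [← indecSub_range_iff e.toLinearMap e.injective, LinearEquiv.range, IndecMod]

lemma exists_projections {N A B : Submodule Λ Y} (hs : A ⊔ B = N) (hi : A ⊓ B = ⊥) :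
    ∃ pA pB : N →ₗ[Λ] Y, LinearMap.range pA ≤ A ∧ LinearMap.range pB ≤ B ∧
      ∀ x, pA x + pB x = x := by
  have hA : A ≤ N := hs ▸ le_sup_left
  have hB : B ≤ N := hs ▸ le_sup_right
  have hc : IsCompl (A.comap N.subtype) (B.comap N.subtype) := by
    refine ⟨disjoint_iff.2 ?_, codisjoint_iff.2 ?_⟩
    · rw [← Submodule.comap_inf, hi, Submodule.comap_bot, Submodule.ker_subtype]
    · refine Submodule.map_injective_of_injective N.injective_subtype ?_
      rw [Submodule.map_sup, Submodule.map_comap_subtype, Submodule.map_comap_subtype,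
        inf_eq_right.2 hA, inf_eq_right.2 hB, hs, Submodule.map_top, Submodule.range_subtype]
  refine ⟨N.subtype ∘ₗ Submodule.projection _ _ hc,
    N.subtype ∘ₗ Submodule.projection _ _ hc.symm, ?_, ?_, fun x => ?_⟩
  · rintro _ ⟨x, rfl⟩
    exact Submodule.projection_apply_mem hc x
  · rintro _ ⟨x, rfl⟩
    exact Submodule.projection_apply_mem hc.symm x
  · exact congrArg Subtype.val (Submodule.projection_add_projection_eq_self hc x)

/-- A vector not killed by `h` survives in an indecomposable direct summand of the image. -/
lemma exists_indec_range [IsArtinian Λ Y] {V : Type*} [AddCommGroup V] [Module Λ V] {v : V}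
    (h : V →ₗ[Λ] Y) (hv : h v ≠ 0) :
    ∃ g : V →ₗ[Λ] Y, LinearMap.ker h ≤ LinearMap.ker g ∧
      LinearMap.range g ≤ LinearMap.range h ∧ g v ≠ 0 ∧ IndecSub Λ (LinearMap.range g) := by
  induction hN : LinearMap.range h using WellFoundedLT.induction generalizing h with
  | ind N ih =>
    subst hN
    by_cases hI : IndecSub Λ (LinearMap.range h)
    · exact ⟨h, le_rfl, le_rfl, hv, hI⟩
    have h0 : LinearMap.range h ≠ ⊥ := fun h0 => hv (by
      have : h v ∈ LinearMap.range h := ⟨v, rfl⟩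
      rwa [h0, Submodule.mem_bot] at this)
    have : ∃ A B : Submodule Λ Y, A ⊔ B = LinearMap.range h ∧ A ⊓ B = ⊥ ∧ A ≠ ⊥ ∧ B ≠ ⊥ := by
      by_contra! hc
      refine hI ⟨h0, fun A B _ _ hs hi => ?_⟩
      by_contra! hAB
      exact hAB.2 (hc A B hs hi hAB.1)
    obtain ⟨A, B, hs, hi, hA, hB⟩ := this
    obtain ⟨pA, pB, hpA, hpB, hp⟩ := exists_projections hs hi
    have hlt : ∀ A B : Submodule Λ Y, A ⊔ B = LinearMap.range h → A ⊓ B = ⊥ → B ≠ ⊥ →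
        A < LinearMap.range h := by
      intro A B hs hi hB
      refine lt_of_le_of_ne (hs ▸ le_sup_left) ?_
      rintro rfl
      exact hB (by rwa [inf_eq_right.2 (hs ▸ le_sup_right)] at hi)
    have key : ∀ (A : Submodule Λ Y) (p : LinearMap.range h →ₗ[Λ] Y), A < LinearMap.range h →
        LinearMap.range p ≤ A → p (h.rangeRestrict v) ≠ 0 →
        ∃ g : V →ₗ[Λ] Y, LinearMap.ker h ≤ LinearMap.ker g ∧
          LinearMap.range g ≤ LinearMap.range h ∧ g v ≠ 0 ∧ IndecSub Λ (LinearMap.range g) := by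
      intro A p hA hp hpv
      have hr : LinearMap.range (p ∘ₗ h.rangeRestrict) < LinearMap.range h :=
        ((LinearMap.range_comp_le_range _ _).trans hp).trans_lt hA
      obtain ⟨g, h1, h2, h3, h4⟩ := ih _ hr (p ∘ₗ h.rangeRestrict) hpv rfl
      refine ⟨g, le_trans ?_ h1, h2.trans hr.le, h3, h4⟩
      intro x hx
      have : h.rangeRestrict x = 0 := Subtype.ext hx
      simp [this]
    by_cases hpv : pA (h.rangeRestrict v) = 0
    · refine key B pB (hlt B A (by rwa [sup_comm]) (by rwa [inf_comm]) hA) hpB fun h' => hv ?_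
      have := hp (h.rangeRestrict v)
      rw [hpv, h', add_zero] at this
      exact this.symm
    · exact key A pA (hlt A B hs hi hB) hpA hpv

/-- If a map restricts to an isomorphism from a proper nonzero submodule of an indecomposable
module onto its image, it is injective. -/
lemma IndecSub.injective_of_range_eq {X X' : Submodule Λ Y} (hX : IndecSub Λ X) (hX' : X' ≠ ⊥)
    (hle : X' ≤ X) {V : Type*} [AddCommGroup V] [Module Λ V] (g : X →ₗ[Λ] V)
    (hg : Function.Injective (g ∘ₗ Submodule.inclusion hle))
    (hr : LinearMap.range (g ∘ₗ Submodule.inclusion hle) = LinearMap.range g) :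
    Function.Injective g := by
  rw [indecSub_iff_indecMod] at hX
  rw [← LinearMap.ker_eq_bot]
  refine (hX.2 (LinearMap.range (Submodule.inclusion hle)) _ le_top le_top ?_ ?_).resolve_left ?_
  · refine eq_top_iff.2 fun x _ => ?_
    have : g x ∈ LinearMap.range (g ∘ₗ Submodule.inclusion hle) := hr ▸ ⟨x, rfl⟩
    obtain ⟨y, hy⟩ := this
    refine Submodule.mem_sup.2 ⟨_, ⟨y, rfl⟩, x - Submodule.inclusion hle y, ?_, by simp⟩
    simpa [sub_eq_zero] using hy.symm
  · refine (Submodule.eq_bot_iff _).2 ?_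
    rintro _ ⟨⟨y, rfl⟩, hy⟩
    have : y = 0 := hg (by simpa using hy)
    simp [this]
  · intro h
    refine hX' ((Submodule.eq_bot_iff _).2 fun x hx => ?_)
    have : Submodule.inclusion hle ⟨x, hx⟩ ∈ LinearMap.range (Submodule.inclusion hle) := ⟨_, rfl⟩
    rw [h, Submodule.mem_bot] at this
    exact congrArg Subtype.val this

end Indecomposable

section MainProperty

variable {Λ : Type u} [Ring Λ] {Y : Type v} [AddCommGroup Y] [Module Λ Y]
  [IsArtinian Λ Y] [IsNoetherian Λ Y]

lemma length_eq_subLen (N : Submodule Λ Y) : Module.length Λ N = subLen Λ N := by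
  rw [Module.length_submodule, coe_subLen]

lemma subLen_range {N : Submodule Λ Y} {f : N →ₗ[Λ] Y} (hf : Function.Injective f) :
    subLen Λ (LinearMap.range f) = subLen Λ N := by
  have := (LinearEquiv.ofInjective f hf).length_eq
  rw [length_eq_subLen, length_eq_subLen] at this
  exact_mod_cast this.symm

lemma mu_le_mu_range (N : Submodule Λ Y) (f : N →ₗ[Λ] Y) (hf : Function.Injective f) :
    mu Λ N ≤ mu Λ (LinearMap.range f) := by
  induction N using WellFoundedLT.induction with
  | ind N ih =>
    rcases eq_or_ne N ⊥ with rfl | hN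
    · exact mu_mono bot_le
    obtain ⟨N', hN', he⟩ := exists_mu_eq hN
    have hinj : Function.Injective (f ∘ₗ Submodule.inclusion hN'.le) :=
      hf.comp (Submodule.inclusion_injective hN'.le)
    have h1 := ih N' hN' _ hinj
    have hlt : LinearMap.range (f ∘ₗ Submodule.inclusion hN'.le) < LinearMap.range f := by
      refine lt_of_le_of_ne (LinearMap.range_comp_le_range _ _) fun h => ?_
      have := congrArg (subLen Λ) h
      rw [subLen_range hinj, subLen_range hf] at this
      exact (subLen_lt_subLen hN').ne this
    have h2 := mu_add_ownWeight_le hlt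
    have h3 : ownWeight N ≤ ownWeight (LinearMap.range f) := by
      by_cases hI : IndecSub Λ N
      · rw [ownWeight_of_indec hI, ownWeight_of_indec, subLen_range hf]
        rwa [indecSub_range_iff f hf, ← indecSub_iff_indecMod]
      · rw [ownWeight, if_neg hI]
        exact ownWeight_nonneg _
    linarith

lemma mu_add_inv_two_pow_lt {M N : Submodule Λ Y} {n : ℕ} (h : mu Λ M < mu Λ N)
    (hM : subLen Λ M < n) (hN : subLen Λ N < n) : mu Λ M + ((2 : ℝ) ^ n)⁻¹ < mu Λ N := by
  obtain ⟨n, rfl⟩ : ∃ m, n = m + 1 := ⟨n - 1, by omega⟩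
  obtain ⟨a, ha⟩ := dyadic_mono (n := n) (by omega) (mu_dyadic M).2.2
  obtain ⟨b, hb⟩ := dyadic_mono (n := n) (by omega) (mu_dyadic N).2.2
  have hpos : (0 : ℝ) < 2 ^ n := by positivity
  have hab : (a : ℝ) + 1 ≤ b := by
    have : (a : ℝ) < b := by rw [← ha, ← hb]; gcongr
    exact_mod_cast this
  rw [← ha, ← hb] at hab
  have h2 : mu Λ M + ((2 : ℝ) ^ n)⁻¹ ≤ mu Λ N := by
    refine le_of_mul_le_mul_right ?_ hpos
    rwa [add_mul, inv_mul_cancel₀ hpos.ne']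
  have h3 : ((2 : ℝ) ^ (n + 1))⁻¹ < ((2 : ℝ) ^ n)⁻¹ := by
    gcongr <;> norm_num
  linarith

/-- If a proper submodule of `X` whose measure differs from that of `X` by at most `2 ^ (-|X|)`
embeds properly into an indecomposable shorter than `X`, the latter has bigger measure. -/
lemma lt_mu_of_range_lt {X X' N : Submodule Λ Y} {g : X' →ₗ[Λ] Y} (hg : Function.Injective g)
    (hX : mu Λ X ≤ mu Λ X' + ((2 : ℝ) ^ subLen Λ X)⁻¹) (hN : IndecSub Λ N)
    (hlt : LinearMap.range g < N) (hl : subLen Λ N < subLen Λ X) : mu Λ X < mu Λ N := by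
  have h1 := mu_le_mu_range X' g hg
  have h2 := mu_add_ownWeight_le hlt
  rw [ownWeight_of_indec hN] at h2
  have h3 : ((2 : ℝ) ^ subLen Λ X)⁻¹ < ((2 : ℝ) ^ subLen Λ N)⁻¹ := by
    gcongr
    norm_num
  linarith

lemma subLen_range_lt {X : Submodule Λ Y} {g : X →ₗ[Λ] Y} (hg : ¬ Function.Injective g) :
    subLen Λ (LinearMap.range g) < subLen Λ X := by
  have h := (g.quotKerEquivRange).length_eq
  rw [← LinearMap.ker_eq_bot] at hg
  have h2 : Module.length Λ (X ⧸ LinearMap.ker g) < Module.length Λ X :=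
    Submodule.length_quotient_lt _ hg
  rw [h, length_eq_subLen, length_eq_subLen] at h2
  exact_mod_cast h2

/-- Gabriel's main property: an indecomposable `X` which is separated by non-injective maps into
`U` has smaller measure than some submodule of `U` shorter than `X`. -/
lemma exists_mu_lt (U X : Submodule Λ Y) (hX : IndecSub Λ X)
    (h : ∀ x : X, x ≠ 0 → ∃ f : X →ₗ[Λ] Y,
      ¬ Function.Injective f ∧ f x ≠ 0 ∧ LinearMap.range f ≤ U) :
    ∃ N ≤ U, subLen Λ N < subLen Λ X ∧ mu Λ X < mu Λ N := by
  induction X using WellFoundedLT.induction with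
  | ind X ih =>
    obtain ⟨M, hM, hXM⟩ := exists_mu_eq hX.1
    obtain ⟨X', hX'M, hX'eq, hX'⟩ := exists_indec_mu_eq M
    have hlt : X' < X := hX'M.trans_lt hM
    have hsub := subLen_lt_subLen hlt
    rw [← hX'eq, ownWeight_of_indec hX, add_comm] at hXM
    have hg : ∀ x : X, x ≠ 0 → ∃ g : X →ₗ[Λ] Y, ¬ Function.Injective g ∧ g x ≠ 0 ∧
        LinearMap.range g ≤ U ∧ IndecSub Λ (LinearMap.range g) := by
      intro x hx
      obtain ⟨f, hf, hfx, hfU⟩ := h x hx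
      obtain ⟨g, h1, h2, h3, h4⟩ := exists_indec_range f hfx
      refine ⟨g, fun hgi => hf ?_, h3, h2.trans hfU, h4⟩
      rw [← LinearMap.ker_eq_bot] at hgi ⊢
      exact le_bot_iff.1 (hgi ▸ h1)
    have final : ∀ g : X →ₗ[Λ] Y, ¬ Function.Injective g → LinearMap.range g ≤ U →
        IndecSub Λ (LinearMap.range g) →
        Function.Injective (g ∘ₗ Submodule.inclusion hlt.le) →
        LinearMap.range (g ∘ₗ Submodule.inclusion hlt.le) ≠ LinearMap.range g →
        ∃ N ≤ U, subLen Λ N < subLen Λ X ∧ mu Λ X < mu Λ N := by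
      intro g h1 h2 h3 h4 h5
      refine ⟨_, h2, subLen_range_lt h1, lt_mu_of_range_lt h4 hXM.le h3 ?_ (subLen_range_lt h1)⟩
      exact lt_of_le_of_ne (LinearMap.range_comp_le_range _ _) h5
    rcases hX' with rfl | hX'
    · obtain ⟨x, hx, hx0⟩ := X.ne_bot_iff.1 hX.1
      obtain ⟨g, h1, h2, h3, h4⟩ := hg ⟨x, hx⟩ fun h => hx0 (congrArg Subtype.val h)
      refine final g h1 h3 h4 (Function.injective_of_subsingleton _) fun h => h4.1 ?_
      rw [← h, Submodule.eq_bot_iff]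
      rintro _ ⟨y, rfl⟩
      rw [Subsingleton.elim y 0, map_zero]
    · by_cases hs : ∀ x : X', x ≠ 0 → ∃ f : X' →ₗ[Λ] Y,
          ¬ Function.Injective f ∧ f x ≠ 0 ∧ LinearMap.range f ≤ U
      · obtain ⟨N, hNU, hN, hmu⟩ := ih X' hlt hX' hs
        exact ⟨N, hNU, hN.trans hsub,
          hXM.trans_lt (mu_add_inv_two_pow_lt hmu hsub (hN.trans hsub))⟩
      · push Not at hs
        obtain ⟨x, hx, hs⟩ := hs
        obtain ⟨g, h1, h2, h3, h4⟩ := hg (Submodule.inclusion hlt.le x) fun h =>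
          hx (Submodule.inclusion_injective hlt.le (by rw [h, map_zero]))
        have hinj : Function.Injective (g ∘ₗ Submodule.inclusion hlt.le) := by
          by_contra hc
          exact hs _ hc h2 ((LinearMap.range_comp_le_range _ _).trans h3)
        exact final g h1 h3 h4 hinj fun h =>
          h1 (hX.injective_of_range_eq hX'.1 hlt.le g hinj h)

/-- A Gabriel-Roiter submodule splits off from every proper submodule containing it. -/
lemma IsGRSub.exists_retraction {X U : Submodule Λ Y} (hX : IsGRSub Λ X) (hXU : X ≤ U)
    (hU : U ≠ ⊤) : ∃ r : U →ₗ[Λ] X, ∀ x : X, r (Submodule.inclusion hXU x) = x := by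
  obtain ⟨hY, hXi, -, hmu⟩ := hX
  have hle : ∀ N ≤ U, mu Λ N ≤ mu Λ X := by
    intro N hN
    have := mu_add_ownWeight_le (hN.trans_lt hU.lt_top)
    rw [ownWeight_of_indec hY, hmu, zpow_neg, zpow_natCast] at this
    linarith
  obtain ⟨x, hx⟩ : ∃ x : X, x ≠ 0 ∧ ∀ f : X →ₗ[Λ] Y, f x ≠ 0 → LinearMap.range f ≤ U →
      Function.Injective f := by
    by_contra! hc
    obtain ⟨N, hN, -, hlt⟩ := exists_mu_lt U X hXi fun x hx => by
      obtain ⟨f, h1, h2, h3⟩ := hc x hx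
      exact ⟨f, h3, h1, h2⟩
    exact (hle N hN).not_gt hlt
  obtain ⟨g, -, h2, h3, h4⟩ := exists_indec_range (v := Submodule.inclusion hXU x) U.subtype
    (by simpa using hx.1)
  rw [Submodule.range_subtype] at h2
  have hinj := hx.2 (g ∘ₗ Submodule.inclusion hXU) h3 ((LinearMap.range_comp_le_range _ _).trans h2)
  have hr : LinearMap.range (g ∘ₗ Submodule.inclusion hXU) = LinearMap.range g := by
    by_contra hne
    have h5 := mu_add_ownWeight_le (lt_of_le_of_ne (LinearMap.range_comp_le_range _ _) hne)
    have h6 := mu_le_mu_range X _ hinj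
    have h7 := hle _ h2
    rw [ownWeight_of_indec h4] at h5
    have : (0 : ℝ) < ((2 : ℝ) ^ subLen Λ (LinearMap.range g))⁻¹ := by positivity
    linarith
  let e := LinearEquiv.ofInjective _ hinj
  refine ⟨e.symm.toLinearMap ∘ₗ
    (LinearEquiv.ofEq _ _ hr.symm).toLinearMap ∘ₗ g.rangeRestrict, fun y => ?_⟩
  refine e.injective ?_
  simp only [LinearMap.comp_apply, LinearEquiv.coe_coe, LinearEquiv.apply_symm_apply]
  rfl

end MainProperty

section Separation

lemma exists_separating {k : Type*} [CommRing k] {m : Ideal k} [m.IsMaximal]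
    {G V W : Type*} [AddCommGroup G] [AddCommGroup V] [AddCommGroup W]
    [Module k G] [Module k V] [Module k W] [Module.Finite k V] [Nontrivial W]
    (hV : Module.IsTorsionBySet k V m) (hW : Module.IsTorsionBySet k W m)
    (B : G →ₗ[k] V →ₗ[k] W) (hB : ∀ v ≠ 0, ∀ w, ∃ g, B g v = w)
    (H : Submodule k V) {f : V} (hf : f ∉ H) : ∃ g, ∀ h ∈ H, B g f ≠ B g h := by
  let : Field (k ⧸ m) := Ideal.Quotient.field m
  let : Module (k ⧸ m) V := hV.module
  let : Module (k ⧸ m) W := hW.module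
  have hVs : ∀ (r : k) (x : V), Ideal.Quotient.mk m r • x = r • x := fun _ _ => rfl
  have hWs : ∀ (r : k) (x : W), Ideal.Quotient.mk m r • x = r • x := fun _ _ => rfl
  have : IsScalarTower k (k ⧸ m) V := hV.isScalarTower
  have : Module.Finite (k ⧸ m) V := Module.Finite.of_restrictScalars_finite k _ _
  obtain ⟨w, hw⟩ := exists_ne (0 : W)
  obtain ⟨l, hl⟩ := Module.Projective.exists_dual_ne_zero (k ⧸ m) hw
  let Φ : Submodule (k ⧸ m) (Module.Dual (k ⧸ m) V) :=
    { carrier := {ψ | ∃ g, ∀ v, ψ v = l (B g v)}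
      zero_mem' := ⟨0, by simp⟩
      add_mem' := by
        rintro a b ⟨g, hg⟩ ⟨g', hg'⟩
        exact ⟨g + g', by simp [hg, hg']⟩
      smul_mem' := by
        rintro c a ⟨g, hg⟩
        obtain ⟨r, rfl⟩ := Ideal.Quotient.mk_surjective c
        refine ⟨r • g, fun v => ?_⟩
        rw [map_smul, LinearMap.smul_apply, LinearMap.smul_apply, ← hWs, map_smul, hg] }
  have hΦ0 : Φ.dualCoannihilator = ⊥ := by
    refine (Submodule.eq_bot_iff _).2 fun v hv => ?_
    by_contra hne
    obtain ⟨g, hg⟩ := hB v hne w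
    rw [Submodule.mem_dualCoannihilator] at hv
    refine hl ?_
    rw [← hg]
    refine hv ⟨⟨fun v => l (B g v), fun x y => by simp⟩, fun c x => ?_⟩ ⟨g, fun v => rfl⟩
    obtain ⟨r, rfl⟩ := Ideal.Quotient.mk_surjective c
    simp only [RingHom.id_apply]
    rw [hVs, map_smul, ← hWs, map_smul]
  have hΦ : Φ = ⊤ := by
    rw [← Subspace.dualCoannihilator_dualAnnihilator_eq (W := Φ), hΦ0]
    exact Submodule.dualAnnihilator_bot
  let H' : Submodule (k ⧸ m) V :=
    { H.toAddSubmonoid with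
      smul_mem' := by
        rintro c x hx
        obtain ⟨r, rfl⟩ := Ideal.Quotient.mk_surjective c
        exact H.smul_mem r hx }
  obtain ⟨ψ, hψf, hψ⟩ := Submodule.exists_le_ker_of_notMem (show f ∉ H' from hf)
  obtain ⟨g, hg⟩ : ψ ∈ Φ := hΦ ▸ Submodule.mem_top
  refine ⟨g, fun h hh he => hψf ?_⟩
  rw [hg, he, ← hg]
  exact hψ hh

variable {k : Type u} [CommRing k] {Λ : Type u} [Ring Λ] [Algebra k Λ]

lemma finite_hom [IsNoetherianRing k] (M N : Type*) [AddCommGroup M] [AddCommGroup N]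
    [Module Λ M] [Module Λ N] [Module k M] [Module k N] [IsScalarTower k Λ M]
    [IsScalarTower k Λ N] [Module.Finite k M] [Module.Finite k N] :
    Module.Finite k (M →ₗ[Λ] N) := by
  obtain ⟨n, s, hs⟩ := Module.Finite.exists_fin' k M
  let F : (M →ₗ[Λ] N) →ₗ[k] (Fin n → N) :=
    { toFun := fun f i => f (s (Pi.single i 1))
      map_add' := fun _ _ => rfl
      map_smul' := fun _ _ => rfl }
  refine Module.Finite.of_injective F fun f g hfg => ?_
  have : f.restrictScalars k ∘ₗ s = g.restrictScalars k ∘ₗ s :=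
    LinearMap.pi_ext' fun i => LinearMap.ext_ring (congrFun hfg i)
  ext x
  obtain ⟨y, rfl⟩ := hs x
  exact LinearMap.congr_fun this y

lemma IsFiniteLength.finite_restrictScalars [Module.Finite k Λ] {M : Type*} [AddCommGroup M]
    [Module Λ M] [Module k M] [IsScalarTower k Λ M] (h : IsFiniteLength Λ M) :
    Module.Finite k M := by
  have := (isFiniteLength_iff_isNoetherian_isArtinian.1 h).1
  exact Module.Finite.trans Λ M

/-- The `k`-annihilator of a simple module is a maximal ideal. -/
lemma annihilator_isMaximal [IsArtinianRing k] (S : Type*) [AddCommGroup S] [Module Λ S]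
    [Module k S] [IsScalarTower k Λ S] [IsSimpleModule Λ S] :
    (Module.annihilator k S).IsMaximal := by
  have := IsSimpleModule.nontrivial Λ S
  have hp : (Module.annihilator k S).IsPrime := by
    refine ⟨?_, fun {x y} hxy => ?_⟩
    · rw [Ideal.ne_top_iff_one, Module.mem_annihilator]
      intro h
      obtain ⟨s, hs⟩ := exists_ne (0 : S)
      exact hs (by simpa using h s)
    · rw [Module.mem_annihilator] at hxy
      rw [Module.mem_annihilator, Module.mem_annihilator]
      let F : S →ₗ[Λ] S := y • LinearMap.id
      rcases F.surjective_or_eq_zero with hF | hF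
      · left
        intro s
        obtain ⟨t, rfl⟩ := hF s
        simpa [F, smul_smul] using hxy t
      · right
        intro s
        simpa [F] using LinearMap.congr_fun hF s
  exact IsArtinianRing.isMaximal_of_isPrime _

lemma isTorsionBySet_hom (M N : Type*) [AddCommGroup M] [AddCommGroup N] [Module Λ M] [Module Λ N]
    [Module k N] [IsScalarTower k Λ N] :
    Module.IsTorsionBySet k (M →ₗ[Λ] N) (Module.annihilator k N : Set k) := by
  rintro f ⟨r, hr⟩
  ext x
  exact Module.mem_annihilator.1 hr _

variable {Z : Type v} [AddCommGroup Z] [Module Λ Z] [Module k Z] [IsScalarTower k Λ Z]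

lemma exists_hom_separating [IsArtinianRing k] {S P : Type*} [AddCommGroup S] [Module Λ S]
    [Module k S] [IsScalarTower k Λ S] [IsSimpleModule Λ S] [AddCommGroup P] [Module Λ P]
    [Module k P] [IsScalarTower k Λ P] [Module.Projective Λ P] {φ : P →ₗ[Λ] S} (hφ : φ ≠ 0)
    [Module.Finite k Z] [Module.Finite k S]
    (H : Submodule k (Z →ₗ[Λ] S)) {f : Z →ₗ[Λ] S} (hf : f ∉ H) :
    ∃ g : P →ₗ[Λ] Z, ∀ h ∈ H, f ∘ₗ g ≠ h ∘ₗ g := by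
  have := annihilator_isMaximal (k := k) (Λ := Λ) S
  have := finite_hom (k := k) (Λ := Λ) Z S
  have : Nontrivial (P →ₗ[Λ] S) := ⟨⟨φ, 0, hφ⟩⟩
  let B : (P →ₗ[Λ] Z) →ₗ[k] (Z →ₗ[Λ] S) →ₗ[k] (P →ₗ[Λ] S) :=
    LinearMap.mk₂ k (fun g h => h ∘ₗ g) (fun _ _ _ => LinearMap.comp_add _ _ _)
      (fun c g h => by
        ext x
        exact h.map_smul_of_tower c (g x))
      (fun _ _ _ => rfl) (fun _ _ _ => rfl)
  refine exists_separating (isTorsionBySet_hom Z S) (isTorsionBySet_hom P S) B (fun h hh w => ?_) H hf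
  exact Module.projective_lifting_property h w ((h.surjective_or_eq_zero).resolve_right hh)

variable (k Λ Z) in
/-- Maps `Z → C` can be separated from subspaces of `Hom(Z, C)` by restricting them to
submodules of `Z` of length at most `p` times the length of `C`. -/
def SeparatedByShort (p : ℕ∞) (C : Type v) [AddCommGroup C] [Module Λ C] [Module k C]
    [IsScalarTower k Λ C] : Prop :=
  ∀ (H : Submodule k (Z →ₗ[Λ] C)) (f : Z →ₗ[Λ] C), f ∉ H →
    ∃ Z' : Submodule Λ Z, Module.length Λ Z' ≤ p * Module.length Λ C ∧
      ∀ h ∈ H, ¬ Z' ≤ LinearMap.ker (f - h)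

lemma SeparatedByShort.of_quotient [IsNoetherianRing k] [Module.Finite k Z] {p : ℕ∞} {C : Type v}
    [AddCommGroup C] [Module Λ C] [Module k C] [IsScalarTower k Λ C] [Module.Finite k C]
    {N : Submodule Λ C} (hN : SeparatedByShort k Λ Z p N)
    (hQ : SeparatedByShort k Λ Z p (C ⧸ N)) : SeparatedByShort k Λ Z p C := by
  intro H f hf
  have := finite_hom (k := k) (Λ := Λ) Z C
  obtain ⟨M, ⟨hHM, hfM⟩, hmax⟩ := set_has_maximal_iff_noetherian.2
    (inferInstance : IsNoetherian k (Z →ₗ[Λ] C)) {M | H ≤ M ∧ f ∉ M} ⟨H, le_rfl, hf⟩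
  let L : (Z →ₗ[Λ] N) →ₗ[k] (Z →ₗ[Λ] C) := LinearMap.compRight k N.subtype
  let R : (Z →ₗ[Λ] C) →ₗ[k] (Z →ₗ[Λ] C ⧸ N) := LinearMap.compRight k N.mkQ
  have hspan : ∀ a : Z →ₗ[Λ] N, L a ∉ M → ∃ r : k, f - r • L a ∈ M := by
    intro a ha
    have hlt : M < M ⊔ Submodule.span k {L a} :=
      left_lt_sup.2 fun h => ha (h (Submodule.mem_span_singleton_self _))
    have hfa : f ∈ M ⊔ Submodule.span k {L a} := by
      by_contra hfa
      exact hmax _ ⟨hHM.trans hlt.le, hfa⟩ hlt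
    obtain ⟨m, hm, y, hy, rfl⟩ := Submodule.mem_sup.1 hfa
    obtain ⟨r, rfl⟩ := Submodule.mem_span_singleton.1 hy
    exact ⟨r, by simpa using hm⟩
  have hadd : Module.length Λ C = Module.length Λ N + Module.length Λ (C ⧸ N) :=
    Module.length_eq_add_of_exact N.subtype N.mkQ N.injective_subtype N.mkQ_surjective
      (LinearMap.exact_subtype_mkQ N)
  obtain ⟨Z₁, hZ₁, hZ₁M⟩ : ∃ Z₁ : Submodule Λ Z, Module.length Λ Z₁ ≤ p * Module.length Λ N ∧
      ∀ a : Z →ₗ[Λ] N, Z₁ ≤ LinearMap.ker a → L a ∈ M := by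
    by_cases h : ∀ a, L a ∈ M
    · exact ⟨⊥, by simp, fun a _ => h a⟩
    push Not at h
    obtain ⟨g, hg⟩ := h
    obtain ⟨r, hr⟩ := hspan g hg
    obtain ⟨Z₁, hZ₁, hsep⟩ := hN (M.comap L) (r • g) fun hrg => hfM (by
      rw [Submodule.mem_comap, map_smul] at hrg
      simpa using M.add_mem hr hrg)
    refine ⟨Z₁, hZ₁, fun a ha => ?_⟩
    by_contra haM
    obtain ⟨s, hs⟩ := hspan a haM
    refine hsep (r • g - s • a) ?_ ?_
    · rw [Submodule.mem_comap, map_sub, map_smul, map_smul]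
      simpa using M.sub_mem hs hr
    · rw [sub_sub_cancel]
      intro x hx
      have hax : a x = 0 := ha hx
      simp [hax]
  by_cases hA : ∃ h₀ ∈ M, Z₁ ≤ LinearMap.ker (f - h₀)
  swap
  · refine ⟨Z₁, hZ₁.trans (mul_le_mul_right (hadd ▸ le_self_add) p), fun h hh hle => ?_⟩
    exact hA ⟨h, hHM hh, hle⟩
  obtain ⟨h₀, hh₀, hfh₀⟩ := hA
  let A : Submodule k (Z →ₗ[Λ] C) :=
    { carrier := {x | Z₁ ≤ LinearMap.ker x}
      zero_mem' := by simp
      add_mem' := by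
        intro a b ha hb z hz
        have h1 : a z = 0 := ha hz
        have h2 : b z = 0 := hb hz
        simp [h1, h2]
      smul_mem' := by
        intro c a ha z hz
        have h1 : a z = 0 := ha hz
        simp [h1] }
  obtain ⟨Z₂, hZ₂, hsep⟩ := hQ ((M ⊓ A).map R) (R (f - h₀)) (by
    rintro ⟨b, ⟨hbM, hbA⟩, hb⟩
    have hmem : ∀ z, (f - h₀ - b) z ∈ N := fun z => by
      rw [← Submodule.Quotient.mk_eq_zero, LinearMap.sub_apply, Submodule.Quotient.mk_sub, sub_eq_zero]
      exact (LinearMap.congr_fun hb z).symm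
    have hc : L ((f - h₀ - b).codRestrict N hmem) ∈ M := by
      refine hZ₁M _ ?_
      rw [LinearMap.ker_codRestrict]
      exact A.sub_mem hfh₀ hbA
    have hfb : f - h₀ - b ∈ M := hc
    exact hfM (by simpa using M.add_mem (M.add_mem hfb hbM) hh₀))
  refine ⟨Z₁ ⊔ Z₂, ?_, fun h hh hle => ?_⟩
  · let s : (Z₁ × Z₂) →ₗ[Λ] ↥(Z₁ ⊔ Z₂) :=
      (Submodule.inclusion le_sup_left).coprod (Submodule.inclusion le_sup_right)
    have hs : Function.Surjective s := by
      rintro ⟨z, hz⟩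
      obtain ⟨x, hx, y, hy, rfl⟩ := Submodule.mem_sup.1 hz
      exact ⟨(⟨x, hx⟩, ⟨y, hy⟩), by ext; simp [s]⟩
    calc Module.length Λ ↥(Z₁ ⊔ Z₂) ≤ Module.length Λ (Z₁ × Z₂) :=
          Module.length_le_of_surjective s hs
      _ = Module.length Λ Z₁ + Module.length Λ Z₂ := Module.length_prod _ _ _
      _ ≤ p * Module.length Λ N + p * Module.length Λ (C ⧸ N) := add_le_add hZ₁ hZ₂
      _ = p * Module.length Λ C := by rw [hadd, mul_add]
  · have hA : h - h₀ ∈ A := by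
      have := A.sub_mem (x := f - h₀) (y := f - h) hfh₀ (le_sup_left.trans hle)
      simpa using this
    refine hsep (R (h - h₀)) ⟨h - h₀, ⟨M.sub_mem (hHM hh) hh₀, hA⟩, rfl⟩ fun z hz => ?_
    have hz' : (f - h) z = 0 := hle (le_sup_right (a := Z₁) hz)
    rw [← map_sub, sub_sub_sub_cancel_right, LinearMap.mem_ker]
    change N.mkQ ((f - h) z) = 0
    rw [hz', map_zero]

lemma separatedByShort [IsArtinianRing k] [Module.Finite k Λ] [Module.Finite k Z] {p : ℕ∞}
    (hp : ∀ (S : Type v) [AddCommGroup S] [Module Λ S] [IsSimpleModule Λ S],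
      ∃ P : ModuleCat.{v} Λ, Module.Projective Λ P ∧ Module.length Λ P ≤ p ∧
        ∃ φ : P →ₗ[Λ] S, φ ≠ 0)
    {C : Type v} [AddCommGroup C] [Module Λ C] (hC : IsFiniteLength Λ C) :
    ∀ [Module k C] [IsScalarTower k Λ C], SeparatedByShort k Λ Z p C := by
  induction hC with
  | of_subsingleton =>
    intro _ _ H f hf
    exact absurd (Subsingleton.elim 0 f ▸ H.zero_mem) hf
  | @of_simple_quotient C _ _ N _ hN ih =>
    intro _ _
    have hC : IsFiniteLength Λ C := .of_simple_quotient hN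
    have := hC.finite_restrictScalars (k := k)
    refine SeparatedByShort.of_quotient ih fun H f hf => ?_
    obtain ⟨P, hP, hPp, φ, hφ⟩ := hp (C ⧸ N)
    let : Module k P := Module.compHom P (algebraMap k Λ)
    have : IsScalarTower k Λ P := ⟨fun a b x => by rw [Algebra.smul_def, mul_smul]; rfl⟩
    obtain ⟨g, hg⟩ := exists_hom_separating hφ H hf
    refine ⟨LinearMap.range g, ?_, fun h hh hle => hg h hh ?_⟩
    · rw [Module.length_eq_one Λ (C ⧸ N), mul_one]
      exact (Module.length_le_of_surjective _ g.surjective_rangeRestrict).trans hPp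
    · ext x
      have := hle ⟨x, rfl⟩
      simpa [sub_eq_zero] using this

end Separation

section Projective

variable {k : Type u} [CommRing k] {Λ : Type u} [Ring Λ]

lemma exists_indec_projective [IsArtinian Λ Λ] (S : Type v) [AddCommGroup S] [Module Λ S]
    [Nontrivial S] :
    ∃ P : Submodule Λ Λ, IndecSub Λ P ∧ Module.Projective Λ P ∧ ∃ φ : P →ₗ[Λ] S, φ ≠ 0 := by
  obtain ⟨s, hs⟩ := exists_ne (0 : S)
  let φ : Λ →ₗ[Λ] S := LinearMap.toSpanSingleton Λ S s
  have hφ : φ 1 ≠ 0 := by simpa [φ] using hs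
  obtain ⟨P, ⟨⟨Q, hPQ⟩, hP⟩, hmin⟩ := IsArtinian.set_has_minimal
    {P : Submodule Λ Λ | (∃ Q, IsCompl P Q) ∧ ¬ P ≤ LinearMap.ker φ}
    ⟨⊤, ⟨⊥, isCompl_top_bot⟩, fun h => hφ (h trivial)⟩
  refine ⟨P, ⟨?_, fun A B hA hB hAB hAB' => ?_⟩, ?_, φ ∘ₗ P.subtype, fun h => hP fun x hx => ?_⟩
  · rintro rfl
    exact hP bot_le
  · have key : ∀ A B : Submodule Λ Λ, A ⊔ B = P → A ⊓ B = ⊥ → ∃ Q, IsCompl A Q := by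
      intro A B hAB hAB'
      refine ⟨B ⊔ Q, ?_, ?_⟩
      · exact (disjoint_iff.2 hAB').disjoint_sup_right_of_disjoint_sup_left (hAB ▸ hPQ.disjoint)
      · rw [codisjoint_iff, ← sup_assoc, hAB]
        exact hPQ.sup_eq_top
    by_cases h : A ≤ LinearMap.ker φ
    · have hB' : ¬ B ≤ LinearMap.ker φ := fun h' => hP (hAB ▸ sup_le h h')
      have : B = P := eq_of_le_of_not_lt hB
        (hmin B ⟨key B A (by rw [sup_comm, hAB]) (by rw [inf_comm, hAB']), hB'⟩)
      left
      rw [← hAB', inf_eq_left.2 (this ▸ hA)]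
    · have : A = P := eq_of_le_of_not_lt hA (hmin A ⟨key A B hAB hAB', h⟩)
      right
      rw [← hAB', inf_eq_right.2 (this ▸ hB)]
  · refine Module.Projective.of_split P.subtype (P.projectionOnto Q hPQ) ?_
    ext x
    simp
  · exact LinearMap.congr_fun h ⟨x, hx⟩

lemma IndecMod.isNilpotent_or_surjective {M : Type*} [AddCommGroup M] [Module Λ M]
    [IsArtinian Λ M] [IsNoetherian Λ M] (hM : IndecMod Λ M) (f : Module.End Λ M) :
    IsNilpotent f ∨ Function.Surjective f := by
  obtain ⟨n, hn⟩ := Filter.eventually_atTop.1 f.eventually_isCompl_ker_pow_range_pow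
  have hc := hn (n + 1) n.le_succ
  rcases hM.2 _ _ le_top le_top hc.sup_eq_top hc.inf_eq_bot with h | h
  · right
    have : LinearMap.range (f ^ (n + 1)) = ⊤ := by simpa [h] using hc.sup_eq_top
    intro y
    obtain ⟨x, hx⟩ := LinearMap.range_eq_top.1 this y
    exact ⟨(f ^ n) x, by rw [← hx, pow_succ']; rfl⟩
  · exact Or.inl ⟨n + 1, LinearMap.range_eq_bot.1 h⟩

variable [Algebra k Λ]

lemma small_of_simple [IsArtinianRing k] [Module.Finite k Λ] (S : Type v) [AddCommGroup S]
    [Module Λ S] [Module k S] [IsScalarTower k Λ S] [IsSimpleModule Λ S]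
    (T : Type*) [AddCommGroup T] [Module Λ T] [Module k T] [IsScalarTower k Λ T]
    [IsSimpleModule Λ T] (h : Module.annihilator k S ≤ Module.annihilator k T) : Small.{v} T := by
  have hmax := annihilator_isMaximal (k := k) (Λ := Λ) S
  have := IsSimpleModule.nontrivial Λ S
  obtain ⟨s, hs⟩ := exists_ne (0 : S)
  have hker : LinearMap.ker (LinearMap.toSpanSingleton k S s) = Module.annihilator k S := by
    refine (hmax.eq_of_le ?_ fun r hr => ?_).symm
    · rw [Ne, Ideal.eq_top_iff_one, LinearMap.mem_ker]
      simpa using hs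
    · simpa using Module.mem_annihilator.1 hr s
  have : Small.{v} (k ⧸ Module.annihilator k S) := by
    rw [← hker]
    exact small_of_injective (LinearMap.toSpanSingleton k S s).quotKerEquivRange.injective
  have hT : Module.IsTorsionBySet k T (Module.annihilator k S) := by
    rintro y ⟨r, hr⟩
    exact Module.mem_annihilator.1 (h hr) y
  let : Module (k ⧸ Module.annihilator k S) T := hT.module
  have : IsScalarTower k (k ⧸ Module.annihilator k S) T := hT.isScalarTower
  have : Module.Finite k T := Module.Finite.trans Λ T
  have : Module.Finite (k ⧸ Module.annihilator k S) T :=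
    Module.Finite.of_restrictScalars_finite k _ _
  obtain ⟨n, f, hf⟩ := Module.Finite.exists_fin' (k ⧸ Module.annihilator k S) T
  exact small_of_surjective hf

/-- Finite length modules lying in the same block over `k` as a simple module `S` live in the
universe of `S`. -/
lemma small_of_nilpotent [IsArtinianRing k] [Module.Finite k Λ] (S : Type v) [AddCommGroup S]
    [Module Λ S] [Module k S] [IsScalarTower k Λ S] [IsSimpleModule Λ S]
    {M : Type*} [AddCommGroup M] [Module Λ M] (hM : IsFiniteLength Λ M) :
    ∀ [Module k M] [IsScalarTower k Λ M],
      (∀ x ∈ Module.annihilator k S, ∀ y : M, ∃ n : ℕ, x ^ n • y = 0) → Small.{v} M := by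
  induction hM with
  | of_subsingleton => exact fun _ => inferInstance
  | @of_simple_quotient M _ _ N _ hN ih =>
    intro _ _ h
    have : Small.{v} N := ih fun x hx y => by
      obtain ⟨n, hn⟩ := h x hx y
      exact ⟨n, Subtype.ext hn⟩
    have : Small.{v} (M ⧸ N) := by
      refine small_of_simple (k := k) (Λ := Λ) S _ fun x hx => ?_
      have hmax := annihilator_isMaximal (k := k) (Λ := Λ) (M ⧸ N)
      have := IsSimpleModule.nontrivial Λ (M ⧸ N)
      obtain ⟨y, hy⟩ := exists_ne (0 : M ⧸ N)
      obtain ⟨y, rfl⟩ := N.mkQ_surjective y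
      obtain ⟨n, hn⟩ := h x hx y
      refine hmax.isPrime.mem_of_pow_mem n ?_
      let F : (M ⧸ N) →ₗ[Λ] (M ⧸ N) := x ^ n • LinearMap.id
      have hF : F (N.mkQ y) = 0 := by
        change N.mkQ (x ^ n • y) = 0
        rw [hn, map_zero]
      rw [Module.mem_annihilator]
      intro t
      rcases F.injective_or_eq_zero with hi | h0
      · exact absurd (hi (hF.trans F.map_zero.symm)) hy
      · exact LinearMap.congr_fun h0 t
    refine small_of_surjective (f := fun z : N × (M ⧸ N) => (z.1 : M) + z.2.out) fun y => ?_
    refine ⟨(⟨y - (Submodule.Quotient.mk y : M ⧸ N).out, ?_⟩, Submodule.Quotient.mk y), by simp⟩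
    rw [← Submodule.Quotient.mk_eq_zero, Submodule.Quotient.mk_sub, sub_eq_zero]
    exact (Quotient.out_eq _).symm

/-- Over an artin algebra every simple module is a quotient of an indecomposable projective
module of finite length in the same universe. -/
lemma exists_indec_projective_hom (k : Type u) [CommRing k] [IsArtinianRing k] [Algebra k Λ]
    [Module.Finite k Λ] (S : Type v) [AddCommGroup S] [Module Λ S] [IsSimpleModule Λ S] :
    ∃ P : ModuleCat.{v} Λ, IsFiniteLength Λ P ∧ IndecMod Λ P ∧ Module.Projective Λ P ∧
      ∃ φ : P →ₗ[Λ] S, φ ≠ 0 := by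
  have := IsArtinianRing.of_finite k Λ
  have := IsNoetherianRing.of_finite k Λ
  have := IsSimpleModule.nontrivial Λ S
  obtain ⟨P, hP, hproj, φ, hφ⟩ := exists_indec_projective (Λ := Λ) S
  have hfl : IsFiniteLength Λ P :=
    isFiniteLength_iff_isNoetherian_isArtinian.2 ⟨inferInstance, inferInstance⟩
  let : Module k S := Module.compHom S (algebraMap k Λ)
  have : IsScalarTower k Λ S := ⟨fun a b x => by rw [Algebra.smul_def, mul_smul]; rfl⟩
  have : Small.{v} P := by
    refine small_of_nilpotent (k := k) S hfl fun x hx y => ?_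
    let F : Module.End Λ P := x • LinearMap.id
    rcases (indecSub_iff_indecMod.1 hP).isNilpotent_or_surjective F with ⟨n, hn⟩ | hF
    · refine ⟨n, ?_⟩
      have hFn : ∀ n : ℕ, (F ^ n) y = x ^ n • y := fun n => by
        rw [smul_pow]
        simp
      rw [← hFn, hn]
      rfl
    · refine absurd ?_ hφ
      ext y
      obtain ⟨z, rfl⟩ := hF y
      exact (φ.map_smul_of_tower x z).trans (Module.mem_annihilator.1 hx _)
  let e := Shrink.linearEquiv.{v} Λ P
  refine ⟨ModuleCat.of Λ (Shrink.{v} P), e.symm.isFiniteLength hfl, ?_, ?_, φ ∘ₗ e, ?_⟩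
  · exact (indecMod_congr e).1 (indecSub_iff_indecMod.1 hP)
  · exact inferInstanceAs (Module.Projective Λ (Shrink.{v} P))
  · intro h
    refine hφ (LinearMap.ext fun x => ?_)
    simpa using LinearMap.congr_fun h (e.symm x)

end Projective

section Injective

variable {Λ : Type u} [Ring Λ]

/-- `i : S → U` is an essential monomorphism from a simple module `S`: it is injective and its
image is contained in every nonzero submodule. -/
def IsSocleMap {S U : Type*} [AddCommGroup S] [Module Λ S] [AddCommGroup U] [Module Λ U]
    (i : S →ₗ[Λ] U) : Prop :=
  Function.Injective i ∧ ∀ K : Submodule Λ U, K ≠ ⊥ → LinearMap.range i ≤ K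

lemma LinearMap.range_le_of_not_disjoint {S U : Type*} [AddCommGroup S] [Module Λ S]
    [AddCommGroup U] [Module Λ U] [IsSimpleModule Λ S] (i : S →ₗ[Λ] U) {K : Submodule Λ U}
    (h : ¬ Disjoint K (LinearMap.range i)) : LinearMap.range i ≤ K := by
  rcases eq_bot_or_eq_top (K.comap i) with hb | ht
  · refine absurd ?_ h
    rw [Submodule.disjoint_def]
    rintro _ hx ⟨s, rfl⟩
    have : s ∈ K.comap i := hx
    rw [hb, Submodule.mem_bot] at this
    rw [this, map_zero]
  · rintro _ ⟨s, rfl⟩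
    have : s ∈ K.comap i := ht ▸ Submodule.mem_top
    exact this

section Simple

variable {S U : Type v} [AddCommGroup S] [Module Λ S] [IsSimpleModule Λ S] [AddCommGroup U]
  [Module Λ U] {i : S →ₗ[Λ] U}

lemma IsSocleMap.ne_zero (hi : IsSocleMap i) : i ≠ 0 := by
  have := IsSimpleModule.nontrivial Λ S
  rintro rfl
  obtain ⟨s, hs⟩ := exists_ne (0 : S)
  exact hs (hi.1 (by simp))

lemma IsSocleMap.indecMod (hi : IsSocleMap i) : IndecMod Λ U := by
  refine ⟨fun h => hi.ne_zero ?_, fun A B _ _ _ hAB => ?_⟩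
  · have : LinearMap.range i ≤ ⊥ := le_top.trans h.le
    exact LinearMap.range_eq_bot.1 (le_bot_iff.1 this)
  · by_contra! h
    exact hi.ne_zero (LinearMap.range_eq_bot.1
      (le_bot_iff.1 (hAB ▸ le_inf (hi.2 A h.1) (hi.2 B h.2))))

variable {k : Type u} [CommRing k] [Algebra k Λ] [Module k S] [IsScalarTower k Λ S]
  [Module k U] [IsScalarTower k Λ U]

lemma IsSocleMap.length_hom_simple_le (hi : IsSocleMap i) (T : Type*) [AddCommGroup T]
    [Module Λ T] [IsSimpleModule Λ T] :
    Module.length k (T →ₗ[Λ] U) ≤ Module.length k (S →ₗ[Λ] S) := by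
  have hsurj : Function.Surjective
      (LinearMap.compRight k i : (T →ₗ[Λ] S) →ₗ[k] (T →ₗ[Λ] U)) := by
    intro h
    by_cases h0 : h = 0
    · exact ⟨0, by rw [map_zero, h0]⟩
    have hle : LinearMap.range i ≤ LinearMap.range h :=
      hi.2 _ fun hb => h0 (LinearMap.range_eq_bot.1 hb)
    have hge : LinearMap.range h ≤ LinearMap.range i := by
      refine LinearMap.range_le_of_not_disjoint h fun hd => hi.ne_zero ?_
      exact LinearMap.range_eq_bot.1 (hd.eq_bot_of_le hle)
    refine ⟨(LinearEquiv.ofInjective i hi.1).symm ∘ₗ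
      h.codRestrict (LinearMap.range i) fun t => hge ⟨t, rfl⟩, ?_⟩
    ext t
    change i ((LinearEquiv.ofInjective i hi.1).symm _) = h t
    rw [← LinearEquiv.ofInjective_apply i (h := hi.1), LinearEquiv.apply_symm_apply]
    rfl
  refine (Module.length_le_of_surjective _ hsurj).trans ?_
  by_cases hT : ∀ e : T →ₗ[Λ] S, e = 0
  · have : Subsingleton (T →ₗ[Λ] S) := ⟨fun a b => (hT a).trans (hT b).symm⟩
    rw [Module.length_eq_zero]
    exact zero_le
  · push Not at hT
    obtain ⟨e, he⟩ := hT
    refine Module.length_le_of_surjective (LinearMap.lcomp k S e) fun h => ?_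
    let e' := LinearEquiv.ofBijective e (e.bijective_of_ne_zero he)
    refine ⟨h ∘ₗ e'.symm, ?_⟩
    ext t
    change h (e'.symm (e' t)) = h t
    rw [LinearEquiv.symm_apply_apply]

lemma IsSocleMap.length_hom_le (hi : IsSocleMap i) {M : Type*} [AddCommGroup M] [Module Λ M]
    (hM : IsFiniteLength Λ M) :
    Module.length k (M →ₗ[Λ] U) ≤ Module.length Λ M * Module.length k (S →ₗ[Λ] S) := by
  induction hM with
  | of_subsingleton =>
    rw [Module.length_eq_zero]
    exact zero_le
  | @of_simple_quotient M _ _ N _ hN ih =>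
    let ρ := LinearMap.lcomp k U N.subtype
    let π : ((M ⧸ N) →ₗ[Λ] U) →ₗ[k] (M →ₗ[Λ] U) := LinearMap.lcomp k U N.mkQ
    have hex : Function.Exact π ρ.rangeRestrict := by
      intro h
      rw [← LinearMap.mem_ker, LinearMap.ker_rangeRestrict]
      constructor
      · intro hh
        exact ⟨N.liftQ h fun x hx => LinearMap.congr_fun hh ⟨x, hx⟩, by ext; rfl⟩
      · rintro ⟨h, rfl⟩
        ext x
        change h (N.mkQ x) = 0
        rw [Submodule.mkQ_apply, (Submodule.Quotient.mk_eq_zero N).2 x.2, map_zero]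
    have hπ : Function.Injective π := fun a b hab => by
      refine LinearMap.ext fun x => ?_
      obtain ⟨x, rfl⟩ := N.mkQ_surjective x
      exact LinearMap.congr_fun hab x
    calc Module.length k (M →ₗ[Λ] U)
        = Module.length k ((M ⧸ N) →ₗ[Λ] U) + Module.length k (LinearMap.range ρ) :=
          Module.length_eq_add_of_exact π ρ.rangeRestrict hπ ρ.surjective_rangeRestrict hex
      _ ≤ Module.length k (S →ₗ[Λ] S) + Module.length Λ N * Module.length k (S →ₗ[Λ] S) :=
          add_le_add (hi.length_hom_simple_le _)
            ((Module.length_le_of_injective _ (Submodule.injective_subtype _)).trans ih)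
      _ = Module.length Λ M * Module.length k (S →ₗ[Λ] S) := by
          rw [Module.length_eq_add_of_exact N.subtype N.mkQ N.injective_subtype N.mkQ_surjective
            (LinearMap.exact_subtype_mkQ N), Module.length_eq_one Λ (M ⧸ N), add_mul, one_mul,
            add_comm]

lemma IsSocleMap.length_le (hi : IsSocleMap i) (hΛ : IsFiniteLength Λ Λ) :
    Module.length Λ U ≤ Module.length Λ Λ * Module.length k (S →ₗ[Λ] S) := by
  let ev : (Λ →ₗ[Λ] U) →ₗ[k] U :=
    { toFun := fun h => h 1
      map_add' := fun _ _ => rfl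
      map_smul' := fun _ _ => rfl }
  have hev : Function.Surjective ev := fun y =>
    ⟨LinearMap.toSpanSingleton Λ U y, by simp [ev]⟩
  calc Module.length Λ U = Module.length Λ (⊤ : Submodule Λ U) := Module.length_top.symm
    _ ≤ Module.length k ((⊤ : Submodule Λ U).restrictScalars k) :=
        Submodule.length_le_length_restrictScalars k _
    _ ≤ Module.length k U := Module.length_le_of_injective _ (Submodule.injective_subtype _)
    _ ≤ Module.length k (Λ →ₗ[Λ] U) := Module.length_le_of_surjective ev hev
    _ ≤ _ := hi.length_hom_le hΛ

end Simple

lemma Module.Injective.of_forall_retraction {U : Type v} [AddCommGroup U] [Module Λ U]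
    (h : ∀ (V : Type v) [AddCommGroup V] [Module Λ V] (j : U →ₗ[Λ] V), Function.Injective j →
      ∃ r : V →ₗ[Λ] U, ∀ x, r (j x) = x) : Module.Injective Λ U := by
  refine ⟨fun A B _ _ _ _ f hf g => ?_⟩
  let W : Submodule Λ (U × B) := LinearMap.range (g.prod (-f))
  obtain ⟨r, hr⟩ := h ((U × B) ⧸ W) (W.mkQ ∘ₗ LinearMap.inl Λ U B) (by
    rw [← LinearMap.ker_eq_bot, LinearMap.ker_eq_bot']
    intro u hu
    have : (u, (0 : B)) ∈ W := (Submodule.Quotient.mk_eq_zero W).1 hu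
    obtain ⟨a, ha⟩ := this
    obtain ⟨h1, h2⟩ := Prod.ext_iff.1 ha
    have : a = 0 := hf (by simpa using h2)
    simpa [this] using h1.symm)
  refine ⟨r ∘ₗ W.mkQ ∘ₗ LinearMap.inr Λ U B, fun a => ?_⟩
  rw [← hr (g a)]
  change r (W.mkQ (0, f a)) = r (W.mkQ (g a, 0))
  congr 1
  rw [← sub_eq_zero, ← map_sub, Submodule.mkQ_apply, Submodule.Quotient.mk_eq_zero]
  exact ⟨-a, by simp⟩

/-- If `U` is an essential extension of a simple module, then every module `V` containing `U` has
a quotient which still contains `U` and is an essential extension of the simple module. -/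
lemma IsSocleMap.exists_quotient {S U V : Type*} [AddCommGroup S] [Module Λ S]
    [IsSimpleModule Λ S] [AddCommGroup U] [Module Λ U] [AddCommGroup V] [Module Λ V]
    {i : S →ₗ[Λ] U} (hi : IsSocleMap i) {j : U →ₗ[Λ] V} (hj : Function.Injective j) :
    ∃ K : Submodule Λ V, IsSocleMap (K.mkQ ∘ₗ j ∘ₗ i) ∧ Function.Injective (K.mkQ ∘ₗ j) := by
  have hji : Function.Injective (j ∘ₗ i) := hj.comp hi.1
  obtain ⟨K, hK⟩ := zorn_le₀ {K : Submodule Λ V | Disjoint K (LinearMap.range (j ∘ₗ i))}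
    fun c hc hchain => ⟨sSup c, (hchain.directedOn.disjoint_sSup_left).2 fun b hb => hc hb,
      fun z hz => le_sSup hz⟩
  have hKinj : Function.Injective (K.mkQ ∘ₗ j ∘ₗ i) := by
    rw [← LinearMap.ker_eq_bot, LinearMap.ker_eq_bot']
    intro s hs
    have : j (i s) ∈ K := (Submodule.Quotient.mk_eq_zero K).1 hs
    exact hji (((Submodule.disjoint_def.1 hK.prop) _ this ⟨s, rfl⟩).trans (map_zero _).symm)
  refine ⟨K, ⟨hKinj, fun K' hK' => ?_⟩, ?_⟩
  · have hnd : ¬ Disjoint (K'.comap K.mkQ) (LinearMap.range (j ∘ₗ i)) := fun hd => hK' (by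
      have hle : K'.comap K.mkQ ≤ K := hK.le_of_ge hd (K.le_comap_mkQ K')
      rw [eq_bot_iff]
      intro y hy
      obtain ⟨y, rfl⟩ := K.mkQ_surjective y
      exact (Submodule.Quotient.mk_eq_zero K).2 (hle hy))
    rintro _ ⟨s, rfl⟩
    exact LinearMap.range_le_of_not_disjoint _ hnd ⟨s, rfl⟩
  · rw [← LinearMap.ker_eq_bot]
    by_contra hne
    have := IsSimpleModule.nontrivial Λ S
    obtain ⟨s, hs⟩ := exists_ne (0 : S)
    have h0 : (K.mkQ ∘ₗ j) (i s) = 0 := hi.2 _ hne ⟨s, rfl⟩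
    exact hs (hKinj (h0.trans (map_zero _).symm))

lemma exists_injective_socleMap (k : Type u) [CommRing k] [IsArtinianRing k] [Algebra k Λ]
    [Module.Finite k Λ] (S : Type v) [AddCommGroup S] [Module Λ S] [IsSimpleModule Λ S] :
    ∃ (U : ModuleCat.{v} Λ) (i : S →ₗ[Λ] U), IsSocleMap i ∧ IsFiniteLength Λ U ∧
      Module.Injective Λ U := by
  have := IsArtinianRing.of_finite k Λ
  have := IsNoetherianRing.of_finite k Λ
  have hΛ : IsFiniteLength Λ Λ :=
    isFiniteLength_iff_isNoetherian_isArtinian.2 ⟨inferInstance, inferInstance⟩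
  let : Module k S := Module.compHom S (algebraMap k Λ)
  have : IsScalarTower k Λ S := ⟨fun a b x => by rw [Algebra.smul_def, mul_smul]; rfl⟩
  have : Module.Finite k S := Module.Finite.trans Λ S
  have := finite_hom (k := k) (Λ := Λ) S S
  obtain ⟨b, hb⟩ : ∃ b : ℕ, (b : ℕ∞) = Module.length Λ Λ * Module.length k (S →ₗ[Λ] S) :=
    ENat.ne_top_iff_exists.1 (WithTop.mul_ne_top Module.length_ne_top Module.length_ne_top)
  have hbound : ∀ (U : ModuleCat.{v} Λ) (i : S →ₗ[Λ] U), IsSocleMap i →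
      Module.length Λ U ≤ b := by
    intro U i hi
    let : Module k U := Module.compHom U (algebraMap k Λ)
    have : IsScalarTower k Λ U := ⟨fun a b x => by rw [Algebra.smul_def, mul_smul]; rfl⟩
    exact hb ▸ hi.length_le hΛ
  let L : Set ℕ :=
    {n | ∃ (U : ModuleCat.{v} Λ) (i : S →ₗ[Λ] U), IsSocleMap i ∧ Module.length Λ U = n}
  have hL : L.Nonempty := by
    refine ⟨1, ModuleCat.of Λ S, LinearMap.id, ⟨Function.injective_id, fun K hK => ?_⟩, ?_⟩
    · rw [(eq_bot_or_eq_top K).resolve_left hK]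
      exact le_top
    · exact Module.length_eq_one Λ S
  have hLb : BddAbove L := ⟨b, by
    rintro n ⟨U, i, hi, hn⟩
    exact_mod_cast hn ▸ hbound U i hi⟩
  obtain ⟨U, i, hi, hU⟩ := Nat.sSup_mem hL hLb
  have hUfl : IsFiniteLength Λ U :=
    Module.length_ne_top_iff.1 (hU ▸ ENat.natCast_ne_top _)
  refine ⟨U, i, hi, hUfl, Module.Injective.of_forall_retraction fun V _ _ j hj => ?_⟩
  obtain ⟨K, hK, hinj⟩ := hi.exists_quotient hj
  have hVb := hbound (ModuleCat.of Λ (V ⧸ K)) _ hK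
  have hVne : Module.length Λ (V ⧸ K) ≠ ⊤ := ne_top_of_le_ne_top (ENat.natCast_ne_top b) hVb
  obtain ⟨n, hn⟩ := ENat.ne_top_iff_exists.1 hVne
  have hle : Module.length Λ (V ⧸ K) ≤ Module.length Λ U := by
    rw [hU, ← hn]
    exact_mod_cast le_csSup hLb ⟨ModuleCat.of Λ (V ⧸ K), _, hK, hn.symm⟩
  have hsurj : LinearMap.range (K.mkQ ∘ₗ j) = ⊤ := by
    by_contra hne
    obtain ⟨_, _⟩ := isFiniteLength_iff_isNoetherian_isArtinian.1
      (Module.length_ne_top_iff.1 hVne)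
    have h1 := Submodule.length_lt hne
    rw [← (LinearEquiv.ofInjective _ hinj).length_eq] at h1
    exact absurd hle (not_le.2 h1)
  let e := LinearEquiv.ofBijective (K.mkQ ∘ₗ j) ⟨hinj, LinearMap.range_eq_top.1 hsurj⟩
  exact ⟨e.symm ∘ₗ K.mkQ, fun x => e.symm_apply_apply x⟩

/-- If indecomposable injective modules have length at most `q`, then every module `X` of finite
length embeds into an injective module of length at most `q` times the length of `X`. -/
lemma exists_injective_embedding (k : Type u) [CommRing k] [IsArtinianRing k] [Algebra k Λ]
    [Module.Finite k Λ] {q : ℕ∞}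
    (hq : ∀ Q : ModuleCat.{v} Λ, IsFiniteLength Λ Q → IndecMod Λ Q → Module.Injective Λ Q →
      Module.length Λ Q ≤ q) {X : Type v} [AddCommGroup X] [Module Λ X] (hX : IsFiniteLength Λ X) :
    ∃ (I : ModuleCat.{v} Λ) (ι : X →ₗ[Λ] I), Function.Injective ι ∧ IsFiniteLength Λ I ∧
      Module.Injective Λ I ∧ Module.length Λ I ≤ q * Module.length Λ X := by
  induction hX with
  | @of_subsingleton X _ _ _ =>
    refine ⟨ModuleCat.of Λ X, LinearMap.id, Function.injective_id, .of_subsingleton,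
      ⟨fun A B _ _ _ _ f hf g => ⟨0, fun _ => Subsingleton.elim _ _⟩⟩, ?_⟩
    rw [show Module.length Λ (ModuleCat.of Λ X) = 0 from Module.length_eq_zero]
    exact zero_le
  | @of_simple_quotient X _ _ N _ hN ih =>
    obtain ⟨I, ι, hι, hIfl, hI, hIq⟩ := ih
    obtain ⟨U, i, hi, hUfl, hU⟩ := exists_injective_socleMap (Λ := Λ) k (X ⧸ N)
    obtain ⟨ι', hι'⟩ := hI.out N.subtype N.injective_subtype ι
    have hlen : Module.length Λ (I × U) ≤ q * Module.length Λ X := by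
      rw [Module.length_prod, Module.length_eq_add_of_exact N.subtype N.mkQ N.injective_subtype
        N.mkQ_surjective (LinearMap.exact_subtype_mkQ N), Module.length_eq_one Λ (X ⧸ N), mul_add,
        mul_one]
      exact add_le_add hIq (hq U hUfl hi.indecMod hU)
    refine ⟨ModuleCat.of Λ (I × U), ι'.prod (i ∘ₗ N.mkQ), ?_, ?_, ⟨?_⟩, hlen⟩
    · refine (injective_iff_map_eq_zero (ι'.prod (i ∘ₗ N.mkQ))).2 fun x hx => ?_
      obtain ⟨h1, h2⟩ := Prod.ext_iff.1 hx
      have hxN : x ∈ N := (Submodule.Quotient.mk_eq_zero N).1 (hi.1 (h2.trans (map_zero i).symm))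
      have h3 : ι ⟨x, hxN⟩ = 0 := (hι' ⟨x, hxN⟩).symm.trans h1
      exact congrArg Subtype.val (hι (h3.trans (map_zero ι).symm))
    · refine Module.length_ne_top_iff.1 ?_
      change Module.length Λ (I × U) ≠ ⊤
      rw [Module.length_prod]
      exact WithTop.add_ne_top.2
        ⟨Module.length_ne_top_iff.2 hIfl, Module.length_ne_top_iff.2 hUfl⟩
    · intro A B _ _ _ _ f hf g
      obtain ⟨a, ha⟩ := hI.out f hf (LinearMap.fst Λ I U ∘ₗ g)
      obtain ⟨b, hb⟩ := hU.out f hf (LinearMap.snd Λ I U ∘ₗ g)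
      exact ⟨a.prod b, fun x => Prod.ext (ha x) (hb x)⟩

end Injective

section Main

variable {Λ : Type u} [Ring Λ]

lemma not_exists_retraction {Y : Type v} [AddCommGroup Y] [Module Λ Y] {X : Submodule Λ Y}
    (hY : IndecMod Λ Y) (hX : X ≠ ⊥) (hX' : X ≠ ⊤) (r : Y →ₗ[Λ] X) : ¬ ∀ x : X, r x = x := by
  intro hr
  have hc := LinearMap.isCompl_of_proj hr
  rcases hY.2 _ _ le_top le_top hc.sup_eq_top hc.inf_eq_bot with h | h
  · exact hX h
  · exact hX' (by simpa [h] using hc.sup_eq_top)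

lemma IsGRSub.length_quotient_le {k : Type u} [CommRing k] [IsArtinianRing k] [Algebra k Λ]
    [Module.Finite k Λ] {p : ℕ∞}
    (hp : ∀ (S : Type v) [AddCommGroup S] [Module Λ S] [IsSimpleModule Λ S],
      ∃ P : ModuleCat.{v} Λ, Module.Projective Λ P ∧ Module.length Λ P ≤ p ∧
        ∃ φ : P →ₗ[Λ] S, φ ≠ 0)
    {Y I : Type v} [AddCommGroup Y] [Module Λ Y] (hY : IsFiniteLength Λ Y) {X : Submodule Λ Y}
    (hX : IsGRSub Λ X) [AddCommGroup I] [Module Λ I] (hI : IsFiniteLength Λ I)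
    [Module.Injective Λ I] {ι : X →ₗ[Λ] I} (hι : Function.Injective ι) :
    Module.length Λ (Y ⧸ X) ≤ p * Module.length Λ (I ⧸ LinearMap.range ι) := by
  obtain ⟨_, _⟩ := isFiniteLength_iff_isNoetherian_isArtinian.1 hY
  let : Module k Y := Module.compHom Y (algebraMap k Λ)
  have : IsScalarTower k Λ Y := ⟨fun a b x => by rw [Algebra.smul_def, mul_smul]; rfl⟩
  let : Module k I := Module.compHom I (algebraMap k Λ)
  have : IsScalarTower k Λ I := ⟨fun a b x => by rw [Algebra.smul_def, mul_smul]; rfl⟩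
  have := hY.finite_restrictScalars (k := k)
  obtain ⟨g, hg⟩ := Module.Injective.out X.subtype X.injective_subtype ι
  let R := LinearMap.range ι
  let f : (Y ⧸ X) →ₗ[Λ] (I ⧸ R) := X.mapQ R g fun x hx => ⟨⟨x, hx⟩, (hg ⟨x, hx⟩).symm⟩
  let H : Submodule k ((Y ⧸ X) →ₗ[Λ] (I ⧸ R)) :=
    LinearMap.range (LinearMap.compRight k R.mkQ : ((Y ⧸ X) →ₗ[Λ] I) →ₗ[k] _)
  have hf : f ∉ H := by
    rintro ⟨g', hg'⟩
    have hmem : ∀ y, (g - g' ∘ₗ X.mkQ) y ∈ R := fun y => by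
      rw [← Submodule.Quotient.mk_eq_zero, LinearMap.sub_apply, Submodule.Quotient.mk_sub,
        sub_eq_zero]
      exact (LinearMap.congr_fun hg' (X.mkQ y)).symm
    refine not_exists_retraction hX.1 hX.2.1.1 hX.2.2.1
      ((LinearEquiv.ofInjective ι hι).symm ∘ₗ (g - g' ∘ₗ X.mkQ).codRestrict R hmem) fun x => ?_
    refine (LinearEquiv.symm_apply_eq _).2 (Subtype.ext ?_)
    change g x - g' (Submodule.Quotient.mk (x : Y)) = ι x
    rw [(Submodule.Quotient.mk_eq_zero X).2 x.2, map_zero, sub_zero]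
    exact hg x
  have hC : IsFiniteLength Λ (I ⧸ R) := hI.of_surjective R.mkQ_surjective
  obtain ⟨Z', hZ', hsep⟩ := separatedByShort (Z := Y ⧸ X) hp hC H f hf
  by_cases htop : Z' = ⊤
  · rwa [htop, Module.length_top] at hZ'
  exfalso
  have hXU : X ≤ Z'.comap X.mkQ := X.le_comap_mkQ Z'
  have hU : Z'.comap X.mkQ ≠ ⊤ := fun h => htop (by
    rw [← Submodule.map_comap_eq_of_surjective X.mkQ_surjective Z', h, Submodule.map_top,
      Submodule.range_mkQ])
  obtain ⟨r, hr⟩ := hX.exists_retraction hXU hU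
  obtain ⟨g₁, hg₁⟩ := Module.Injective.out (Z'.comap X.mkQ).subtype
    (Submodule.injective_subtype _) (g ∘ₗ (Z'.comap X.mkQ).subtype - ι ∘ₗ r)
  have hg₁X : X ≤ LinearMap.ker g₁ := fun x hx => by
    refine (hg₁ ⟨x, hXU hx⟩).trans (sub_eq_zero.2 ((hg ⟨x, hx⟩).trans ?_))
    exact congrArg ι (hr ⟨x, hx⟩).symm
  refine hsep _ ⟨X.liftQ g₁ hg₁X, rfl⟩ fun z hz => ?_
  obtain ⟨y, rfl⟩ := X.mkQ_surjective z
  rw [LinearMap.mem_ker, LinearMap.sub_apply, sub_eq_zero]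
  change R.mkQ (g y) = R.mkQ (g₁ y)
  rw [← sub_eq_zero, ← map_sub, Submodule.mkQ_apply, Submodule.Quotient.mk_eq_zero]
  refine ⟨r ⟨y, hz⟩, ?_⟩
  have h1 : g₁ y = g y - ι (r ⟨y, hz⟩) := hg₁ ⟨y, hz⟩
  rw [h1, sub_sub_cancel]

end Main

/-- Let `p` be the maximal length of an indecomposable projective
`Λ`-module and `q` the maximal length of an indecomposable injective `Λ`-module. If
`X ⊂ Y` is a Gabriel-Roiter inclusion, then `|Y| ≤ p·q·|X|`. -/
theorem gabriel_roiter_stmt4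
    (k : Type u) [CommRing k] [IsArtinianRing k]
    (Λ : Type u) [Ring Λ] [Algebra k Λ] [Module.Finite k Λ]
    (p q : ℕ∞)
    (hp : IsGreatest {n : ℕ∞ | ∃ P : ModuleCat.{v} Λ, IsFiniteLength Λ P ∧
      IndecMod Λ P ∧ Module.Projective Λ P ∧ modLen Λ P = n} p)
    (hq : IsGreatest {n : ℕ∞ | ∃ Q : ModuleCat.{v} Λ, IsFiniteLength Λ Q ∧
      IndecMod Λ Q ∧ Module.Injective Λ Q ∧ modLen Λ Q = n} q)
    (Y : Type v) [AddCommGroup Y] [Module Λ Y] (hYfl : IsFiniteLength Λ Y)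
    (X : Submodule Λ Y) (hX : IsGRSub Λ X) :
    modLen Λ Y ≤ p * q * Order.height X := by
  have hp' : ∀ (S : Type v) [AddCommGroup S] [Module Λ S] [IsSimpleModule Λ S],
      ∃ P : ModuleCat.{v} Λ, Module.Projective Λ P ∧ Module.length Λ P ≤ p ∧
        ∃ φ : P →ₗ[Λ] S, φ ≠ 0 := by
    intro S _ _ _
    obtain ⟨P, hPfl, hP, hproj, φ, hφ⟩ := exists_indec_projective_hom (Λ := Λ) k S
    refine ⟨P, hproj, ?_, φ, hφ⟩
    rw [Module.length_eq_height]
    exact hp.2 ⟨P, hPfl, hP, hproj, rfl⟩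
  have hp1 : 1 ≤ p := by
    obtain ⟨P, -, hP, -, rfl⟩ := hp.1
    rw [modLen, ← Module.length_eq_height, Order.one_le_iff_ne_zero, Ne, Module.length_eq_zero_iff]
    exact fun h => hP.1 (Subsingleton.elim _ _)
  obtain ⟨_, _⟩ := isFiniteLength_iff_isNoetherian_isArtinian.1 hYfl
  have hXfl : IsFiniteLength Λ X :=
    isFiniteLength_iff_isNoetherian_isArtinian.2 ⟨inferInstance, inferInstance⟩
  obtain ⟨I, ι, hι, hIfl, hI, hIq⟩ := exists_injective_embedding k (q := q)
    (fun Q hQ hQ' hQ'' => by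
      rw [Module.length_eq_height]
      exact hq.2 ⟨Q, hQ, hQ', hQ'', rfl⟩) hXfl
  have hlen : Module.length Λ I = Module.length Λ X + Module.length Λ (I ⧸ LinearMap.range ι) :=
    Module.length_eq_add_of_exact ι (LinearMap.range ι).mkQ hι (Submodule.mkQ_surjective _)
      (LinearMap.exact_map_mkQ_range ι)
  rw [modLen, ← Module.length_eq_height, ← Module.length_submodule]
  calc Module.length Λ Y = Module.length Λ X + Module.length Λ (Y ⧸ X) :=
        Module.length_eq_add_of_exact X.subtype X.mkQ X.injective_subtype X.mkQ_surjective
          (LinearMap.exact_subtype_mkQ X)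
    _ ≤ p * Module.length Λ X + p * Module.length Λ (I ⧸ LinearMap.range ι) :=
        add_le_add (le_mul_of_one_le_left zero_le hp1)
          (hX.length_quotient_le (k := k) hp' hYfl hIfl hι)
    _ = p * Module.length Λ I := by rw [hlen, mul_add]
    _ ≤ p * q * Module.length Λ X := by
        rw [mul_assoc]
        exact mul_le_mul_right hIq p
end

section
/- Let Λ be an artin algebra, let p be the maximal length of an indecomposable projective Λ-module and q the maximal length of an indecomposable injective Λ-module. Let M be an indecomposable finite length Λ-module and let a be a natural number with 1 ≤ a < |M|. Then there exists an indecomposable submodule M' of M whose length lies in the interval [a+1, pq·a]. -/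
/-!
Setting: `k` is a commutative artinian ring and `Λ` an artin `k`-algebra
(an algebra over `k` which is finitely generated as a `k`-module).
All modules considered are `Λ`-modules of finite length (`IsFiniteLength Λ M`),
and `|M|` denotes the length of `M`, implemented as the height
`Order.height (⊤ : Submodule Λ M)` of the lattice of submodules
(for a submodule `N` of an ambient module, its length is `Order.height N`).
-/

universe u v

open Submodule

namespace GabrielRoiter

section Measure

variable {Λ : Type u} [Ring Λ]

lemma indecMod_iff {M : Type*} [AddCommGroup M] [Module Λ M] :
    IndecMod Λ M ↔ Nontrivial M ∧
      ∀ A B : Submodule Λ M, IsCompl A B → A = ⊥ ∨ B = ⊥ := by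
  constructor
  · rintro ⟨h, h'⟩
    exact ⟨(Submodule.nontrivial_iff Λ).1 ⟨⟨_, _, h⟩⟩,
      fun A B hAB => h' A B le_top le_top hAB.sup_eq_top hAB.inf_eq_bot⟩
  · rintro ⟨h, h'⟩
    exact ⟨top_ne_bot, fun A B _ _ hs hi =>
      h' A B ⟨disjoint_iff.2 hi, codisjoint_iff.2 hs⟩⟩

lemma indecSub_iff {M : Type*} [AddCommGroup M] [Module Λ M] (N : Submodule Λ M) :
    IndecSub Λ N ↔ IndecMod Λ N := by
  have hinj := Submodule.map_injective_of_injective N.injective_subtype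
  constructor
  · rintro ⟨h, h'⟩
    refine ⟨fun h0 => h ?_, fun A B _ _ hs hi => ?_⟩
    · simpa using congrArg (Submodule.map N.subtype) h0
    · have := h' (A.map N.subtype) (B.map N.subtype) (map_subtype_le _ _) (map_subtype_le _ _)
        (by rw [← Submodule.map_sup, hs]; simp)
        (by rw [← Submodule.map_inf _ N.injective_subtype, hi]; simp)
      exact this.imp (fun h => hinj (by simpa using h)) (fun h => hinj (by simpa using h))
  · rintro ⟨h, h'⟩
    refine ⟨fun h0 => h ?_, fun A B hA hB hs hi => ?_⟩
    · subst h0; exact Subsingleton.elim _ _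
    · have := h' (A.comap N.subtype) (B.comap N.subtype) le_top le_top
        (hinj (by simp [Submodule.map_sup, Submodule.map_comap_subtype, inf_eq_right.2 hA,
          inf_eq_right.2 hB, hs]))
        (by rw [← Submodule.comap_inf, hi]; simp)
      refine this.imp (fun h => ?_) (fun h => ?_)
      · simpa [Submodule.map_comap_subtype, inf_eq_right.2 hA] using
          congrArg (Submodule.map N.subtype) h
      · simpa [Submodule.map_comap_subtype, inf_eq_right.2 hB] using
          congrArg (Submodule.map N.subtype) h

lemma IndecMod.congr {M N : Type*} [AddCommGroup M] [Module Λ M] [AddCommGroup N] [Module Λ N]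
    (e : M ≃ₗ[Λ] N) (h : IndecMod Λ M) : IndecMod Λ N := by
  rw [indecMod_iff] at h ⊢
  refine ⟨haveI := h.1; e.symm.toEquiv.nontrivial, fun A B hAB => ?_⟩
  have := h.2 _ _ ((Submodule.orderIsoMapComap e.symm).isCompl hAB)
  simpa using this

/-- A section of a retraction onto a nonzero module, with indecomposable target, is onto. -/
lemma surjective_of_retraction {X N : Type*} [AddCommGroup X] [Module Λ X] [AddCommGroup N]
    [Module Λ N] [Nontrivial X] (hN : IndecMod Λ N) (i : X →ₗ[Λ] N) (r : N →ₗ[Λ] X)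
    (h : ∀ x, r (i x) = x) : Function.Surjective i := by
  have hc : IsCompl (LinearMap.range i) (LinearMap.ker r) := by
    constructor
    · rw [Submodule.disjoint_def]
      rintro _ ⟨x, rfl⟩ hx
      rw [LinearMap.mem_ker, h] at hx
      simp [hx]
    · rw [codisjoint_iff, eq_top_iff]
      intro n _
      rw [Submodule.mem_sup]
      exact ⟨i (r n), ⟨_, rfl⟩, n - i (r n), by simp [h], by simp⟩
  rcases (indecMod_iff.1 hN).2 _ _ hc with h0 | h0
  · obtain ⟨x, hx⟩ := exists_ne (0 : X)
    refine absurd ?_ hx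
    rw [← h x, LinearMap.range_eq_bot.1 h0]; simp
  · have := hc.sup_eq_top
    rw [h0, sup_bot_eq] at this
    exact LinearMap.range_eq_top.1 this

lemma length_lt_of_injective {X N : Type*} [AddCommGroup X] [Module Λ X] [AddCommGroup N]
    [Module Λ N] (hN : Module.length Λ N ≠ ⊤) (i : X →ₗ[Λ] N) (hi : Function.Injective i)
    (hs : ¬ Function.Surjective i) : Module.length Λ X < Module.length Λ N := by
  have hfl := isFiniteLength_iff_isNoetherian_isArtinian.1 (Module.length_ne_top_iff.1 hN)
  have := hfl.1
  have := hfl.2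
  rw [(LinearEquiv.ofInjective i hi).length_eq]
  exact Submodule.length_lt (fun h => hs (LinearMap.range_eq_top.1 h))

lemma surjective_of_length_le {X N : Type*} [AddCommGroup X] [Module Λ X] [AddCommGroup N]
    [Module Λ N] (hN : Module.length Λ N ≠ ⊤) (i : X →ₗ[Λ] N) (hi : Function.Injective i)
    (hl : Module.length Λ N ≤ Module.length Λ X) : Function.Surjective i := by
  by_contra hs
  exact (length_lt_of_injective hN i hi hs).not_ge hl

/-- Every nonzero element of a module of finite length is detected by a map to an
indecomposable submodule. -/
lemma exists_indec_map (N : Type v) [AddCommGroup N] [Module Λ N]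
    (hN : IsFiniteLength Λ N) (x : N) (hx : x ≠ 0) :
    ∃ Z : Submodule Λ N, IndecMod Λ Z ∧ ∃ g : N →ₗ[Λ] Z, g x ≠ 0 := by
  have hfl := isFiniteLength_iff_isNoetherian_isArtinian.1 hN
  have := hfl.2
  let S : Set (Submodule Λ N) := {Z | ∃ g : N →ₗ[Λ] Z, (∀ z : Z, g z = z) ∧ g x ≠ 0}
  obtain ⟨Z, ⟨g, hg, hgx⟩, hmin⟩ := wellFounded_lt.has_min S
    ⟨⊤, LinearMap.id.codRestrict ⊤ (by simp), by simp [Subtype.ext_iff], by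
      simpa [Subtype.ext_iff] using hx⟩
  refine ⟨Z, (indecSub_iff Z).1 ⟨?_, fun A B hA hB hs hi => ?_⟩, g, hgx⟩
  · rintro rfl
    exact hgx (Subsingleton.elim _ _)
  · have hc : IsCompl (A.comap Z.subtype) (B.comap Z.subtype) := by
      have hinj := Submodule.map_injective_of_injective Z.injective_subtype
      refine ⟨disjoint_iff.2 ?_, codisjoint_iff.2 (hinj ?_)⟩
      · rw [← Submodule.comap_inf, hi]; simp
      · simp [Submodule.map_sup, Submodule.map_comap_subtype, inf_eq_right.2 hA,
          inf_eq_right.2 hB, hs]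
    have key : ∀ A B : Submodule Λ N, A ≤ Z → IsCompl (A.comap Z.subtype) (B.comap Z.subtype) →
        (hp : ∃ a b : N, a ∈ A ∧ b ∈ B ∧ a + b = g x ∧ a ≠ 0) → A = Z := by
      intro A B hA hc ⟨a, b, ha, hb, hab, ha0⟩
      by_contra hne
      refine hmin A ?_ (lt_of_le_of_ne hA hne)
      let P := Submodule.projectionOnto _ _ hc
      let e : (A.comap Z.subtype) →ₗ[Λ] A :=
        (Z.subtype.comp (A.comap Z.subtype).subtype).codRestrict A (fun c => c.2)
      have hP : ∀ z : Z, (z : N) ∈ A → ((e (P z) : A) : N) = z := by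
        intro z hz
        have : P z = ⟨z, hz⟩ :=
          Submodule.projectionOnto_apply_left hc (⟨z, hz⟩ : A.comap Z.subtype)
        rw [this]; rfl
      have hbZ : b ∈ Z := by
        have : b = g x - a := by rw [← hab]; abel
        rw [this]; exact Z.sub_mem (g x).2 (hA ha)
      refine ⟨e ∘ₗ P ∘ₗ g, fun z => ?_, fun h0 => ha0 ?_⟩
      · apply Subtype.ext
        have := hg ⟨z, hA z.2⟩
        simp only [LinearMap.comp_apply]
        rw [show g (z : N) = ⟨z, hA z.2⟩ from this, hP _ z.2]
      · have hgx' : g x = ⟨a, hA ha⟩ + ⟨b, hbZ⟩ := Subtype.ext hab.symm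
        have hPb : P ⟨b, hbZ⟩ = 0 :=
          (Submodule.projectionOnto_apply_eq_zero_iff hc).2 hb
        simp only [LinearMap.comp_apply] at h0
        rw [hgx', map_add, hPb, add_zero] at h0
        have := hP ⟨a, hA ha⟩ ha
        rw [h0] at this
        exact this.symm
    obtain ⟨a, ha, b, hb, hab⟩ := Submodule.mem_sup.1 (hs.symm ▸ (g x).2 : (g x : N) ∈ A ⊔ B)
    by_cases ha0 : a = 0
    · left
      have hBZ : B = Z := key B A hB hc.symm
        ⟨b, a, hb, ha, by rw [← hab, add_comm], fun hb0 => hgx (by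
          apply Subtype.ext; rw [← hab, ha0, hb0]; simp)⟩
      rw [hBZ, inf_eq_left.2 hA] at hi
      exact hi
    · right
      have hAZ : A = Z := key A B hA hc ⟨a, b, ha, hb, hab, ha0⟩
      rw [hAZ, inf_eq_right.2 hB] at hi
      exact hi

end Measure

section Chain

variable (Λ : Type u) [Ring Λ]

/-- `MeasureVal Λ L N c` says that `c` is `∑ 2 ^ (L - |N_i|)` for some chain
`N_1 ⊂ ⋯ ⊂ N_t = N` of proper embeddings between indecomposable modules. -/
inductive MeasureVal (L : ℕ) : ∀ (N : Type v) [AddCommGroup N] [Module Λ N], ℕ → Prop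
  | base {N : Type v} [AddCommGroup N] [Module Λ N] (hN : IndecMod Λ N) :
      MeasureVal L N (2 ^ (L - (Module.length Λ N).toNat))
  | step {N' N : Type v} [AddCommGroup N'] [Module Λ N'] [AddCommGroup N] [Module Λ N]
      (i : N' →ₗ[Λ] N) (hi : Function.Injective i) (hs : ¬ Function.Surjective i)
      (hN : IndecMod Λ N) {c : ℕ} (h : MeasureVal L N' c) :
      MeasureVal L N (c + 2 ^ (L - (Module.length Λ N).toNat))

/-- The Gabriel-Roiter measure of an indecomposable module of length at most `L`,
scaled by `2 ^ L`. -/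
noncomputable def measure (L : ℕ) (N : Type v) [AddCommGroup N] [Module Λ N] : ℕ :=
  sSup {c | MeasureVal Λ L N c}

variable {Λ} {L : ℕ}

lemma toNat_lt_toNat_iff {m n : ℕ∞} (hm : m ≠ ⊤) (hn : n ≠ ⊤) : m.toNat < n.toNat ↔ m < n := by
  lift m to ℕ using hm
  lift n to ℕ using hn
  simp

lemma toNat_length_lt {X N : Type*} [AddCommGroup X] [Module Λ X] [AddCommGroup N]
    [Module Λ N] (hN : Module.length Λ N ≤ L) (i : X →ₗ[Λ] N) (hi : Function.Injective i)
    (hs : ¬ Function.Surjective i) :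
    (Module.length Λ X).toNat < (Module.length Λ N).toNat ∧ (Module.length Λ N).toNat ≤ L ∧
      Module.length Λ X ≤ L := by
  have hN' : Module.length Λ N ≠ ⊤ := ne_top_of_le_ne_top (by simp) hN
  have h := length_lt_of_injective hN' i hi hs
  refine ⟨(toNat_lt_toNat_iff (h.trans_le le_top).ne hN').2 h, ?_, h.le.trans hN⟩
  simpa using ENat.toNat_le_toNat hN (by simp)

lemma MeasureVal.add_le {N : Type v} [AddCommGroup N] [Module Λ N] {c : ℕ}
    (h : MeasureVal Λ L N c) (hL : Module.length Λ N ≤ L) :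
    c + 2 ^ (L - (Module.length Λ N).toNat) ≤ 2 ^ L := by
  induction h with
  | @base N _ _ hN =>
    have := (indecMod_iff.1 hN).1
    have h0 : (Module.length Λ N).toNat ≠ 0 := by
      simp only [ne_eq, ENat.toNat_eq_zero, Module.length_eq_zero_iff, not_or]
      exact ⟨not_subsingleton N, ne_top_of_le_ne_top (by simp) hL⟩
    have h1 : (Module.length Λ N).toNat ≤ L := by simpa using ENat.toNat_le_toNat hL (by simp)
    rw [← two_mul, ← pow_succ']
    exact Nat.pow_le_pow_right (by norm_num) (by omega)
  | @step N' N _ _ _ _ i hi hs hN c _ ih =>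
    obtain ⟨h1, h2, h3⟩ := toNat_length_lt hL i hi hs
    have h4 := ih h3
    have h5 : 2 ^ (L - (Module.length Λ N).toNat + 1) ≤
        2 ^ (L - (Module.length Λ N').toNat) := Nat.pow_le_pow_right (by norm_num) (by omega)
    rw [pow_succ] at h5
    omega

lemma MeasureVal.dvd {N : Type v} [AddCommGroup N] [Module Λ N] {c : ℕ}
    (h : MeasureVal Λ L N c) (hL : Module.length Λ N ≤ L) :
    2 ^ (L - (Module.length Λ N).toNat) ∣ c := by
  induction h with
  | base hN => exact dvd_rfl
  | step i hi hs hN h ih =>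
    obtain ⟨h1, h2, h3⟩ := toNat_length_lt hL i hi hs
    exact dvd_add ((pow_dvd_pow 2 (by omega)).trans (ih h3)) dvd_rfl

lemma MeasureVal.congr {N N' : Type v} [AddCommGroup N] [Module Λ N] [AddCommGroup N']
    [Module Λ N'] {c : ℕ} (e : N ≃ₗ[Λ] N') (h : MeasureVal Λ L N c) : MeasureVal Λ L N' c := by
  cases h with
  | base hN => rw [e.length_eq]; exact .base (IndecMod.congr e hN)
  | step i hi hs hN h =>
    rw [e.length_eq]
    refine .step (e.toLinearMap ∘ₗ i) (e.injective.comp hi) (fun h' => hs ?_)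
      (IndecMod.congr e hN) h
    exact (EquivLike.comp_surjective i e).1 h'

lemma measure_mem {N : Type v} [AddCommGroup N] [Module Λ N] (hN : IndecMod Λ N)
    (hL : Module.length Λ N ≤ L) : MeasureVal Λ L N (measure Λ L N) :=
  Nat.sSup_mem ⟨_, .base hN⟩ ⟨2 ^ L, fun _ hc => (Nat.le_add_right _ _).trans (hc.add_le hL)⟩

lemma MeasureVal.le_measure {N : Type v} [AddCommGroup N] [Module Λ N] {c : ℕ}
    (h : MeasureVal Λ L N c) (hL : Module.length Λ N ≤ L) : c ≤ measure Λ L N :=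
  le_csSup ⟨2 ^ L, fun _ hc => (Nat.le_add_right _ _).trans (MeasureVal.add_le hc hL)⟩ h

lemma measure_le_pow {N : Type v} [AddCommGroup N] [Module Λ N] (hN : IndecMod Λ N)
    (hL : Module.length Λ N ≤ L) : measure Λ L N ≤ 2 ^ L :=
  (Nat.le_add_right _ _).trans ((measure_mem hN hL).add_le hL)

lemma measure_lt {X N : Type v} [AddCommGroup X] [Module Λ X] [AddCommGroup N] [Module Λ N]
    (hX : IndecMod Λ X) (hN : IndecMod Λ N) (hL : Module.length Λ N ≤ L)
    (i : X →ₗ[Λ] N) (hi : Function.Injective i) (hs : ¬ Function.Surjective i) :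
    measure Λ L X + 2 ^ (L - (Module.length Λ N).toNat) ≤ measure Λ L N :=
  (MeasureVal.step i hi hs hN
    (measure_mem hX (toNat_length_lt hL i hi hs).2.2)).le_measure hL

lemma measure_le {X N : Type v} [AddCommGroup X] [Module Λ X] [AddCommGroup N] [Module Λ N]
    (hX : IndecMod Λ X) (hN : IndecMod Λ N) (hL : Module.length Λ N ≤ L)
    (i : X →ₗ[Λ] N) (hi : Function.Injective i) : measure Λ L X ≤ measure Λ L N := by
  by_cases hs : Function.Surjective i
  · let e := LinearEquiv.ofBijective i ⟨hi, hs⟩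
    exact ((measure_mem hX (e.length_eq.trans_le hL)).congr e).le_measure hL
  · exact (Nat.le_add_right _ _).trans (measure_lt hX hN hL i hi hs)

lemma MeasureVal.inv {N : Type v} [AddCommGroup N] [Module Λ N] {c : ℕ}
    (h : MeasureVal Λ L N c) : c = 2 ^ (L - (Module.length Λ N).toNat) ∨
      ∃ (X : ModuleCat.{v} Λ) (i : X →ₗ[Λ] N) (c' : ℕ), IndecMod Λ X ∧ Function.Injective i ∧
        ¬ Function.Surjective i ∧ MeasureVal Λ L X c' ∧
        c = c' + 2 ^ (L - (Module.length Λ N).toNat) := by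
  cases h with
  | base _ => exact .inl rfl
  | step i hi hs hN h =>
    refine .inr ⟨ModuleCat.of Λ _, i, _, ?_, hi, hs, h, rfl⟩
    cases h <;> assumption

/-- Gabriel's main property: an embedding of an indecomposable module `X` into a module
which is cogenerated by indecomposable modules of measure at most that of `X` splits. -/
theorem exists_retraction {X N : Type v} [AddCommGroup X] [Module Λ X] [AddCommGroup N]
    [Module Λ N] (hX : IndecMod Λ X) (hXL : Module.length Λ X ≤ L)
    (j : X →ₗ[Λ] N) (hj : Function.Injective j)
    (hcog : ∀ y : N, y ≠ 0 → ∃ Z : ModuleCat.{v} Λ, IndecMod Λ Z ∧ Module.length Λ Z ≤ L ∧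
      measure Λ L Z ≤ measure Λ L X ∧ ∃ g : N →ₗ[Λ] Z, g y ≠ 0) :
    ∃ r : N →ₗ[Λ] X, ∀ x, r (j x) = x := by
  induction hn : (Module.length Λ X).toNat using Nat.strong_induction_on generalizing X N with
  | _ n ih =>
  subst hn
  by_contra hno
  have hXtop : Module.length Λ X ≠ ⊤ := ne_top_of_le_ne_top (by simp) hXL
  have := (isFiniteLength_iff_isNoetherian_isArtinian.1 (Module.length_ne_top_iff.1 hXtop)).1
  have := (isFiniteLength_iff_isNoetherian_isArtinian.1 (Module.length_ne_top_iff.1 hXtop)).2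
  have hninj : ∀ (Z : Type v) [AddCommGroup Z] [Module Λ Z], IndecMod Λ Z →
      Module.length Λ Z ≤ L → measure Λ L Z ≤ measure Λ L X → ∀ g : N →ₗ[Λ] Z,
      ¬ Function.Injective (g ∘ₗ j) := by
    intro Z _ _ hZ hZL hm g hg
    by_cases hs : Function.Surjective (g ∘ₗ j)
    · let e := LinearEquiv.ofBijective _ ⟨hg, hs⟩
      exact hno ⟨e.symm.toLinearMap ∘ₗ g, fun x => e.symm_apply_apply x⟩
    · have := measure_lt hX hZ hZL _ hg hs
      have : 0 < 2 ^ (L - (Module.length Λ Z).toNat) := by positivity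
      omega
  have hmem := measure_mem hX hXL
  rcases hmem.inv with hc | ⟨X', i, c, hX'i, hi, hs, hX', hc⟩
  · have := (indecMod_iff.1 hX).1
    obtain ⟨x, hx⟩ := exists_ne (0 : X)
    obtain ⟨Z, hZ, hZL, hm, g, hg⟩ := hcog (j x) (fun h => hx (hj (by simpa using h)))
    refine hninj Z hZ hZL hm g ?_
    rw [← LinearMap.ker_eq_bot]
    by_contra hk
    obtain ⟨⟨y, hyk⟩, hy⟩ := @exists_ne _ ((Submodule.nontrivial_iff_ne_bot).2 hk) 0
    obtain ⟨Z', hZ', -⟩ := exists_indec_map (LinearMap.ker (g ∘ₗ j))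
      (isFiniteLength_iff_isNoetherian_isArtinian (R := Λ).2 ⟨inferInstance, inferInstance⟩) _ hy
    have := measure_lt hZ' hX hXL ((LinearMap.ker (g ∘ₗ j)).subtype ∘ₗ Z'.subtype)
      (Subtype.val_injective.comp Subtype.val_injective) (fun hs => by
        obtain ⟨z, rfl⟩ := hs x
        exact hg z.1.2)
    have h0 : 0 < measure Λ L Z' := by
      have hl : Module.length Λ Z' ≤ L := (Module.length_le_of_injective
        ((LinearMap.ker (g ∘ₗ j)).subtype ∘ₗ Z'.subtype)
        (Subtype.val_injective.comp Subtype.val_injective)).trans hXL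
      exact lt_of_lt_of_le (by positivity) ((MeasureVal.base hZ').le_measure hl)
    omega
  · obtain ⟨h1, h2, h3⟩ := toNat_length_lt hXL i hi hs
    have hc' : c = measure Λ L X' := by
      apply le_antisymm (hX'.le_measure h3)
      have := measure_lt hX'i hX hXL i hi hs
      omega
    subst hc'
    have := (indecMod_iff.1 hX'i).1
    obtain ⟨r, hr⟩ := ih _ h1 hX'i h3 i hi (fun y hy => by
      obtain ⟨Z, hZ, hZL, hm, g, hg⟩ := hcog (j y) (fun h => hy (hj (by simpa using h)))
      let R := LinearMap.range (g ∘ₗ j)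
      let f : X →ₗ[Λ] R := (g ∘ₗ j).rangeRestrict
      have hf : Function.Surjective f := LinearMap.surjective_rangeRestrict _
      have hfy : f y ≠ 0 := fun h => hg (congrArg Subtype.val h)
      have hRX : Module.length Λ R ≤ Module.length Λ X := Module.length_le_of_surjective f hf
      have hRlt : (Module.length Λ R).toNat < (Module.length Λ X).toNat := by
        refine (toNat_lt_toNat_iff (ne_top_of_le_ne_top hXtop hRX) hXtop).2 ?_
        rw [← (f.quotKerEquivOfSurjective hf).length_eq]
        refine Submodule.length_quotient_lt _ fun hk => hninj Z hZ hZL hm g ?_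
        rw [LinearMap.ker_rangeRestrict] at hk
        exact LinearMap.ker_eq_bot.1 hk
      obtain ⟨Z', hZ', π, hπ⟩ := exists_indec_map R
        (Module.length_ne_top_iff.1 (ne_top_of_le_ne_top hXtop hRX)) _ hfy
      have hZ'R : Module.length Λ Z' ≤ Module.length Λ R :=
        Module.length_le_of_injective Z'.subtype Z'.injective_subtype
      have hZ'L : Module.length Λ Z' ≤ L := hZ'R.trans (hRX.trans hXL)
      refine ⟨ModuleCat.of Λ Z', hZ', hZ'L, ?_, π ∘ₗ f, hπ⟩
      change measure Λ L Z' ≤ _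
      have hZ'm : measure Λ L Z' ≤ measure Λ L Z :=
        measure_le hZ' hZ hZL (R.subtype ∘ₗ Z'.subtype)
          (Subtype.val_injective.comp Subtype.val_injective)
      have hZ'lt : (Module.length Λ Z').toNat < (Module.length Λ X).toNat :=
        (ENat.toNat_le_toNat hZ'R (ne_top_of_le_ne_top hXtop hRX)).trans_lt hRlt
      by_contra hlt
      have d1 : 2 ^ (L - (Module.length Λ X).toNat + 1) ∣ measure Λ L Z' :=
        (pow_dvd_pow 2 (by omega)).trans ((measure_mem hZ' hZ'L).dvd hZ'L)
      have d2 : 2 ^ (L - (Module.length Λ X).toNat + 1) ∣ measure Λ L X' :=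
        (pow_dvd_pow 2 (by omega)).trans ((measure_mem hX'i h3).dvd h3)
      have d3 := Nat.le_of_dvd (by omega) (Nat.dvd_sub d1 d2)
      rw [pow_succ] at d3
      have : 0 < 2 ^ (L - (Module.length Λ X).toNat) := by positivity
      omega) rfl
    exact hs (surjective_of_retraction hX i r hr)

end Chain

section Hom

variable {k : Type*} [CommRing k]

lemma exists_maximal_not_mem {H : Type*} [AddCommGroup H] [Module k H] (L : Submodule k H)
    {h : H} (hL : h ∉ L) : ∃ L' ≥ L, h ∉ L' ∧ ∀ N, L' < N → h ∈ N := by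
  obtain ⟨L', hle, hmax⟩ := zorn_le_nonempty₀ {N : Submodule k H | h ∉ N} (by
    intro c hc hchain y hy
    refine ⟨sSup c, fun hmem => ?_, fun z hz => le_sSup hz⟩
    obtain ⟨z, hz, hhz⟩ := (Submodule.mem_sSup_of_directed ⟨y, hy⟩ hchain.directedOn).1 hmem
    exact hc hz hhz) L hL
  refine ⟨L', hle, hmax.1, fun N hN => ?_⟩
  by_contra hn
  exact hN.not_ge (hmax.2 hn hN.le)

lemma mem_of_mem_of_isSimpleModule_quotient {R A : Type*} [Ring R] [AddCommGroup A] [Module R A]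
    (N P : Submodule R A) [IsSimpleModule R (A ⧸ N)] (hNP : N ≤ P) {a : A} (haN : a ∉ N)
    (ha : a ∈ P) (b : A) : b ∈ P := by
  have hco : IsCoatom N := isSimpleModule_iff_isCoatom.1 inferInstance
  have : P = ⊤ := hco.2 P (lt_of_le_of_ne hNP fun h => haN (h ▸ ha))
  simp [this]

lemma exists_not_mem_of_isSimpleModule_quotient {R A : Type*} [Ring R] [AddCommGroup A]
    [Module R A] (N : Submodule R A) [IsSimpleModule R (A ⧸ N)] : ∃ a, a ∉ N := by
  have hco : IsCoatom N := isSimpleModule_iff_isCoatom.1 inferInstance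
  by_contra! h
  exact hco.1 (eq_top_iff.2 fun x _ => h x)

lemma length_linearMap_le {Q : Type*} [AddCommGroup Q] [Module k Q] [IsSimpleModule k Q]
    {A : Type*} [AddCommGroup A] [Module k A] (hA : IsFiniteLength k A) :
    Module.length k (A →ₗ[k] Q) ≤ Module.length k A := by
  induction hA with
  | of_subsingleton => simp
  | @of_simple_quotient A _ _ N _ _ ih =>
    obtain ⟨a, ha⟩ := exists_not_mem_of_isSimpleModule_quotient N
    let ρ : (A →ₗ[k] Q) →ₗ[k] (N →ₗ[k] Q) := LinearMap.lcomp k Q N.subtype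
    have e1 := Module.length_eq_add_of_exact (LinearMap.ker ρ).subtype ρ.rangeRestrict
      Subtype.val_injective (LinearMap.surjective_rangeRestrict _)
      (by rw [LinearMap.exact_iff, LinearMap.ker_rangeRestrict, Submodule.range_subtype])
    have e2 := Module.length_eq_add_of_exact N.subtype N.mkQ
      Subtype.val_injective N.mkQ_surjective (LinearMap.exact_subtype_mkQ N)
    have h1 : Module.length k (LinearMap.ker ρ) ≤ Module.length k Q := by
      refine Module.length_le_of_injective
        ((LinearMap.applyₗ a).comp (LinearMap.ker ρ).subtype) ?_
      rw [← LinearMap.ker_eq_bot, LinearMap.ker_eq_bot']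
      rintro ⟨f, hf⟩ hfa
      apply Subtype.ext
      ext b
      have hf' : N ≤ LinearMap.ker f := fun n hn => LinearMap.congr_fun hf ⟨n, hn⟩
      exact mem_of_mem_of_isSimpleModule_quotient N _ hf' ha (show f a = 0 from hfa) b
    have h2 : Module.length k (LinearMap.range ρ) ≤ Module.length k (N →ₗ[k] Q) :=
      Module.length_le_of_injective (LinearMap.range ρ).subtype Subtype.val_injective
    rw [e1, e2, Module.length_eq_one k (A ⧸ N), add_comm]
    rw [Module.length_eq_one k Q] at h1
    exact add_le_add (h2.trans ih) h1

lemma exists_comp_eq {R V S T : Type*} [Ring R] [AddCommGroup V] [Module R V] [AddCommGroup S]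
    [Module R S] [AddCommGroup T] [Module R T] (f : V →ₗ[R] S) (hf : Function.Surjective f)
    (g : V →ₗ[R] T) (h : LinearMap.ker f ≤ LinearMap.ker g) :
    ∃ d : S →ₗ[R] T, ∀ v, d (f v) = g v := by
  refine ⟨(LinearMap.ker f).liftQ g h ∘ₗ (f.quotKerEquivOfSurjective hf).symm.toLinearMap,
    fun v => ?_⟩
  have : (f.quotKerEquivOfSurjective hf).symm (f v) = (LinearMap.ker f).mkQ v := by
    rw [LinearEquiv.symm_apply_eq]; rfl
  simp [this]

variable [IsArtinianRing k] {Λ : Type*} [Ring Λ] [Algebra k Λ]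
  {W : Type*} [AddCommGroup W] [Module Λ W]

/-- A linear map to a simple module which avoids a `k`-submodule `L` of the space of all maps
is still different from the members of `L` on some local submodule. -/
lemma exists_supIrred_of_not_mem [IsArtinian Λ W] {S : Type*} [AddCommGroup S] [Module Λ S]
    [Module k S] [IsScalarTower k Λ S] [Module.Finite k S] [IsSimpleModule Λ S]
    (L : Submodule k (W →ₗ[Λ] S)) {h : W →ₗ[Λ] S} (hL : h ∉ L) :
    ∃ V : Submodule Λ W, SupIrred V ∧ ∀ l ∈ L, ∃ v ∈ V, h v ≠ l v := by
  obtain ⟨L', hLL', hhL', hmax⟩ := exists_maximal_not_mem L hL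
  have hsimple : IsSimpleModule k ((W →ₗ[Λ] S) ⧸ L') := by
    rw [isSimpleModule_iff_isCoatom]
    refine ⟨fun h => hhL' (h ▸ trivial), fun N hN => eq_top_iff.2 fun f _ => ?_⟩
    by_cases hf : f ∈ L'
    · exact hN.le hf
    have hlt : L' < L' ⊔ Submodule.span k {f} := lt_of_le_of_ne le_sup_left fun he => hf (by
      rw [he]; exact Submodule.mem_sup_right (Submodule.mem_span_singleton_self f))
    obtain ⟨l, hl, y, hy, hly⟩ := Submodule.mem_sup.1 (hmax _ hlt)
    obtain ⟨c, rfl⟩ := Submodule.mem_span_singleton.1 hy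
    obtain ⟨n, d, hd⟩ := IsArtinian.exists_pow_succ_smul_dvd c (1 : k)
    let μ : S →ₗ[Λ] S := c • LinearMap.id
    have hμ : Function.Injective μ := by
      rcases LinearMap.bijective_or_eq_zero μ with h0 | h0
      · exact h0.1
      · exfalso
        apply hhL'
        have : c • f = 0 := by
          ext w
          exact LinearMap.congr_fun h0 (f w)
        rw [← hly, this, add_zero]
        exact hl
    have hcf : c • d • f = f := by
      ext w
      have hpow : ∀ m : ℕ, ∀ s : S, c ^ m • s = 0 → s = 0 := by
        intro m
        induction m with
        | zero => simp
        | succ m ih =>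
          intro s hs
          rw [pow_succ', mul_smul] at hs
          exact ih s (hμ (by simpa [μ] using hs))
      have := hpow n (c • d • f w - f w) (by
        rw [smul_sub, sub_eq_zero, smul_smul, smul_smul, ← pow_succ]
        have := congrArg (fun t : k => t • f w) hd
        simpa [mul_comm] using this)
      simpa [sub_eq_zero] using this
    have : f = d • h - d • l := by
      rw [← smul_sub, ← hly, add_sub_cancel_left, smul_comm, hcf]
    rw [this]
    exact N.sub_mem (N.smul_mem _ (hmax N hN)) (N.smul_mem _ (hN.le hl))
  have : Nontrivial S := IsSimpleModule.nontrivial Λ S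
  obtain ⟨s, hs⟩ := exists_ne (0 : S)
  have hfin : Module.Finite k (S →ₗ[Λ] S) := by
    let ev : (S →ₗ[Λ] S) →ₗ[k] S :=
      { toFun := fun f => f s, map_add' := fun _ _ => rfl, map_smul' := fun _ _ => rfl }
    refine Module.Finite.of_injective ev ?_
    rw [← LinearMap.ker_eq_bot, LinearMap.ker_eq_bot']
    intro f hf
    rcases LinearMap.bijective_or_eq_zero f with h0 | h0
    · exact absurd (h0.1 (show f s = f 0 by simpa [ev] using hf)) hs
    · exact h0
  have hfl : IsFiniteLength k (S →ₗ[Λ] S) :=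
    isFiniteLength_iff_isNoetherian_isArtinian.2 ⟨inferInstance, inferInstance⟩
  let β : (S →ₗ[Λ] S) →ₗ[k] ((S →ₗ[Λ] S) →ₗ[k] ((W →ₗ[Λ] S) ⧸ L')) :=
    LinearMap.mk₂ k (fun d d' => L'.mkQ (d' ∘ₗ d ∘ₗ h))
      (fun d₁ d₂ d' => by rw [LinearMap.add_comp, LinearMap.comp_add, map_add])
      (fun c d d' => by
        rw [← map_smul]; congr 1; ext w; simp [LinearMap.map_smul_of_tower])
      (fun d d₁ d₂ => by rw [LinearMap.add_comp, map_add])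
      (fun c d d' => by rw [← map_smul]; rfl)
  have hβ : Function.Injective β := by
    rw [← LinearMap.ker_eq_bot, LinearMap.ker_eq_bot']
    intro d hd
    rcases LinearMap.bijective_or_eq_zero d with h0 | h0
    · exfalso
      let e := LinearEquiv.ofBijective d h0
      have h1 : L'.mkQ (e.symm.toLinearMap ∘ₗ d ∘ₗ h) = 0 := LinearMap.congr_fun hd _
      have h2 : e.symm.toLinearMap ∘ₗ d ∘ₗ h = h := by
        ext w; exact e.symm_apply_apply (h w)
      rw [h2] at h1
      exact hhL' (by simpa using h1)
    · exact h0
  have hle := length_linearMap_le (Q := (W →ₗ[Λ] S) ⧸ L') hfl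
  have hβs : Function.Surjective β := surjective_of_length_le
    (ne_top_of_le_ne_top (Module.length_ne_top_iff.2 hfl) hle) β hβ hle
  let U : (W →ₗ[Λ] S) → Prop := fun f => ∀ d : S →ₗ[Λ] S, d ∘ₗ f ∈ L'
  have hU : ∀ f, ∃ d : S →ₗ[Λ] S, U (f - d ∘ₗ h) := by
    intro f
    obtain ⟨d, hd⟩ := hβs
      { toFun := fun d' => L'.mkQ (d' ∘ₗ f)
        map_add' := fun d₁ d₂ => by rw [LinearMap.add_comp, map_add]
        map_smul' := fun c d' => by rw [RingHom.id_apply, ← map_smul]; rfl }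
    refine ⟨d, fun d' => ?_⟩
    have : L'.mkQ (d' ∘ₗ d ∘ₗ h) = L'.mkQ (d' ∘ₗ f) := LinearMap.congr_fun hd d'
    rw [LinearMap.comp_sub, ← L'.ker_mkQ, LinearMap.mem_ker, map_sub, this, sub_self]
  obtain ⟨V, hV, hVmin⟩ := wellFounded_lt.has_min
    {V : Submodule Λ W | ∀ f : W →ₗ[Λ] S, (∀ v ∈ V, f v = 0) → U f}
    ⟨⊤, fun f hf d => by
      have : f = 0 := LinearMap.ext fun w => hf w trivial
      simp [this]⟩
  have hVU : ∀ f, U f → ∀ v ∈ V, f v = 0 := by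
    intro f hf
    by_contra! hne
    obtain ⟨v₀, hv₀, hne⟩ := hne
    refine hVmin (V ⊓ LinearMap.ker f) (fun g hg => ?_) (lt_of_le_of_ne inf_le_left fun he =>
      hne (he.ge hv₀).2)
    have hsurj : Function.Surjective (f ∘ₗ V.subtype) :=
      (LinearMap.surjective_or_eq_zero _).resolve_right fun h0 =>
        hne (LinearMap.congr_fun h0 ⟨v₀, hv₀⟩)
    obtain ⟨d, hd⟩ := exists_comp_eq (f ∘ₗ V.subtype) hsurj (g ∘ₗ V.subtype)
      (fun v hv => hg v ⟨v.2, hv⟩)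
    have h1 : U (g - d ∘ₗ f) := hV _ fun v hv => by
      have : d (f v) = g v := hd ⟨v, hv⟩
      simp [this]
    intro d'
    have h2 := L'.add_mem (h1 d') (hf (d' ∘ₗ d))
    rwa [LinearMap.comp_assoc, ← LinearMap.comp_add, sub_add_cancel] at h2
  have hhV : ¬ V ≤ LinearMap.ker h := fun hle => hhL' (by
    simpa using hV h (fun v hv => hle hv) LinearMap.id)
  obtain ⟨V', ⟨hV'V, hhV'⟩, hV'min⟩ := wellFounded_lt.has_min
    {V' : Submodule Λ W | V' ≤ V ∧ ¬ V' ≤ LinearMap.ker h} ⟨V, le_rfl, hhV⟩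
  have hlt : ∀ A, A ≤ V' → A ≠ V' → A ≤ LinearMap.ker h := fun A hA hne => by
    by_contra hn
    exact hV'min A ⟨hA.trans hV'V, hn⟩ (lt_of_le_of_ne hA hne)
  refine ⟨V', ⟨fun hm => hhV' ?_, fun A B hAB => ?_⟩, fun l hl => ?_⟩
  · rw [isMin_iff_eq_bot] at hm
    simp [hm]
  · by_contra! hne
    exact hhV' (hAB ▸ sup_le (hlt A (hAB ▸ le_sup_left) hne.1) (hlt B (hAB ▸ le_sup_right) hne.2))
  · by_contra! heq
    obtain ⟨d, hd⟩ := hU (h - l)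
    have hd0 : d = 0 := by
      rcases LinearMap.bijective_or_eq_zero d with h0 | h0
      · refine absurd (fun v hv => ?_) hhV'
        have h1 := hVU _ hd v (hV'V hv)
        have h2 : d (h v) = 0 := by simpa [heq v hv] using h1
        exact h0.1 (by rw [h2, map_zero])
      · exact h0
    have h3 := hd LinearMap.id
    rw [hd0] at h3
    have h4 : h - l ∈ L' := by simpa using h3
    exact hhL' (by simpa using L'.add_mem h4 (hLL' hl))

lemma length_sup_le {R A : Type*} [Ring R] [AddCommGroup A] [Module R A] (P Q : Submodule R A) :
    Module.length R ↥(P ⊔ Q) ≤ Module.length R P + Module.length R Q := by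
  have h : P ⊔ Q = LinearMap.range (P.subtype.coprod Q.subtype) := by
    rw [LinearMap.range_coprod, Submodule.range_subtype, Submodule.range_subtype]
  rw [h, ← Module.length_prod]
  exact Module.length_le_of_surjective _ (LinearMap.surjective_rangeRestrict _)

/-- If all local submodules of `W` have length at most `p`, then a linear map from `W` to `C` which
avoids a `k`-submodule `L` of the space of all maps is still different from the members
of `L` on some submodule of length at most `p * |C|`. -/
lemma exists_submodule_of_not_mem [Module.Finite k Λ] [IsArtinian Λ W] {p : ℕ∞}
    (hp : ∀ V : Submodule Λ W, SupIrred V → Module.length Λ V ≤ p) {C : Type*} [AddCommGroup C]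
    [Module Λ C] [modC : Module k C] [tower : IsScalarTower k Λ C] (hC : IsFiniteLength Λ C)
    (L : Submodule k (W →ₗ[Λ] C)) {h : W →ₗ[Λ] C} (hL : h ∉ L) :
    ∃ W' : Submodule Λ W, Module.length Λ W' ≤ p * Module.length Λ C ∧
      ∀ l ∈ L, ∃ w ∈ W', h w ≠ l w := by
  induction hC generalizing modC tower with
  | of_subsingleton => exact absurd (Subsingleton.elim (0 : _ →ₗ[Λ] _) h ▸ L.zero_mem) hL
  | @of_simple_quotient C _ _ N _ _ ih =>
    obtain ⟨L', hLL', hhL', hmax⟩ := exists_maximal_not_mem L hL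
    let ι : (W →ₗ[Λ] N) →ₗ[k] (W →ₗ[Λ] C) :=
      { toFun := fun u => N.subtype ∘ₗ u
        map_add' := fun _ _ => rfl
        map_smul' := fun _ _ => rfl }
    let κ : (W →ₗ[Λ] C) →ₗ[k] (W →ₗ[Λ] (C ⧸ N)) :=
      { toFun := fun u => N.mkQ ∘ₗ u
        map_add' := fun _ _ => rfl
        map_smul' := fun _ _ => rfl }
    have e2 := Module.length_eq_add_of_exact N.subtype N.mkQ
      Subtype.val_injective N.mkQ_surjective (LinearMap.exact_subtype_mkQ N)
    rw [Module.length_eq_one Λ (C ⧸ N)] at e2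
    obtain ⟨W₁, hW₁l, hW₁⟩ : ∃ W₁ : Submodule Λ W,
        Module.length Λ W₁ ≤ p * Module.length Λ N ∧
        ∀ u : W →ₗ[Λ] N, (∀ w ∈ W₁, u w = 0) → ι u ∈ L' := by
      by_cases hr : LinearMap.range ι ≤ L'
      · exact ⟨⊥, by simp, fun u _ => hr ⟨u, rfl⟩⟩
      obtain ⟨l, hl, _, ⟨h', rfl⟩, hlh⟩ := Submodule.mem_sup.1
        (hmax _ (left_lt_sup.2 hr))
      obtain ⟨W₁, hW₁l, hW₁⟩ := ih (L'.comap ι) (h := h') (fun hh' => hhL' (by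
        rw [← hlh]; exact L'.add_mem hl hh'))
      refine ⟨W₁, hW₁l, fun u hu => ?_⟩
      by_contra hn
      have hsp : ¬ Submodule.span k {ι u} ≤ L' := fun hle =>
        hn (hle (Submodule.mem_span_singleton_self _))
      obtain ⟨l₂, hl₂, y, hy, hly⟩ := Submodule.mem_sup.1 (hmax _ (left_lt_sup.2 hsp))
      obtain ⟨c, rfl⟩ := Submodule.mem_span_singleton.1 hy
      obtain ⟨w, hw, hne⟩ := hW₁ (h' - c • u) (by
        rw [Submodule.mem_comap, map_sub, map_smul]
        have : ι h' - c • ι u = l₂ - l := by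
          rw [sub_eq_sub_iff_add_eq_add, hly, add_comm, hlh]
        rw [this]
        exact L'.sub_mem hl₂ hl)
      exact hne (by simp [hu w hw])
    by_cases h1 : ∀ l ∈ L', ∃ w ∈ W₁, h w ≠ l w
    · refine ⟨W₁, hW₁l.trans ?_, fun l hl => h1 l (hLL' hl)⟩
      rw [e2]
      gcongr
      exact le_self_add
    push Not at h1
    obtain ⟨l₀, hl₀, heq⟩ := h1
    let K : Submodule k (W →ₗ[Λ] C) :=
      { carrier := {u | ∀ w ∈ W₁, u w = 0}
        zero_mem' := fun _ _ => rfl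
        add_mem' := fun {a b} ha hb w hw => by simp [ha w hw, hb w hw]
        smul_mem' := fun c a ha w hw => by simp [ha w hw] }
    have hκ : κ (h - l₀) ∉ (L' ⊓ K).map κ := by
      rintro ⟨l, ⟨hl, hlK⟩, hlκ⟩
      have hN : ∀ w, (h - l₀ - l) w ∈ N := fun w => by
        have := LinearMap.congr_fun hlκ w
        rw [← Submodule.ker_mkQ N, LinearMap.mem_ker, LinearMap.sub_apply, map_sub, sub_eq_zero]
        exact this.symm
      have h2 := hW₁ ((h - l₀ - l).codRestrict N hN) (fun w hw => by
        apply Subtype.ext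
        have := hlK w hw
        simp [heq w hw, this])
      have h3 : ι ((h - l₀ - l).codRestrict N hN) = h - l₀ - l := rfl
      rw [h3] at h2
      apply hhL'
      simpa using L'.add_mem (L'.add_mem h2 hl) hl₀
    have hfin : Module.Finite k (C ⧸ N) := Module.Finite.trans Λ _
    obtain ⟨V, hV, hVL⟩ := exists_supIrred_of_not_mem _ hκ
    refine ⟨W₁ ⊔ V, (length_sup_le _ _).trans ?_, fun l hl => ?_⟩
    · rw [e2, mul_add, mul_one]
      exact add_le_add hW₁l (hp V hV)
    · by_contra! hcon
      obtain ⟨v, hv, hne⟩ := hVL (κ (l - l₀)) ⟨l - l₀, ⟨L'.sub_mem (hLL' hl) hl₀, fun w hw => by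
        rw [LinearMap.sub_apply, ← hcon w (Submodule.mem_sup_left hw), heq w hw, sub_self]⟩, rfl⟩
      refine hne ?_
      change N.mkQ (h v - l₀ v) = N.mkQ (l v - l₀ v)
      rw [hcon v (Submodule.mem_sup_right hv)]

end Hom

universe w

section Small

variable {k : Type*} [CommRing k]

lemma small_of_pow_smul_eq_zero (m : Ideal k) [hm : m.IsMaximal] [Small.{v} (k ⧸ m)] {n : ℕ}
    {A : Type*} [AddCommGroup A] [Module k A] (hA : IsFiniteLength k A)
    (h : ∀ r ∈ m ^ n, ∀ a : A, r • a = 0) : Small.{v} A := by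
  induction hA with
  | of_subsingleton => infer_instance
  | @of_simple_quotient A _ _ N hS _ ih =>
    have hN : Small.{v} N := ih fun r hr a => Subtype.ext (h r hr a)
    obtain ⟨I, hI, ⟨e⟩⟩ := isSimpleModule_iff_quot_maximal.1 hS
    have hle : m ^ n ≤ I := fun r hr => by
      obtain ⟨a, ha⟩ := N.mkQ_surjective (e.symm 1)
      have h1 : r • e.symm 1 = 0 := by rw [← ha, ← map_smul, h r hr, map_zero]
      rw [← map_smul, LinearEquiv.map_eq_zero_iff] at h1
      rw [← Ideal.Quotient.eq_zero_iff_mem, ← h1, Algebra.smul_def, mul_one]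
      rfl
    have hmI : m = I := hm.eq_of_le hI.ne_top (Ideal.IsPrime.le_of_pow_le hle)
    subst hmI
    have hQ : Small.{v} (A ⧸ N) := small_of_injective e.injective
    let f : A → (A ⧸ N) × N := fun a => (N.mkQ a, ⟨a - (N.mkQ a).out, by
      have : ∀ b ∈ LinearMap.ker N.mkQ, b ∈ N := fun b hb => by rwa [Submodule.ker_mkQ] at hb
      refine this _ ?_
      rw [LinearMap.mem_ker, map_sub, sub_eq_zero]
      exact (Quotient.out_eq' (N.mkQ a)).symm⟩)
    refine small_of_injective (f := f) fun a b hab => ?_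
    simp only [f, Prod.mk.injEq, Subtype.mk.injEq] at hab
    rw [hab.1] at hab
    simpa using hab.2

/-- An idempotent which cuts out a block of `k` acting nontrivially on `A`; all modules of finite
length over this block are as small as `A`. -/
lemma exists_idempotent [IsArtinianRing k] {A : Type v} [AddCommGroup A] [Module k A]
    [IsArtinian k A] [Nontrivial A] : ∃ e : k, e * e = e ∧ (∃ y : A, y ≠ 0 ∧ e • y = 0) ∧
      ∀ (B : Type w) [AddCommGroup B] [Module k B], IsFiniteLength k B →
        (∀ b : B, e • b = 0) → Small.{v} B := by
  obtain ⟨T, hT, -⟩ := (eq_bot_or_exists_atom_le (⊤ : Submodule k A)).resolve_left top_ne_bot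
  obtain ⟨m, hm, ⟨f⟩⟩ := isSimpleModule_iff_quot_maximal.1 (isSimpleModule_iff_isAtom.2 hT)
  obtain ⟨n, hn⟩ := IsArtinian.monotone_stabilizes
    (⟨fun n => OrderDual.toDual (m ^ n), fun a b hab => Ideal.pow_le_pow_right hab⟩ :
      ℕ →o (Submodule k k)ᵒᵈ)
  have hn' : ∀ i, n ≤ i → m ^ n = m ^ i := hn
  have hid : IsIdempotentElem (m ^ (n + 1)) := by
    rw [IsIdempotentElem, ← pow_add, ← hn' (n + 1) (by omega), ← hn' (n + 1 + (n + 1)) (by omega)]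
  obtain ⟨e, he, hme⟩ := (Ideal.isIdempotentElem_iff_of_fg _ (IsNoetherian.noetherian _)).1 hid
  have hem : e ∈ m := Ideal.pow_le_self n.succ_ne_zero
    (hme.ge (Submodule.mem_span_singleton_self e))
  have : Small.{v} (k ⧸ m) := small_of_injective f.symm.injective
  refine ⟨e, he, ⟨f.symm 1, ?_, ?_⟩, fun B _ _ hB h0 => ?_⟩
  · simp
  · have : e • f.symm 1 = 0 := by
      rw [← map_smul, Algebra.smul_def, mul_one, LinearEquiv.map_eq_zero_iff]
      exact Ideal.Quotient.eq_zero_iff_mem.2 hem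
    exact congrArg Subtype.val this
  · refine small_of_pow_smul_eq_zero m (n := n + 1) hB fun r hr b => ?_
    obtain ⟨s, rfl⟩ := Submodule.mem_span_singleton.1 (hme.le hr)
    rw [smul_assoc, h0, smul_zero]

lemma smul_eq_zero_of_indecMod {Λ : Type*} [Ring Λ] [Algebra k Λ] {A : Type*} [AddCommGroup A]
    [Module Λ A] [Module k A] [IsScalarTower k Λ A] (hA : IndecMod Λ A) {e : k} (he : e * e = e)
    {y : A} (hy : y ≠ 0) (hey : e • y = 0) (a : A) : e • a = 0 := by
  let f : A →ₗ[Λ] A := e • LinearMap.id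
  have hf : ∀ a, f (f a) = f a := fun a => by
    change e • e • a = e • a
    rw [smul_smul, he]
  have hc : IsCompl (LinearMap.range f) (LinearMap.ker f) := by
    constructor
    · rw [Submodule.disjoint_def]
      rintro _ ⟨x, rfl⟩ hx
      rw [LinearMap.mem_ker, hf] at hx
      exact hx
    · rw [codisjoint_iff, eq_top_iff]
      intro x _
      exact Submodule.mem_sup.2 ⟨f x, ⟨x, rfl⟩, x - f x, by simp [hf], by simp⟩
  rcases (indecMod_iff.1 hA).2 _ _ hc with h0 | h0
  · exact LinearMap.congr_fun (LinearMap.range_eq_bot.1 h0) a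
  · exact absurd ((Submodule.mem_bot Λ).1 (h0.le (show y ∈ LinearMap.ker f from hey))) hy

lemma isFiniteLength_of_finite [IsArtinianRing k] (A : Type*) [AddCommGroup A] [Module k A]
    [Module.Finite k A] : IsFiniteLength k A :=
  isFiniteLength_iff_isNoetherian_isArtinian.2 ⟨inferInstance, inferInstance⟩

end Small

section Projective

lemma exists_eq_span_of_supIrred {Λ : Type*} [Ring Λ] {W : Type*} [AddCommGroup W]
    [Module Λ W] [IsNoetherian Λ W] {V : Submodule Λ W} (hV : SupIrred V) : ∃ x, V = Submodule.span Λ {x} := by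
  obtain ⟨U, hU, hmax⟩ := wellFounded_gt.has_min {U : Submodule Λ W | U < V}
    ⟨⊥, bot_lt_iff_ne_bot.2 hV.ne_bot⟩
  obtain ⟨x, hxV, hxU⟩ := SetLike.exists_of_lt (show U < V from hU)
  have hle : U ⊔ Submodule.span Λ {x} ≤ V :=
    sup_le (le_of_lt hU) ((Submodule.span_singleton_le_iff_mem _ _).2 hxV)
  have heq : U ⊔ Submodule.span Λ {x} = V := by
    by_contra hne
    refine hmax _ (lt_of_le_of_ne hle hne) (left_lt_sup.2 fun h => hxU ?_)
    exact h (Submodule.mem_span_singleton_self x)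
  exact ⟨x, ((hV.2 heq).resolve_left (ne_of_lt hU)).symm⟩

/-- The projective cover of a local module, as a left ideal. -/
lemma exists_projective_leftIdeal {Λ : Type*} [Ring Λ] [IsArtinianRing Λ] {W : Type*}
    [AddCommGroup W] [Module Λ W] {V : Submodule Λ W} (hV : SupIrred V) (φ : Λ →ₗ[Λ] W) (hφ : LinearMap.range φ = V) :
    ∃ P : Submodule Λ Λ, IndecMod Λ P ∧ Module.Projective Λ P ∧ P.map φ = V := by
  obtain ⟨P, ⟨⟨Q, hPQ⟩, hPV⟩, hmin⟩ := wellFounded_lt.has_min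
    {P : Submodule Λ Λ | (∃ Q, IsCompl P Q) ∧ P.map φ = V}
    ⟨⊤, ⟨⊥, isCompl_top_bot⟩, by rw [Submodule.map_top, hφ]⟩
  have key : ∀ A B : Submodule Λ Λ, A ⊔ B = P → A ⊓ B = ⊥ → A.map φ = V → B = ⊥ := by
    intro A B hs hi hA
    have hAP : A = P := by
      by_contra hne
      refine hmin A ⟨⟨B ⊔ Q, ?_, ?_⟩, hA⟩ (lt_of_le_of_ne (hs ▸ le_sup_left) hne)
      · exact (disjoint_iff.2 hi).disjoint_sup_right_of_disjoint_sup_left (hs ▸ hPQ.disjoint)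
      · rw [codisjoint_iff, ← sup_assoc, hs, hPQ.sup_eq_top]
    rw [← hi, hAP, right_eq_inf, ← hs]
    exact le_sup_right
  refine ⟨P, (indecSub_iff P).1 ⟨?_, fun A B _ _ hs hi => ?_⟩, ?_, hPV⟩
  · rintro rfl
    exact hV.ne_bot (by rw [← hPV, Submodule.map_bot])
  · have h : A.map φ ⊔ B.map φ = V := by rw [← Submodule.map_sup, hs, hPV]
    rcases hV.2 h with h | h
    · exact .inr (key A B hs hi h)
    · exact .inl (key B A (by rwa [sup_comm]) (by rwa [inf_comm]) h)
  · refine Module.Projective.of_split P.subtype (P.projectionOnto Q hPQ) ?_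
    ext x
    exact congrArg Subtype.val (Submodule.projectionOnto_apply_left hPQ x)

lemma length_le_of_supIrred (k : Type*) [CommRing k] [IsArtinianRing k] {Λ : Type u} [Ring Λ]
    [Algebra k Λ] [Module.Finite k Λ] {p : ℕ∞}
    (hp : p ∈ upperBounds {n : ℕ∞ | ∃ P : ModuleCat.{v} Λ, IsFiniteLength Λ P ∧
      IndecMod Λ P ∧ Module.Projective Λ P ∧ modLen Λ P = n})
    {W : Type v} [AddCommGroup W] [Module Λ W] (hW : IsFiniteLength Λ W)
    {V : Submodule Λ W} (hV : SupIrred V) : Module.length Λ V ≤ p := by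
  obtain ⟨_, _⟩ := isFiniteLength_iff_isNoetherian_isArtinian.1 hW
  have : IsArtinianRing Λ := IsArtinianRing.of_finite k Λ
  obtain ⟨x, hx⟩ := exists_eq_span_of_supIrred hV
  obtain ⟨P, hP, hPp, hPV⟩ := exists_projective_leftIdeal hV (LinearMap.toSpanSingleton Λ W x)
    (by rw [LinearMap.range_toSpanSingleton, hx])
  let _ : Module k W := Module.compHom W (algebraMap k Λ)
  have : IsScalarTower k Λ W := ⟨fun r l w => by rw [Algebra.smul_def, mul_smul]; rfl⟩
  have : Nontrivial V := (Submodule.nontrivial_iff_ne_bot).2 hV.ne_bot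
  have : Module.Finite k V := Module.Finite.trans Λ V
  obtain ⟨e, he, ⟨y, hy, hey⟩, hsmall⟩ := exists_idempotent (k := k) (A := V)
  obtain ⟨z, hz, hzy⟩ := Submodule.mem_map.1 (hPV.ge y.2)
  have hPe : ∀ b : P, e • b = 0 := by
    refine smul_eq_zero_of_indecMod hP he (y := ⟨z, hz⟩ - e • ⟨z, hz⟩) (fun h0 => hy ?_) ?_
    · have h1 := congrArg (fun b : P => LinearMap.toSpanSingleton Λ W x b) h0
      simp only [Submodule.coe_sub, map_sub, Submodule.coe_smul_of_tower,
        LinearMap.map_smul_of_tower, hzy] at h1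
      have h2 : e • (y : W) = 0 := congrArg Subtype.val hey
      apply Subtype.ext
      simpa [h2] using h1
    · rw [smul_sub, smul_smul, he, sub_self]
  have hkP : IsFiniteLength k P := isFiniteLength_of_finite _
  have : Small.{v} P := hsmall P hkP hPe
  let E := Shrink.linearEquiv.{v} Λ P
  have h1 := hp ⟨ModuleCat.of Λ (Shrink.{v} P), ?_, IndecMod.congr E.symm hP,
    Module.Projective.of_equiv E.symm, rfl⟩
  · change modLen Λ (Shrink.{v} P) ≤ p at h1
    rw [modLen, ← Module.length_eq_height, E.length_eq] at h1
    subst hPV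
    exact (Module.length_le_of_surjective _ (LinearMap.submoduleMap_surjective _ P)).trans h1
  · have hΛ : IsFiniteLength Λ Λ :=
      isFiniteLength_iff_isNoetherian_isArtinian.2 ⟨inferInstance, inferInstance⟩
    exact hΛ.of_injective (f := P.subtype ∘ₗ E.toLinearMap)
      (P.injective_subtype.comp E.injective)

end Projective

section Injective

lemma baer_of_retraction {Λ : Type*} [Ring Λ] {I J : Type*} [AddCommGroup I] [Module Λ I]
    [AddCommGroup J] [Module Λ J] (hJ : Module.Baer Λ J) (i : I →ₗ[Λ] J) (r : J →ₗ[Λ] I)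
    (h : ∀ x, r (i x) = x) : Module.Baer Λ I := fun a g => by
  obtain ⟨g', hg'⟩ := hJ a (i ∘ₗ g)
  exact ⟨r ∘ₗ g', fun x hx => by simp [hg' x hx, h]⟩

lemma baer_prod {Λ : Type*} [Ring Λ] {I J : Type*} [AddCommGroup I] [Module Λ I]
    [AddCommGroup J] [Module Λ J] (hI : Module.Baer Λ I) (hJ : Module.Baer Λ J) :
    Module.Baer Λ (I × J) := fun a g => by
  obtain ⟨g₁, h₁⟩ := hI a (LinearMap.fst Λ I J ∘ₗ g)
  obtain ⟨g₂, h₂⟩ := hJ a (LinearMap.snd Λ I J ∘ₗ g)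
  exact ⟨g₁.prod g₂, fun x hx => Prod.ext (h₁ x hx) (h₂ x hx)⟩

lemma exists_maximal_disjoint {Λ : Type*} [Ring Λ] {J : Type*} [AddCommGroup J] [Module Λ J]
    (I : Submodule Λ J) : ∃ N : Submodule Λ J, Disjoint N I ∧
      ∀ N', N ≤ N' → Disjoint N' I → N' ≤ N := by
  obtain ⟨N, -, hmax⟩ := zorn_le_nonempty₀ {N : Submodule Λ J | Disjoint N I} (by
    intro c hc hchain y hy
    refine ⟨sSup c, ?_, fun z hz => le_sSup hz⟩
    rw [Set.mem_ofPred_eq, Submodule.disjoint_def]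
    intro x hx hxI
    obtain ⟨z, hz, hxz⟩ := (Submodule.mem_sSup_of_directed ⟨y, hy⟩ hchain.directedOn).1 hx
    exact Submodule.disjoint_def.1 (hc hz) x hxz hxI) ⊥ disjoint_bot_left
  exact ⟨N, hmax.1, fun N' h h' => hmax.2 h' h⟩

/-- An injective hull of a submodule of an injective module, for a submodule which is contained
in every nonzero submodule of the hull. -/
lemma exists_baer_submodule {Λ : Type*} [Ring Λ] {J : Type*} [AddCommGroup J] [Module Λ J]
    (hJ : Module.Baer Λ J) (S : Submodule Λ J)
    (hS : ∀ u ∈ S, u ≠ 0 → S ≤ Submodule.span Λ {u}) :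
    ∃ I : Submodule Λ J, S ≤ I ∧ (∀ u ∈ I, u ≠ 0 → S ≤ Submodule.span Λ {u}) ∧
      Module.Baer Λ I := by
  obtain ⟨I, hSI, hmax⟩ := zorn_le_nonempty₀
    {I : Submodule Λ J | ∀ u ∈ I, u ≠ 0 → S ≤ Submodule.span Λ {u}} (by
      intro c hc hchain y hy
      refine ⟨sSup c, fun u hu => ?_, fun z hz => le_sSup hz⟩
      obtain ⟨z, hz, huz⟩ := (Submodule.mem_sSup_of_directed ⟨y, hy⟩ hchain.directedOn).1 hu
      exact hc hz u huz) S hS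
  have hI : ∀ u ∈ I, u ≠ 0 → S ≤ Submodule.span Λ {u} := hmax.1
  obtain ⟨N, hN, hNmax⟩ := exists_maximal_disjoint I
  let ψ : I →ₗ[Λ] J ⧸ N := N.mkQ ∘ₗ I.subtype
  have hψ : Function.Injective ψ := by
    rw [← LinearMap.ker_eq_bot, LinearMap.ker_eq_bot']
    intro x hx
    have hx' : (x : J) ∈ N := by simpa [ψ] using hx
    exact Subtype.ext (Submodule.disjoint_def.1 hN x hx' x.2)
  obtain ⟨g, hg⟩ := hJ.extension_property ψ hψ I.subtype
  have hg' : ∀ x ∈ I, g (N.mkQ x) = x := fun x hx => LinearMap.congr_fun hg ⟨x, hx⟩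
  have hmem : LinearMap.range (g ∘ₗ N.mkQ) ≤ I := by
    refine hmax.2 ?_ fun x hx => ⟨x, hg' x hx⟩
    rintro _ ⟨y, rfl⟩ hu
    have hyN : y ∉ N := fun h => hu (by
      have : N.mkQ y = 0 := by simpa using h
      simp only [LinearMap.comp_apply, this, map_zero])
    have hnd : ¬ Disjoint (N ⊔ Submodule.span Λ {y}) I := fun h =>
      hyN (hNmax _ le_sup_left h (Submodule.mem_sup_right (Submodule.mem_span_singleton_self y)))
    rw [Submodule.disjoint_def] at hnd
    push Not at hnd
    obtain ⟨x, hx, hxI, hx0⟩ := hnd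
    obtain ⟨n, hn, z, hz, rfl⟩ := Submodule.mem_sup.1 hx
    obtain ⟨c, rfl⟩ := Submodule.mem_span_singleton.1 hz
    refine (hI _ hxI hx0).trans ((Submodule.span_singleton_le_iff_mem _ _).2
      (Submodule.mem_span_singleton.2 ⟨c, ?_⟩))
    have hn0 : N.mkQ n = 0 := by simpa using hn
    rw [← hg' _ hxI, map_add, hn0, zero_add, map_smul, map_smul]
    rfl
  exact ⟨I, hSI, hI, baer_of_retraction hJ I.subtype
    ((g ∘ₗ N.mkQ).codRestrict I fun x => hmem ⟨x, rfl⟩) fun x => Subtype.ext (hg' x x.2)⟩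

lemma isNoetherian_linearMap {k : Type*} [CommRing k] {Λ : Type*} [Ring Λ] [Algebra k Λ]
    {I : Type*} [AddCommGroup I] [Module Λ I] [Module k I] [IsScalarTower k Λ I]
    (S : Submodule Λ I) (hS0 : S ≠ ⊥) (hS : ∀ u, u ≠ 0 → S ≤ Submodule.span Λ {u})
    [IsNoetherian k S] {A : Type*} [AddCommGroup A] [Module Λ A] (hA : IsFiniteLength Λ A) :
    IsNoetherian k (A →ₗ[Λ] I) := by
  induction hA with
  | of_subsingleton => infer_instance
  | @of_simple_quotient A _ _ N _ _ ih =>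
    obtain ⟨a, ha⟩ := exists_not_mem_of_isSimpleModule_quotient N
    let ρ : (A →ₗ[Λ] I) →ₗ[k] (N →ₗ[Λ] I) :=
      { toFun := fun f => f ∘ₗ N.subtype
        map_add' := fun _ _ => rfl
        map_smul' := fun _ _ => rfl }
    have hker : ∀ f ∈ LinearMap.ker ρ, N ≤ LinearMap.ker f := fun f hf n hn =>
      LinearMap.congr_fun (show f ∘ₗ N.subtype = 0 from hf) ⟨n, hn⟩
    have hfa : ∀ f ∈ LinearMap.ker ρ, f a ∈ S := by
      intro f hf
      by_cases h0 : f a = 0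
      · simp [h0]
      obtain ⟨s, hs, hs0⟩ := Submodule.exists_mem_ne_zero_of_ne_bot hS0
      obtain ⟨c, rfl⟩ := Submodule.mem_span_singleton.1 (hS _ h0 hs)
      rw [← map_smul] at hs hs0
      refine mem_of_mem_of_isSimpleModule_quotient N (S.comap f) (fun n hn => ?_)
        (a := c • a) (fun hN => hs0 (hker f hf hN)) hs a
      rw [Submodule.mem_comap, show f n = 0 from hker f hf hn]
      exact S.zero_mem
    let ev : LinearMap.ker ρ →ₗ[k] S :=
      { toFun := fun f => ⟨f.1 a, hfa f.1 f.2⟩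
        map_add' := fun _ _ => rfl
        map_smul' := fun _ _ => rfl }
    have hev : Function.Injective ev := by
      rw [← LinearMap.ker_eq_bot, LinearMap.ker_eq_bot']
      rintro ⟨f, hf⟩ h0
      apply Subtype.ext
      ext b
      exact mem_of_mem_of_isSimpleModule_quotient N _ (hker f hf) ha
        (show f a = 0 from congrArg Subtype.val h0) b
    have : IsNoetherian k (LinearMap.ker ρ) := isNoetherian_of_injective ev hev
    exact isNoetherian_of_range_eq_ker (LinearMap.ker ρ).subtype ρ (Submodule.range_subtype _)

lemma exists_baer_embedding {Λ : Type u} [Ring Λ] (S : Type v) [AddCommGroup S] [Module Λ S] :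
    ∃ J : ModuleCat.{max u v} Λ, Module.Baer Λ J ∧ ∃ ι : S →ₗ[Λ] J, Function.Injective ι := by
  obtain ⟨⟨J, hJ, f, hf⟩⟩ :=
    CategoryTheory.EnoughInjectives.presentation (ModuleCat.of Λ (ULift.{u} S))
  have : Module.Injective Λ J :=
    @Module.injective_module_of_injective_object Λ J _ _ _ hJ
  exact ⟨J, Module.Baer.of_injective this, f.hom ∘ₗ ULift.moduleEquiv.symm.toLinearMap,
    ((ModuleCat.mono_iff_injective f).1 hf).comp ULift.moduleEquiv.symm.injective⟩

lemma exists_baer_of_isSimpleModule (k : Type*) [CommRing k] [IsArtinianRing k] {Λ : Type u}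
    [Ring Λ] [Algebra k Λ] [Module.Finite k Λ] {q : ℕ∞}
    (hq : q ∈ upperBounds {n : ℕ∞ | ∃ Q : ModuleCat.{v} Λ, IsFiniteLength Λ Q ∧
      IndecMod Λ Q ∧ Module.Injective Λ Q ∧ modLen Λ Q = n})
    (S : Type v) [AddCommGroup S] [Module Λ S] [IsSimpleModule Λ S] :
    ∃ I : ModuleCat.{v} Λ, Module.Baer Λ I ∧ IsFiniteLength Λ I ∧ Module.length Λ I ≤ q ∧
      ∃ j : S →ₗ[Λ] I, Function.Injective j := by
  have : IsArtinianRing Λ := IsArtinianRing.of_finite k Λ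
  obtain ⟨J, hJ, ι, hι⟩ := exists_baer_embedding (Λ := Λ) S
  have : Nontrivial S := IsSimpleModule.nontrivial Λ S
  have hT : ∀ u ∈ LinearMap.range ι, u ≠ 0 → LinearMap.range ι ≤ Submodule.span Λ {u} := by
    intro u hu h0
    have : IsSimpleModule Λ (LinearMap.range ι) :=
      IsSimpleModule.congr (LinearEquiv.ofInjective ι hι).symm
    refine (((isSimpleModule_iff_isAtom.1 this).le_iff.1
      ((Submodule.span_singleton_le_iff_mem _ _).2 hu)).resolve_left fun h => h0 ?_).ge
    simpa using h
  obtain ⟨I, hTI, hI, hIB⟩ := exists_baer_submodule hJ _ hT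
  let _ : Module k J := Module.compHom J (algebraMap k Λ)
  have : IsScalarTower k Λ J := ⟨fun r l w => by rw [Algebra.smul_def, mul_smul]; rfl⟩
  let _ : Module k S := Module.compHom S (algebraMap k Λ)
  have : IsScalarTower k Λ S := ⟨fun r l w => by rw [Algebra.smul_def, mul_smul]; rfl⟩
  have : Module.Finite k S := Module.Finite.trans Λ S
  let j : S →ₗ[Λ] I := ι.codRestrict I fun s => hTI ⟨s, rfl⟩
  have hj : Function.Injective j := fun a b hab => hι (congrArg Subtype.val hab)
  have hjI : ∀ u : I, u ≠ 0 → LinearMap.range j ≤ Submodule.span Λ {u} := by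
    rintro u hu _ ⟨s, rfl⟩
    obtain ⟨c, hc⟩ := Submodule.mem_span_singleton.1
      (hI u u.2 (fun h => hu (Subtype.ext h)) ⟨s, rfl⟩)
    exact Submodule.mem_span_singleton.2 ⟨c, Subtype.ext hc⟩
  obtain ⟨s, hs⟩ := exists_ne (0 : S)
  have hj0 : LinearMap.range j ≠ ⊥ := fun h => hs (hj (by
    rw [LinearMap.range_eq_bot.1 h]; simp))
  have : Module.Finite k (LinearMap.range j) := Module.Finite.trans Λ _
  have : IsNoetherian k (Λ →ₗ[Λ] I) := isNoetherian_linearMap (LinearMap.range j) hj0 hjI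
    (isFiniteLength_iff_isNoetherian_isArtinian.2 ⟨inferInstance, inferInstance⟩)
  have : IsNoetherian k I := isNoetherian_of_linearEquiv (LinearMap.ringLmapEquivSelf Λ k I)
  have : IsNoetherian Λ I := isNoetherian_of_tower k inferInstance
  have : IsArtinian Λ I := isArtinian_of_tower k inferInstance
  have hIfl : IsFiniteLength Λ I :=
    isFiniteLength_iff_isNoetherian_isArtinian.2 ⟨inferInstance, inferInstance⟩
  have hind : IndecMod Λ I := by
    refine indecMod_iff.2 ⟨⟨⟨j s, 0, fun h => hs (hj (by simpa using h))⟩⟩, fun A B hAB => ?_⟩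
    by_contra! hne
    obtain ⟨a, ha, ha0⟩ := Submodule.exists_mem_ne_zero_of_ne_bot hne.1
    obtain ⟨b, hb, hb0⟩ := Submodule.exists_mem_ne_zero_of_ne_bot hne.2
    refine hj0 (le_bot_iff.1 ?_)
    rw [← hAB.inf_eq_bot]
    exact le_inf ((hjI a ha0).trans ((Submodule.span_singleton_le_iff_mem _ _).2 ha))
      ((hjI b hb0).trans ((Submodule.span_singleton_le_iff_mem _ _).2 hb))
  obtain ⟨e, he, ⟨y, hy, hey⟩, hsmall⟩ := exists_idempotent (k := k) (A := S)
  have hIs : Small.{v} I := hsmall I (isFiniteLength_of_finite _)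
    (smul_eq_zero_of_indecMod hind he (y := j y) (fun h => hy (hj (by simpa using h))) (by
      rw [← LinearMap.map_smul_of_tower, hey, map_zero]))
  let E := Shrink.linearEquiv.{v} Λ I
  have hB : Module.Baer Λ (Shrink.{v} I) := hIB.of_equiv E.symm
  have hfl : IsFiniteLength Λ (Shrink.{v} I) := hIfl.of_injective (f := E.toLinearMap) E.injective
  refine ⟨ModuleCat.of Λ (Shrink.{v} I), hB, hfl, ?_, E.symm.toLinearMap ∘ₗ j,
    E.symm.injective.comp hj⟩
  rw [Module.length_eq_height]
  exact hq ⟨ModuleCat.of Λ (Shrink.{v} I), hfl, IndecMod.congr E.symm hind, hB.injective, rfl⟩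

lemma exists_baer_of_isFiniteLength (k : Type*) [CommRing k] [IsArtinianRing k] {Λ : Type u}
    [Ring Λ] [Algebra k Λ] [Module.Finite k Λ] {q : ℕ∞}
    (hq : q ∈ upperBounds {n : ℕ∞ | ∃ Q : ModuleCat.{v} Λ, IsFiniteLength Λ Q ∧
      IndecMod Λ Q ∧ Module.Injective Λ Q ∧ modLen Λ Q = n})
    (X : Type v) [AddCommGroup X] [Module Λ X] (hX : IsFiniteLength Λ X) :
    ∃ I : ModuleCat.{v} Λ, Module.Baer Λ I ∧ IsFiniteLength Λ I ∧
      Module.length Λ I ≤ q * Module.length Λ X ∧ ∃ j : X →ₗ[Λ] I, Function.Injective j := by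
  induction hX with
  | of_subsingleton =>
    exact ⟨ModuleCat.of Λ PUnit, fun _ _ => ⟨0, fun _ _ => Subsingleton.elim _ _⟩,
      .of_subsingleton, by rw [Module.length_eq_zero]; simp, 0,
      Function.injective_of_subsingleton _⟩
  | @of_simple_quotient X _ _ N _ _ ih =>
    obtain ⟨I₁, hB₁, hfl₁, hl₁, j₁, hj₁⟩ := ih
    obtain ⟨I₂, hB₂, hfl₂, hl₂, j₂, hj₂⟩ := exists_baer_of_isSimpleModule k hq (X ⧸ N)
    obtain ⟨t, ht⟩ := hB₁.extension_property N.subtype N.injective_subtype j₁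
    have e2 := Module.length_eq_add_of_exact N.subtype N.mkQ
      Subtype.val_injective N.mkQ_surjective (LinearMap.exact_subtype_mkQ N)
    rw [Module.length_eq_one Λ (X ⧸ N)] at e2
    have hle : Module.length Λ (I₁ × I₂) ≤ q * Module.length Λ X := by
      rw [Module.length_prod, e2, mul_add, mul_one]
      exact add_le_add hl₁ hl₂
    refine ⟨ModuleCat.of Λ (I₁ × I₂), baer_prod hB₁ hB₂, ?_, hle, t.prod (j₂ ∘ₗ N.mkQ), ?_⟩
    · refine Module.length_ne_top_iff.1 ?_
      change Module.length Λ (I₁ × I₂) ≠ ⊤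
      rw [Module.length_prod]
      exact WithTop.add_ne_top.2
        ⟨Module.length_ne_top_iff.2 hfl₁, Module.length_ne_top_iff.2 hfl₂⟩
    · rw [← LinearMap.ker_eq_bot, LinearMap.ker_eq_bot']
      intro x hx
      have h1 : t x = 0 := congrArg Prod.fst hx
      have h2 : j₂ (N.mkQ x) = 0 := congrArg Prod.snd hx
      have hxN : x ∈ N := by
        have := hj₂ (h2.trans (map_zero j₂).symm)
        simpa using this
      have h3 : j₁ ⟨x, hxN⟩ = t x := (LinearMap.congr_fun ht ⟨x, hxN⟩).symm
      exact congrArg Subtype.val (hj₁ ((h3.trans h1).trans (map_zero j₁).symm))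

end Injective

section Main

/-- A non-split embedding of `X` is already non-split as an embedding into some submodule of
length at most `p * q * |X|`. -/
lemma exists_submodule_of_not_split (k : Type*) [CommRing k] [IsArtinianRing k] {Λ : Type u}
    [Ring Λ] [Algebra k Λ] [Module.Finite k Λ] {p q : ℕ∞} (hp1 : 1 ≤ p)
    (hp : p ∈ upperBounds {n : ℕ∞ | ∃ P : ModuleCat.{v} Λ, IsFiniteLength Λ P ∧
      IndecMod Λ P ∧ Module.Projective Λ P ∧ modLen Λ P = n})
    (hq : q ∈ upperBounds {n : ℕ∞ | ∃ Q : ModuleCat.{v} Λ, IsFiniteLength Λ Q ∧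
      IndecMod Λ Q ∧ Module.Injective Λ Q ∧ modLen Λ Q = n})
    {X Y : Type v} [AddCommGroup X] [Module Λ X] [AddCommGroup Y] [Module Λ Y]
    (hX : IsFiniteLength Λ X) (hY : IsFiniteLength Λ Y) (i : X →ₗ[Λ] Y)
    (hi : Function.Injective i) (hno : ¬ ∃ r : Y →ₗ[Λ] X, ∀ x, r (i x) = x) :
    ∃ Y' : Submodule Λ Y, Module.length Λ Y' ≤ p * q * Module.length Λ X ∧
      ∃ i' : X →ₗ[Λ] Y', Function.Injective i' ∧ ¬ ∃ r : Y' →ₗ[Λ] X, ∀ x, r (i' x) = x := by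
  obtain ⟨_, _⟩ := isFiniteLength_iff_isNoetherian_isArtinian.1 hY
  obtain ⟨I, hB, hI, hIl, j, hj⟩ := exists_baer_of_isFiniteLength k hq X hX
  let π := (LinearMap.range j).mkQ
  let _ : Module k I := Module.compHom I (algebraMap k Λ)
  have : IsScalarTower k Λ I := ⟨fun r l w => by rw [Algebra.smul_def, mul_smul]; rfl⟩
  obtain ⟨jY, hjY⟩ := hB.extension_property i hi j
  have hjY' : ∀ x, jY (i x) = j x := LinearMap.congr_fun hjY
  let L : Submodule k (Y →ₗ[Λ] I ⧸ LinearMap.range j) :=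
    { carrier := {l | ∃ t : Y →ₗ[Λ] I, (∀ x, t (i x) = 0) ∧ ∀ y, l y = π (t y)}
      zero_mem' := ⟨0, fun _ => rfl, fun _ => by simp⟩
      add_mem' := fun {l₁ l₂} ⟨t₁, h₁, h₁'⟩ ⟨t₂, h₂, h₂'⟩ =>
        ⟨t₁ + t₂, fun x => by simp [h₁, h₂], fun y => by simp [h₁', h₂']⟩
      smul_mem' := fun c l ⟨t, h, h'⟩ =>
        ⟨c • t, fun x => by simp [h], fun y => by
          rw [LinearMap.smul_apply, LinearMap.smul_apply, h', LinearMap.map_smul_of_tower]⟩ }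
  have retr : ∀ (Z : Type v) [AddCommGroup Z] [Module Λ Z] (i' : X →ₗ[Λ] Z) (s : Z →ₗ[Λ] I),
      (∀ x, s (i' x) = j x) → (∀ z, π (s z) = 0) → ∃ r : Z →ₗ[Λ] X, ∀ x, r (i' x) = x := by
    intro Z _ _ i' s hs hz
    have hmem : ∀ z, s z ∈ LinearMap.range j := fun z => by simpa [π] using hz z
    refine ⟨(LinearEquiv.ofInjective j hj).symm.toLinearMap ∘ₗ s.codRestrict _ hmem,
      fun x => hj ?_⟩
    have := (LinearEquiv.ofInjective j hj).apply_symm_apply (s.codRestrict _ hmem (i' x))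
    exact (congrArg Subtype.val this).trans (hs x)
  have hL : π ∘ₗ jY ∉ L := by
    rintro ⟨t, ht, hπt⟩
    refine hno (retr Y i (jY - t) (fun x => by simp [hjY', ht]) fun y => ?_)
    rw [LinearMap.sub_apply, map_sub, sub_eq_zero]
    exact hπt y
  have e2 := Module.length_eq_add_of_exact (LinearMap.range j).subtype π
    Subtype.val_injective (Submodule.mkQ_surjective _) (LinearMap.exact_subtype_mkQ _)
  rw [← (LinearEquiv.ofInjective j hj).length_eq] at e2
  obtain ⟨Y', hY'l, hY'⟩ := exists_submodule_of_not_mem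
    (fun V hV => length_le_of_supIrred k hp hY hV)
    (hI.of_surjective (Submodule.mkQ_surjective (LinearMap.range j))) L hL
  refine ⟨Y' ⊔ LinearMap.range i, ?_,
    i.codRestrict _ fun x => Submodule.mem_sup_right ⟨x, rfl⟩,
    fun a b hab => hi (congrArg Subtype.val hab), ?_⟩
  · calc Module.length Λ ↥(Y' ⊔ LinearMap.range i)
        ≤ Module.length Λ Y' + Module.length Λ (LinearMap.range i) := length_sup_le _ _
      _ ≤ p * Module.length Λ (I ⧸ LinearMap.range j) + p * Module.length Λ X := by
        rw [← (LinearEquiv.ofInjective i hi).length_eq]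
        gcongr
        exact le_mul_of_one_le_left' hp1
      _ = p * Module.length Λ I := by rw [e2, mul_add, add_comm]
      _ ≤ p * (q * Module.length Λ X) := by gcongr
      _ = p * q * Module.length Λ X := (mul_assoc _ _ _).symm
  · rintro ⟨r, hr⟩
    obtain ⟨t, ht⟩ := hB.extension_property (Y' ⊔ LinearMap.range i).subtype
      (Submodule.injective_subtype _) (jY ∘ₗ (Y' ⊔ LinearMap.range i).subtype - j ∘ₗ r)
    have ht' : ∀ y (hy : y ∈ Y' ⊔ LinearMap.range i), t y = jY y - j (r ⟨y, hy⟩) :=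
      fun y hy => LinearMap.congr_fun ht ⟨y, hy⟩
    obtain ⟨w, hw, hne⟩ := hY' (π ∘ₗ t) ⟨t, fun x => by
      have h1 := hr x
      rw [ht' _ (Submodule.mem_sup_right ⟨x, rfl⟩), hjY', sub_eq_zero]
      exact congrArg j h1.symm, fun _ => rfl⟩
    apply hne
    have h0 : π (j (r ⟨w, Submodule.mem_sup_left hw⟩)) = 0 := by simp [π]
    rw [LinearMap.comp_apply, LinearMap.comp_apply, ht' w (Submodule.mem_sup_left hw), map_sub,
      h0, sub_zero]

lemma indecMod_of_isSimpleModule {Λ : Type u} [Ring Λ] {T : Type*} [AddCommGroup T] [Module Λ T]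
    [IsSimpleModule Λ T] : IndecMod Λ T := by
  refine indecMod_iff.2 ⟨IsSimpleModule.nontrivial Λ T, fun A B hAB => ?_⟩
  rcases eq_bot_or_eq_top A with h | h
  · exact .inl h
  · exact .inr (by rw [← hAB.inf_eq_bot, h, top_inf_eq])

lemma exists_indec_of_proper {Λ : Type u} [Ring Λ] {Y : Type v} [AddCommGroup Y] [Module Λ Y]
    (hY : IsFiniteLength Λ Y) (hY1 : 1 < Module.length Λ Y) :
    ∃ X : Submodule Λ Y, IndecMod Λ X ∧ X ≠ ⊤ := by
  obtain ⟨_, _⟩ := isFiniteLength_iff_isNoetherian_isArtinian.1 hY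
  have : Nontrivial Y := by
    by_contra h
    rw [not_nontrivial_iff_subsingleton] at h
    rw [Module.length_eq_zero] at hY1
    exact absurd hY1 (by simp)
  obtain ⟨T, hT, -⟩ := (eq_bot_or_exists_atom_le (⊤ : Submodule Λ Y)).resolve_left top_ne_bot
  have : IsSimpleModule Λ T := isSimpleModule_iff_isAtom.2 hT
  refine ⟨T, indecMod_of_isSimpleModule, ?_⟩
  rintro rfl
  rw [← Module.length_top, Module.length_eq_one Λ (⊤ : Submodule Λ Y)] at hY1
  exact lt_irrefl _ hY1

/-- An indecomposable module whose indecomposable proper submodules have length at most `a` has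
length at most `p * q * a`. -/
lemma length_le_of_forall_proper (k : Type*) [CommRing k] [IsArtinianRing k] {Λ : Type u}
    [Ring Λ] [Algebra k Λ] [Module.Finite k Λ] {p q : ℕ∞} (hp1 : 1 ≤ p)
    (hp : p ∈ upperBounds {n : ℕ∞ | ∃ P : ModuleCat.{v} Λ, IsFiniteLength Λ P ∧
      IndecMod Λ P ∧ Module.Projective Λ P ∧ modLen Λ P = n})
    (hq : q ∈ upperBounds {n : ℕ∞ | ∃ Q : ModuleCat.{v} Λ, IsFiniteLength Λ Q ∧
      IndecMod Λ Q ∧ Module.Injective Λ Q ∧ modLen Λ Q = n})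
    {Y : Type v} [AddCommGroup Y] [Module Λ Y] (hY : IsFiniteLength Λ Y) (hYi : IndecMod Λ Y)
    (hY1 : 1 < Module.length Λ Y) (a : ℕ∞)
    (ha : ∀ X : Submodule Λ Y, IndecMod Λ X → X ≠ ⊤ → Module.length Λ X ≤ a) :
    Module.length Λ Y ≤ p * q * a := by
  obtain ⟨_, _⟩ := isFiniteLength_iff_isNoetherian_isArtinian.1 hY
  have hYt := Module.length_ne_top_iff.2 hY
  obtain ⟨L, hL⟩ := ENat.ne_top_iff_exists.1 hYt
  have hsub : ∀ X : Submodule Λ Y, Module.length Λ X ≤ L := fun X =>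
    (Module.length_le_of_injective X.subtype X.injective_subtype).trans hL.ge
  let s : Set ℕ := {n | ∃ X : Submodule Λ Y, IndecMod Λ X ∧ X ≠ ⊤ ∧ measure Λ L X = n}
  have hs : BddAbove s := ⟨2 ^ L, by
    rintro _ ⟨X, hX, -, rfl⟩
    exact measure_le_pow hX (hsub X)⟩
  obtain ⟨X₀, hX₀, hX₀t⟩ := exists_indec_of_proper hY hY1
  obtain ⟨X, hX, hXt, hXs⟩ := Nat.sSup_mem (s := s) ⟨_, X₀, hX₀, hX₀t, rfl⟩ hs
  have := (indecMod_iff.1 hX).1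
  obtain ⟨Y', hY'l, i', hi', hno⟩ := exists_submodule_of_not_split k hp1 hp hq
    (hY.of_injective X.injective_subtype) hY X.subtype X.injective_subtype (by
      rintro ⟨r, hr⟩
      have := surjective_of_retraction hYi X.subtype r hr
      exact hXt (by rw [← LinearMap.range_eq_top.2 this, Submodule.range_subtype]))
  by_contra! hlt
  have hY't : Y' ≠ ⊤ := by
    rintro rfl
    rw [Module.length_top] at hY'l
    exact (hY'l.trans (by gcongr; exact ha X hX hXt)).not_gt hlt
  refine hno (exists_retraction hX (hsub X) i' hi' fun y hy => ?_)
  obtain ⟨Z, hZ, g, hg⟩ := exists_indec_map Y' (hY.of_injective Y'.injective_subtype) y hy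
  refine ⟨ModuleCat.of Λ Z, hZ, ?_, ?_, g, hg⟩
  · exact (Module.length_le_of_injective Z.subtype Z.injective_subtype).trans (hsub Y')
  · let Z' : Submodule Λ Y := Z.map Y'.subtype
    let E : Z ≃ₗ[Λ] Z' := Submodule.equivMapOfInjective _ Y'.injective_subtype Z
    have hZ' : IndecMod Λ Z' := IndecMod.congr E hZ
    have hle : Z' ≤ Y' := Submodule.map_subtype_le _ _
    refine (measure_le hZ hZ' (hsub Z') E.toLinearMap E.injective).trans ?_
    rw [hXs]
    exact le_csSup hs ⟨Z', hZ', fun h => hY't (top_le_iff.1 (h ▸ hle)), rfl⟩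

end Main

end GabrielRoiter

/-- With `p`, `q` as before, let `M` be an indecomposable finite length
module and `1 ≤ a < |M|`. Then there is an indecomposable submodule `M'` of `M` whose
length lies in the interval `[a+1, p·q·a]`. -/
theorem gabriel_roiter_stmt5
    (k : Type u) [CommRing k] [IsArtinianRing k]
    (Λ : Type u) [Ring Λ] [Algebra k Λ] [Module.Finite k Λ]
    (p q : ℕ∞)
    (hp : IsGreatest {n : ℕ∞ | ∃ P : ModuleCat.{v} Λ, IsFiniteLength Λ P ∧
      IndecMod Λ P ∧ Module.Projective Λ P ∧ modLen Λ P = n} p)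
    (hq : IsGreatest {n : ℕ∞ | ∃ Q : ModuleCat.{v} Λ, IsFiniteLength Λ Q ∧
      IndecMod Λ Q ∧ Module.Injective Λ Q ∧ modLen Λ Q = n} q)
    (M : Type v) [AddCommGroup M] [Module Λ M] (hMfl : IsFiniteLength Λ M)
    (hMind : IndecMod Λ M)
    (a : ℕ) (ha1 : 1 ≤ a) (ha : (a : ℕ∞) < modLen Λ M) :
    ∃ M' : Submodule Λ M, IndecSub Λ M' ∧
      (a : ℕ∞) + 1 ≤ Order.height M' ∧ Order.height M' ≤ p * q * (a : ℕ∞) := by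
  have hp1 : 1 ≤ p := by
    obtain ⟨P, _, hP, _, rfl⟩ := hp.1
    have := (GabrielRoiter.indecMod_iff (Λ := Λ).1 hP).1
    rw [modLen, ← Module.length_eq_height]
    exact Order.one_le_iff_pos.2 (Module.length_pos_iff.2 this)
  obtain ⟨_, _⟩ := isFiniteLength_iff_isNoetherian_isArtinian.1 hMfl
  obtain ⟨Y, ⟨hYi, hYa⟩, hmin⟩ := wellFounded_lt.has_min
    {N : Submodule Λ M | IndecSub Λ N ∧ (a : ℕ∞) < Order.height N} ⟨⊤, hMind, ha⟩
  refine ⟨Y, hYi, Order.add_one_le_of_lt hYa, ?_⟩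
  rw [← Module.length_submodule] at hYa ⊢
  refine GabrielRoiter.length_le_of_forall_proper k hp1 hp.2 hq.2
    (hMfl.of_injective Y.injective_subtype) ((GabrielRoiter.indecSub_iff Y).1 hYi)
    (lt_of_le_of_lt (by exact_mod_cast ha1) hYa) a fun X hX hXt => ?_
  by_contra! hlt
  let E : X ≃ₗ[Λ] X.map Y.subtype := Submodule.equivMapOfInjective _ Y.injective_subtype X
  refine hmin (X.map Y.subtype)
    ⟨(GabrielRoiter.indecSub_iff _).2 (GabrielRoiter.IndecMod.congr E hX), ?_⟩
    (lt_of_le_of_ne (Submodule.map_subtype_le _ _) fun h => hXt ?_)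
  · rwa [← Module.length_submodule, ← E.length_eq]
  · apply Submodule.map_injective_of_injective Y.injective_subtype
    rw [h, Submodule.map_subtype_top]
end

section
/- Let Λ be an artin algebra, Y a finite length Λ-module and U an indecomposable submodule of Y. Then U is a piling submodule of Y if and only if μ(Y) starts with μ(U), that is, if and only if μ(U) = μ(Y) ∩ {1, 2, …, |U|} when Gabriel-Roiter measures are regarded as finite sets of natural numbers. -/
/-!
Setting: `k` is a commutative artinian ring and `Λ` an artin `k`-algebra
(an algebra over `k` which is finitely generated as a `k`-module).
All modules considered are `Λ`-modules of finite length (`IsFiniteLength Λ M`),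
and `|M|` denotes the length of `M`, implemented as the height
`Order.height (⊤ : Submodule Λ M)` of the lattice of submodules
(for a submodule `N` of an ambient module, its length is `Order.height N`).
-/

universe u v

open Submodule

namespace GabrielRoiter

/-- The real number `Σ_{i ∈ I} 2^{-i}` attached to a finite set of natural numbers. -/
noncomputable def binSum (I : Finset ℕ) : ℝ := ∑ i ∈ I, (2 : ℝ) ^ (-(i : ℤ))

theorem binSum_nonneg (I : Finset ℕ) : 0 ≤ binSum I :=
  Finset.sum_nonneg fun _ _ => by positivity

theorem binSum_Ioc (m n : ℕ) (h : m ≤ n) :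
    binSum (Finset.Ioc m n) = (2 : ℝ) ^ (-(m : ℤ)) - (2 : ℝ) ^ (-(n : ℤ)) := by
  induction n, h using Nat.le_induction with
  | base => simp [binSum]
  | succ n h ih =>
    have hI : Finset.Ioc m (n + 1) = insert (n + 1) (Finset.Ioc m n) := by
      ext i
      simp only [Finset.mem_insert, Finset.mem_Ioc]
      omega
    have h2 : (2 : ℝ) ^ (-(n : ℤ)) = 2 * (2 : ℝ) ^ (-((n + 1 : ℕ) : ℤ)) := by
      rw [← zpow_one_add₀ (two_ne_zero)]
      congr 1
      push_cast
      ring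
    rw [binSum] at ih
    rw [binSum, hI, Finset.sum_insert (by simp), ih, h2]
    ring

theorem binSum_lt_of_forall_lt {I : Finset ℕ} {m : ℕ} (hI : ∀ i ∈ I, m < i) :
    binSum I < (2 : ℝ) ^ (-(m : ℤ)) := by
  have hsub : I ⊆ Finset.Ioc m (m + I.sup id) := fun i hi =>
    Finset.mem_Ioc.2 ⟨hI i hi, (Finset.le_sup (f := id) hi).trans (Nat.le_add_left _ _)⟩
  calc binSum I ≤ binSum (Finset.Ioc m (m + I.sup id)) :=
        Finset.sum_le_sum_of_subset_of_nonneg hsub fun _ _ _ => by positivity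
    _ < _ := by
        rw [binSum_Ioc _ _ (Nat.le_add_right _ _)]
        exact sub_lt_self _ (by positivity)

theorem exists_binSum_eq_mul {I : Finset ℕ} {m : ℕ} (hI : ∀ i ∈ I, i ≤ m) :
    ∃ z : ℤ, binSum I = z * (2 : ℝ) ^ (-(m : ℤ)) := by
  refine ⟨∑ i ∈ I, 2 ^ (m - i), ?_⟩
  rw [binSum]
  push_cast
  rw [Finset.sum_mul]
  refine Finset.sum_congr rfl fun i hi => ?_
  rw [← zpow_natCast, ← zpow_add₀ (two_ne_zero)]
  congr 1
  have := hI i hi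
  omega

/-- Truncation of the binary expansion preserves lower bounds of that precision. -/
theorem binSum_le_binSum_filter {S I : Finset ℕ} {m : ℕ} (hS : ∀ i ∈ S, i ≤ m)
    (h : binSum S ≤ binSum I) : binSum S ≤ binSum (I.filter (fun i => i ≤ m)) := by
  obtain ⟨a, ha⟩ := exists_binSum_eq_mul hS
  obtain ⟨b, hb⟩ := exists_binSum_eq_mul (I := I.filter (fun i => i ≤ m)) (m := m)
    fun i hi => (Finset.mem_filter.1 hi).2
  have ht : binSum (I.filter (fun i => ¬ i ≤ m)) < (2 : ℝ) ^ (-(m : ℤ)) :=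
    binSum_lt_of_forall_lt fun i hi => not_le.1 (Finset.mem_filter.1 hi).2
  have hsplit : binSum (I.filter (fun i => i ≤ m)) + binSum (I.filter (fun i => ¬ i ≤ m))
      = binSum I := Finset.sum_filter_add_sum_filter_not I _ _
  have hpos : (0 : ℝ) < (2 : ℝ) ^ (-(m : ℤ)) := by positivity
  have hlt : (a : ℝ) * (2 : ℝ) ^ (-(m : ℤ)) < (b + 1) * (2 : ℝ) ^ (-(m : ℤ)) := by
    linarith
  have hab : (a : ℝ) < b + 1 := lt_of_mul_lt_mul_right hlt hpos.le
  have hab' : a ≤ b := Int.lt_add_one_iff.1 (by exact_mod_cast hab)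
  rw [ha, hb]
  exact mul_le_mul_of_nonneg_right (by exact_mod_cast hab') hpos.le

variable {Λ : Type u} [Ring Λ] {Y : Type v} [AddCommGroup Y] [Module Λ Y]

theorem height_ne_top (hY : IsFiniteLength Λ Y) (N : Submodule Λ Y) :
    Order.height N ≠ ⊤ := by
  have h := Module.length_ne_top_iff.2 hY
  refine ne_top_of_le_ne_top h ?_
  rw [← WithBot.coe_le_coe, Module.coe_length]
  exact Order.height_le_krullDim N

theorem subLen_lt_subLen (hY : IsFiniteLength Λ Y) {M N : Submodule Λ Y} (h : M < N) :
    subLen Λ M < subLen Λ N := by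
  have h1 := Order.height_strictMono h (height_ne_top hY M).lt_top
  rw [← ENat.natCast_toNat (height_ne_top hY M), ← ENat.natCast_toNat (height_ne_top hY N)] at h1
  exact_mod_cast h1

theorem subLen_pos (hY : IsFiniteLength Λ Y) {N : Submodule Λ Y} (h : N ≠ ⊥) :
    0 < subLen Λ N :=
  (Nat.zero_le _).trans_lt (subLen_lt_subLen hY (bot_lt_iff_ne_bot.2 h))

theorem muAux_bot (n : ℕ) : muAux Λ n (⊥ : Submodule Λ Y) = 0 := by
  cases n with
  | zero => rfl
  | succ n => simp [muAux, IndecSub]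

theorem mu_bot : mu Λ (⊥ : Submodule Λ Y) = 0 := muAux_bot _

theorem muAux_eq_mu (hY : IsFiniteLength Λ Y) (n : ℕ) :
    ∀ N : Submodule Λ Y, subLen Λ N ≤ n → muAux Λ n N = mu Λ N := by
  induction n using Nat.strong_induction_on with
  | _ n ih =>
    intro N hN
    by_cases hbot : N = ⊥
    · rw [hbot, muAux_bot, mu_bot]
    have hpos := subLen_pos hY hbot
    obtain ⟨l, hl⟩ := Nat.exists_eq_succ_of_ne_zero hpos.ne'
    obtain ⟨n, rfl⟩ := Nat.exists_eq_succ_of_ne_zero (hpos.trans_le hN).ne'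
    rw [mu, hl, muAux, muAux]
    congr 2
    refine Set.image_congr fun M hM => ?_
    have hlt := subLen_lt_subLen hY hM
    rw [ih n (by omega) M (by omega), ih l (by omega) M (by omega)]

open Classical in
/-- The defining recursion of the Gabriel-Roiter measure. -/
theorem mu_eq (hY : IsFiniteLength Λ Y) {N : Submodule Λ Y} (hN : N ≠ ⊥) :
    mu Λ N = (if IndecSub Λ N then (2 : ℝ) ^ (-(subLen Λ N : ℤ)) else 0)
      + sSup (mu Λ '' {M : Submodule Λ Y | M < N}) := by
  obtain ⟨l, hl⟩ := Nat.exists_eq_succ_of_ne_zero (subLen_pos hY hN).ne'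
  rw [mu, hl, muAux, hl]
  congr 2
  refine Set.image_congr fun M hM => ?_
  have hlt := subLen_lt_subLen hY hM
  exact muAux_eq_mu hY l M (by omega)

theorem finite_image_mu {s : Set (Submodule Λ Y)} {n : ℕ}
    (h : ∀ M ∈ s, ∃ I : Finset ℕ, (∀ i ∈ I, i ≤ n) ∧ mu Λ M = binSum I) :
    (mu Λ '' s).Finite := by
  refine (((Finset.range (n + 1)).powerset.image binSum).finite_toSet).subset ?_
  rintro _ ⟨M, hM, rfl⟩
  obtain ⟨I, hI, hMI⟩ := h M hM
  rw [Finset.mem_coe, Finset.mem_image]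
  refine ⟨I, Finset.mem_powerset.2 fun i hi => ?_, hMI.symm⟩
  exact Finset.mem_range.2 (Nat.lt_succ_of_le (hI i hi))

/-- The Gabriel-Roiter measure is `binSum I` for a finite set `I` of positive numbers, all of
whose nonempty initial segments are realized by indecomposable submodules. -/
theorem exists_mu_eq_binSum (hY : IsFiniteLength Λ Y) (N : Submodule Λ Y) :
    ∃ I : Finset ℕ, (∀ i ∈ I, 0 < i ∧ i ≤ subLen Λ N) ∧ mu Λ N = binSum I ∧
      ∀ m, I.filter (fun i => i ≤ m) = ∅ ∨ ∃ X : Submodule Λ Y,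
        IndecSub Λ X ∧ subLen Λ X ≤ m ∧ mu Λ X = binSum (I.filter (fun i => i ≤ m)) := by
  induction hn : subLen Λ N using Nat.strong_induction_on generalizing N with
  | _ n ih =>
    subst hn
    by_cases hbot : N = ⊥
    · refine ⟨∅, by simp, ?_, by simp⟩
      rw [hbot, mu_bot, binSum, Finset.sum_empty]
    have hfin : (mu Λ '' {M : Submodule Λ Y | M < N}).Finite := by
      refine finite_image_mu (n := subLen Λ N) fun M hM => ?_
      have hlt := subLen_lt_subLen hY hM
      obtain ⟨I, hI, hMI, -⟩ := ih _ hlt M rfl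
      exact ⟨I, fun i hi => (hI i hi).2.trans hlt.le, hMI⟩
    have hne : (mu Λ '' {M : Submodule Λ Y | M < N}).Nonempty :=
      ⟨_, ⊥, bot_lt_iff_ne_bot.2 hbot, rfl⟩
    obtain ⟨M, hM, hsup⟩ := hne.csSup_mem hfin
    have hlt := subLen_lt_subLen hY hM
    obtain ⟨I, hI, hMI, hseg⟩ := ih _ hlt M rfl
    have hmu := mu_eq hY hbot
    rw [← hsup, hMI] at hmu
    by_cases hind : IndecSub Λ N
    · have hnot : subLen Λ N ∉ I := fun h => (hI _ h).2.not_gt hlt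
      rw [if_pos hind] at hmu
      have hmu' : mu Λ N = binSum (insert (subLen Λ N) I) := by
        rw [hmu, binSum, binSum, Finset.sum_insert hnot]
      refine ⟨insert (subLen Λ N) I, ?_, hmu', fun m => ?_⟩
      · intro i hi
        rcases Finset.mem_insert.1 hi with rfl | hi
        · exact ⟨subLen_pos hY hbot, le_rfl⟩
        · exact ⟨(hI i hi).1, (hI i hi).2.trans hlt.le⟩
      · by_cases hm : subLen Λ N ≤ m
        · refine Or.inr ⟨N, hind, hm, ?_⟩
          rw [Finset.filter_true_of_mem, hmu']
          intro i hi
          rcases Finset.mem_insert.1 hi with rfl | hi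
          · exact hm
          · exact ((hI i hi).2.trans hlt.le).trans hm
        · rw [Finset.filter_insert, if_neg hm]
          exact hseg m
    · rw [if_neg hind, zero_add] at hmu
      exact ⟨I, fun i hi => ⟨(hI i hi).1, (hI i hi).2.trans hlt.le⟩, hmu, hseg⟩

theorem mu_mono (hY : IsFiniteLength Λ Y) {M N : Submodule Λ Y} (h : M ≤ N) :
    mu Λ M ≤ mu Λ N := by
  rcases h.eq_or_lt with rfl | h
  · exact le_rfl
  rw [mu_eq hY (ne_bot_of_gt h)]
  have hfin : (mu Λ '' {M : Submodule Λ Y | M < N}).Finite := by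
    refine finite_image_mu (n := subLen Λ N) fun M hM => ?_
    obtain ⟨I, hI, hMI, -⟩ := exists_mu_eq_binSum hY M
    exact ⟨I, fun i hi => (hI i hi).2.trans (subLen_lt_subLen hY hM).le, hMI⟩
  refine (le_csSup hfin.bddAbove ⟨M, h, rfl⟩).trans (le_add_of_nonneg_left ?_)
  split_ifs
  · positivity
  · exact le_rfl

theorem subLen_le_subLen_iff (hY : IsFiniteLength Λ Y) {M N : Submodule Λ Y} :
    subLen Λ M ≤ subLen Λ N ↔ Order.height M ≤ Order.height N := by
  conv_rhs => rw [← ENat.natCast_toNat (height_ne_top hY M), ← ENat.natCast_toNat (height_ne_top hY N)]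
  exact Nat.cast_le.symm

end GabrielRoiter

/-- An indecomposable submodule `U` of a finite length module `Y` is
piling if and only if `μ(Y)` starts with `μ(U)`: writing the two Gabriel-Roiter measures
as finite sets `I` and `J` of (positive) natural numbers — identifying a finite set
`I ⊆ ℕ` with the rational number `Σ_{i ∈ I} 2^{-i}` — one has
`J = I ∩ {1, 2, …, |U|}`. -/
theorem gabriel_roiter_stmt8
    (k : Type u) [CommRing k] [IsArtinianRing k]
    (Λ : Type u) [Ring Λ] [Algebra k Λ] [Module.Finite k Λ]
    (Y : Type v) [AddCommGroup Y] [Module Λ Y] (hYfl : IsFiniteLength Λ Y)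
    (U : Submodule Λ Y) (hU : IndecSub Λ U) :
    IsPilingSub Λ U ↔
      ∃ I J : Finset ℕ, (∀ i ∈ I, 0 < i) ∧ (∀ j ∈ J, 0 < j) ∧
        mu Λ (⊤ : Submodule Λ Y) = ∑ i ∈ I, (2 : ℝ) ^ (-(i : ℤ)) ∧
        mu Λ U = ∑ j ∈ J, (2 : ℝ) ^ (-(j : ℤ)) ∧
        J = I.filter (fun i => i ≤ subLen Λ U) := by
  open GabrielRoiter in
  constructor
  · rintro ⟨-, hpil⟩
    obtain ⟨I, hI, hYI, hseg⟩ := exists_mu_eq_binSum hYfl (⊤ : Submodule Λ Y)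
    obtain ⟨S, hS, hUS, -⟩ := exists_mu_eq_binSum hYfl U
    refine ⟨I, I.filter (fun i => i ≤ subLen Λ U), fun i hi => (hI i hi).1,
      fun j hj => (hI j (Finset.mem_filter.1 hj).1).1, hYI, ?_, rfl⟩
    refine le_antisymm ?_ ?_
    · have hle := mu_mono hYfl (le_top : U ≤ ⊤)
      rw [hUS, hYI] at hle
      rw [hUS]
      exact binSum_le_binSum_filter (fun i hi => (hS i hi).2) hle
    · rcases hseg (subLen Λ U) with h | ⟨X, hX, hlen, hmu⟩
      · rw [h, Finset.sum_empty, hUS]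
        exact binSum_nonneg S
      · exact hmu.symm.le.trans (hpil X hX ((subLen_le_subLen_iff hYfl).1 hlen))
  · rintro ⟨I, J, -, -, hYI, hUJ, rfl⟩
    refine ⟨hU, fun V _ hVU => ?_⟩
    obtain ⟨S, hS, hVS, -⟩ := exists_mu_eq_binSum hYfl V
    have hle := mu_mono hYfl (le_top : V ≤ ⊤)
    rw [hVS, hYI] at hle
    rw [hVS, hUJ]
    exact binSum_le_binSum_filter
      (fun i hi => (hS i hi).2.trans ((subLen_le_subLen_iff hYfl).2 hVU)) hle
end
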